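/- arXiv:1706.07687 — 4 statements merged into one kernel-verified Lean document; each statement's English description precedes it below -/
import Mathlib

section
/- Let K ⊆ ℝ² be a detour set whose complementary components are Jordan regions when regarded as subsets of the Riemann sphere (i.e., each bounded component Ω_k, k ≥ 1, is a Jordan region, and the unbounded component Ω₀ is an unbounded Jordan region). Then diam(Ω_k) → 0 as k → ∞. -/
open MeasureTheory Metric Set Filter
open scoped ENNReal NNReal Topology

/-- The line through the point `w` in the direction `v`. -/
def lineThrough {n : ℕ} (w v : EuclideanSpace ℝ (Fin n)) : Set (EuclideanSpace ℝ (Fin n)) :=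
  {x | ∃ t : ℝ, x = w + t • v}

/-- The line `L` has the detour property with respect to the family `Ω` of complementary
components and the closed ball `B`: for every `ε > 0` there is a path `γ` whose trace lies
within Hausdorff distance `ε` of `L ∩ B`, such that (i) the trace of `γ` is contained in
`⋃ k, closure (Ω k)`; (ii) `γ` meets only finitely many of the sets `closure (Ω k)`; and
(iii) every `closure (Ω k)` met by `γ` is also met by `L`. -/
def HasDetourProperty {n : ℕ} (Ω : ℕ → Set (EuclideanSpace ℝ (Fin n)))
    (B : Set (EuclideanSpace ℝ (Fin n))) (L : Set (EuclideanSpace ℝ (Fin n))) : Prop :=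
  ∀ ε > (0 : ℝ), ∃ γ : ℝ → EuclideanSpace ℝ (Fin n), ContinuousOn γ (Icc 0 1) ∧
    hausdorffDist (γ '' Icc 0 1) (L ∩ B) ≤ ε ∧
    γ '' Icc 0 1 ⊆ ⋃ k, closure (Ω k) ∧
    {k | (γ '' Icc 0 1 ∩ closure (Ω k)).Nonempty}.Finite ∧
    {k | (γ '' Icc 0 1 ∩ closure (Ω k)).Nonempty} ⊆ {k | (L ∩ closure (Ω k)).Nonempty}

/-- `K` is a detour set with complementary components `Ω 0, Ω 1, Ω 2, …`:
`K` is compact, `Ω` is an injective enumeration of the (infinitely many) connected components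
of the complement of `K`, with `Ω 0` the unbounded component and `Ω k`, `k ≥ 1`, the bounded
ones, and there exist a closed ball `B` containing `K` in its interior and `n` linearly
independent directions such that, for each of these directions, almost every line parallel to
it (lines parallel to `v` being parametrized by the points of the orthogonal complement of `v`,
equipped with its Lebesgue measure) has the detour property. -/
structure IsDetourSet (n : ℕ) (K : Set (EuclideanSpace ℝ (Fin n)))
    (Ω : ℕ → Set (EuclideanSpace ℝ (Fin n))) : Prop where
  compact : IsCompact K
  inj : Function.Injective Ω
  component : ∀ k, ∃ x ∈ Kᶜ, Ω k = connectedComponentIn Kᶜ x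
  surj : ∀ x ∈ Kᶜ, ∃ k, Ω k = connectedComponentIn Kᶜ x
  unbounded : ¬ Bornology.IsBounded (Ω 0)
  bounded : ∀ k : ℕ, k ≠ 0 → Bornology.IsBounded (Ω k)
  detour : ∃ (x : EuclideanSpace ℝ (Fin n)) (r : ℝ), 0 < r ∧ K ⊆ ball x r ∧
    ∃ v : Fin n → EuclideanSpace ℝ (Fin n), LinearIndependent ℝ v ∧
      ∀ i : Fin n, ∀ᵐ w : ↥(Submodule.span ℝ {v i})ᗮ,
        HasDetourProperty Ω (closedBall x r)
          (lineThrough (w : EuclideanSpace ℝ (Fin n)) (v i))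

/-- A Jordan curve in the plane: the homeomorphic (equivalently, continuous injective) image
of a circle. -/
def IsJordanCurve (J : Set (EuclideanSpace ℝ (Fin 2))) : Prop :=
  ∃ f : Metric.sphere (0 : EuclideanSpace ℝ (Fin 2)) 1 → EuclideanSpace ℝ (Fin 2),
    Continuous f ∧ Function.Injective f ∧ Set.range f = J

/-- A Jordan region: an open subset of the plane whose boundary is a Jordan curve. -/
def IsJordanRegion (Ω : Set (EuclideanSpace ℝ (Fin 2))) : Prop :=
  IsOpen Ω ∧ IsJordanCurve (frontier Ω)

/-- An unbounded Jordan region: `∂Ω` is a Jordan curve and `Ω` is the unbounded connected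
component of the complement of `∂Ω`. -/
def IsUnboundedJordanRegion (Ω : Set (EuclideanSpace ℝ (Fin 2))) : Prop :=
  IsJordanCurve (frontier Ω) ∧ ¬ Bornology.IsBounded Ω ∧
    ∃ x ∈ Ω, Ω = connectedComponentIn (frontier Ω)ᶜ x

/-- Intermediate value: a continuous function that never takes the value `a` and starts above `a`
stays above `a`. -/
theorem stay_above {h : ℝ → ℝ} (hc : Continuous h) {a : ℝ} (hne : ∀ s, h s ≠ a) {s t : ℝ}
    (hs : a < h s) : a < h t := by
  by_contra hcon
  obtain ⟨z, hz⟩ := mem_range_of_exists_le_of_exists_ge hc ⟨t, not_lt.mp hcon⟩ ⟨s, hs.le⟩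
  exact hne z hz

theorem stay_below {h : ℝ → ℝ} (hc : Continuous h) {a : ℝ} (hne : ∀ s, h s ≠ a) {s t : ℝ}
    (hs : h s < a) : h t < a := by
  by_contra hcon
  obtain ⟨z, hz⟩ := mem_range_of_exists_le_of_exists_ge hc ⟨s, hs.le⟩ ⟨t, not_lt.mp hcon⟩
  exact hne z hz

/-- The topological crossing lemma, in terms of a difference map into the punctured plane. -/
theorem crossing_complex (F : C(ℝ × ℝ, ℂ)) (hF : ∀ p, F p ≠ 0)
    (hb : ∀ s, 0 < (F (s, 0)).im) (ht : ∀ s, (F (s, 1)).im < 0)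
    (hl : ∀ t, (F (0, t)).im = 0 → (F (0, t)).re < 0)
    (hr : ∀ t, (F (1, t)).im = 0 → 0 < (F (1, t)).re) : False := by
  have : SimplyConnectedSpace (ℝ × ℝ) := inferInstance
  obtain ⟨f, ⟨hf0, hf⟩, -⟩ := Complex.isCoveringMapOn_exp.existsUnique_continuousMap_lifts
    F (a₀ := ((0 : ℝ), (0 : ℝ))) (Complex.exp_log (hF _)) (fun p => hF p)
  have hfe : ∀ p, Complex.exp (f p) = F p := fun p => congrFun hf p
  have him : ∀ p, (F p).im = Real.exp (f p).re * Real.sin (f p).im := fun p => by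
    rw [← hfe, Complex.exp_im]
  have hre : ∀ p, (F p).re = Real.exp (f p).re * Real.cos (f p).im := fun p => by
    rw [← hfe, Complex.exp_re]
  have hpos : ∀ p, 0 < Real.exp (f p).re := fun p => Real.exp_pos _
  have hcs : ∀ t, Continuous fun s : ℝ => (f (s, t)).im := fun t =>
    Complex.continuous_im.comp (f.continuous.comp (by fun_prop))
  have hct : ∀ s, Continuous fun t : ℝ => (f (s, t)).im := fun s =>
    Complex.continuous_im.comp (f.continuous.comp (by fun_prop))
  have h00 : 0 < (f (0, 0)).im ∧ (f (0, 0)).im < Real.pi := by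
    have h1 := hb 0
    have h2 : (f (0, 0)).im = Complex.arg (F (0, 0)) := by rw [hf0, Complex.log_im]
    have hs := him (0, 0)
    have hsin : 0 < Real.sin (f (0, 0)).im := by
      rw [hs] at h1
      exact pos_of_mul_pos_right h1 (hpos _).le
    have h3 := Complex.neg_pi_lt_arg (F (0, 0))
    have h4 := Complex.arg_le_pi (F (0, 0))
    rw [← h2] at h3 h4
    constructor
    · by_contra hc
      have := Real.sin_nonpos_of_nonpos_of_neg_pi_le (not_lt.mp hc) h3.le
      linarith
    · refine lt_of_le_of_ne h4 fun h => ?_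
      rw [h, Real.sin_pi] at hsin
      exact lt_irrefl _ hsin
  -- bottom
  have h10 : 0 < (f (1, 0)).im ∧ (f (1, 0)).im < Real.pi := by
    refine ⟨stay_above (hcs 0) (fun s h => ?_) h00.1, stay_below (hcs 0) (fun s h => ?_) h00.2⟩
    · have := hb s
      simp [him, h] at this
    · have := hb s
      simp [him, h] at this
  -- left
  have h01 : 0 < (f (0, 1)).im := by
    refine stay_above (hct 0) (fun t h => ?_) h00.1
    have := hl t (by simp [him, h])
    rw [hre, h, Real.cos_zero] at this
    linarith [hpos (0, t)]
  -- right
  have h11 : -Real.pi < (f (1, 1)).im ∧ (f (1, 1)).im < Real.pi := by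
    refine ⟨stay_above (hct 1) (fun t h => ?_) (s := 0) (by linarith [h10.1, Real.pi_pos]),
      stay_below (hct 1) (fun t h => ?_) h10.2⟩
    · have := hr t (by simp [him, h])
      rw [hre, h, Real.cos_neg, Real.cos_pi] at this
      linarith [hpos (1, t)]
    · have := hr t (by simp [him, h])
      rw [hre, h, Real.cos_pi] at this
      linarith [hpos (1, t)]
  have h11' : (f (1, 1)).im < 0 := by
    by_contra hc
    have h1 := Real.sin_nonneg_of_nonneg_of_le_pi (not_lt.mp hc) h11.2.le
    have h2 := ht 1
    rw [him] at h2
    have := mul_nonneg (hpos (1, 1)).le h1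
    linarith
  have := stay_above (hcs 1) (a := 0) (fun s h => by
    have := ht s
    simp [him, h] at this) (t := 1) h01
  linarith

/-- The coordinate transversal to `v`. -/
def trv (v z : EuclideanSpace ℝ (Fin 2)) : ℝ := v 0 * z 1 - v 1 * z 0

/-- The coordinate along `v`. -/
def along (v z : EuclideanSpace ℝ (Fin 2)) : ℝ := v 0 * z 0 + v 1 * z 1

theorem continuous_trans (v : EuclideanSpace ℝ (Fin 2)) : Continuous (trv v) := by
  unfold trv; fun_prop

theorem continuous_along (v : EuclideanSpace ℝ (Fin 2)) : Continuous (along v) := by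
  unfold along; fun_prop

theorem trans_sub (v a b : EuclideanSpace ℝ (Fin 2)) :
    trv v (a - b) = trv v a - trv v b := by
  simp [trv]; ring

theorem norm_sq_two (v : EuclideanSpace ℝ (Fin 2)) : ‖v‖ ^ 2 = v 0 ^ 2 + v 1 ^ 2 := by
  simp [EuclideanSpace.norm_sq_eq, Fin.sum_univ_two]

theorem abs_trans_le (v z : EuclideanSpace ℝ (Fin 2)) : |trv v z| ≤ ‖v‖ * ‖z‖ := by
  apply abs_le_of_sq_le_sq _ (by positivity)
  rw [mul_pow, norm_sq_two, norm_sq_two, trv]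
  nlinarith [sq_nonneg (v 0 * z 0 + v 1 * z 1)]

theorem abs_along_le (v z : EuclideanSpace ℝ (Fin 2)) : |along v z| ≤ ‖v‖ * ‖z‖ := by
  apply abs_le_of_sq_le_sq _ (by positivity)
  rw [mul_pow, norm_sq_two, norm_sq_two, along]
  nlinarith [sq_nonneg (v 0 * z 1 - v 1 * z 0)]

/-- A vector is determined by the two coordinates. -/
theorem smul_eq_of_trans (v z : EuclideanSpace ℝ (Fin 2)) (h : trv v z = 0) (hv : v ≠ 0) :
    z = (along v z / ‖v‖ ^ 2) • v := by
  have hn : ‖v‖ ^ 2 ≠ 0 := by simpa using hv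
  rw [norm_sq_two] at *
  unfold trv at h
  unfold along
  ext i
  fin_cases i
  · simp
    field_simp
    linear_combination -v 1 * h
  · simp
    field_simp
    linear_combination v 0 * h

theorem mem_line (w v z : EuclideanSpace ℝ (Fin 2)) (hv : v ≠ 0) (h : trv v z = trv v w) :
    z ∈ lineThrough w v := by
  refine ⟨along v (z - w) / ‖v‖ ^ 2, ?_⟩
  rw [← smul_eq_of_trans v (z - w) (by rw [trans_sub, h, sub_self]) hv]
  abel

theorem trans_of_mem_line (w v z : EuclideanSpace ℝ (Fin 2)) (h : z ∈ lineThrough w v) :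
    trv v z = trv v w := by
  obtain ⟨t, rfl⟩ := h
  simp [trv]; ring

/-- The crossing lemma for two paths in the plane. -/
theorem crossing (v : EuclideanSpace ℝ (Fin 2)) (hv : v ≠ 0)
    (γ σ : ℝ → EuclideanSpace ℝ (Fin 2)) (hγ : Continuous γ) (hσ : Continuous σ)
    (hb : ∀ s, trv v (σ 0) < trv v (γ s)) (ht : ∀ s, trv v (γ s) < trv v (σ 1))
    (hl : ∀ t, trv v (γ 0) = trv v (σ t) → along v (γ 0) < along v (σ t))
    (hr : ∀ t, trv v (γ 1) = trv v (σ t) → along v (σ t) < along v (γ 1)) :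
    ∃ s t, γ s = σ t := by
  by_contra hne
  push Not at hne
  have c1 := continuous_trans v
  have c2 := continuous_along v
  refine crossing_complex ⟨fun p => ⟨along v (γ p.1) - along v (σ p.2),
    trv v (γ p.1) - trv v (σ p.2)⟩, ?_⟩ ?_ ?_ ?_ ?_ ?_
  · have : (fun p : ℝ × ℝ => (⟨along v (γ p.1) - along v (σ p.2),
        trv v (γ p.1) - trv v (σ p.2)⟩ : ℂ)) = fun p : ℝ × ℝ =>
        ((along v (γ p.1) - along v (σ p.2) : ℝ) : ℂ) +
        ((trv v (γ p.1) - trv v (σ p.2) : ℝ) : ℂ) * Complex.I := by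
      ext p; exact Complex.mk_eq_add_mul_I _ _
    rw [this]
    fun_prop
  · rintro ⟨s, t⟩ h
    have h1 := congrArg Complex.re h
    have h2 := congrArg Complex.im h
    simp at h1 h2
    apply hne s t
    have h3 : trv v (γ s - σ t) = 0 := by rw [trans_sub, h2]
    have h4 : along v (γ s - σ t) = 0 := by
      rw [← h1]; simp [along]; ring
    have := smul_eq_of_trans v _ h3 hv
    rw [h4] at this
    simpa [sub_eq_zero] using this
  · intro s; simpa using hb s
  · intro s; simpa using ht s
  · intro t h; simpa using hl t (by simpa [sub_eq_zero] using h)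
  · intro t h; simpa using hr t (by simpa [sub_eq_zero] using h)

theorem along_self (v : EuclideanSpace ℝ (Fin 2)) : along v v = ‖v‖ ^ 2 := by
  rw [norm_sq_two, along]; ring

theorem along_comm (v w : EuclideanSpace ℝ (Fin 2)) : along v w = along w v := by
  unfold along; ring

/-- The ends of the chord are far out: a point near an endpoint `p` of the chord cannot be a
translate of a point of the inner ball in the wrong direction. -/
theorem end_estimate (x v p g z : EuclideanSpace ℝ (Fin 2)) (hv : v ≠ 0) {r ρ ε : ℝ}
    (hr : 0 < r) (hρ : ρ + ε < r) (hp : ‖p - x‖ = r) (hg : dist g p < ε) (hz : dist z x ≤ ρ)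
    (hpe : 0 ≤ along v (p - x)) (htr : trv v g = trv v z) : along v z < along v g := by
  by_contra hcon
  have hd := smul_eq_of_trans v (z - g) (by rw [trans_sub, htr, sub_self]) hv
  have hnn : 0 ≤ along v (z - g) / ‖v‖ ^ 2 := by
    have : along v (z - g) = along v z - along v g := by simp [along]; ring
    rw [this]
    apply div_nonneg _ (by positivity)
    linarith
  set k := along v (z - g) / ‖v‖ ^ 2
  have e1 : along (p - x) (z - x) = along (p - x) (g - p) + along (p - x) (p - x)
      + k * along v (p - x) := by
    have : z = g + k • v := by rw [← hd]; abel
    rw [this]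
    simp [along]; ring
  rw [along_self, hp] at e1
  have b1 := abs_le.mp (abs_along_le (p - x) (z - x))
  have b2 := abs_le.mp (abs_along_le (p - x) (g - p))
  rw [hp, ← dist_eq_norm] at b1 b2
  have b3 := mul_nonneg hnn hpe
  nlinarith [b1.2, b2.1]

/-- The same with the opposite direction. -/
theorem end_estimate_neg (x v p g z : EuclideanSpace ℝ (Fin 2)) (hv : v ≠ 0) {r ρ ε : ℝ}
    (hr : 0 < r) (hρ : ρ + ε < r) (hp : ‖p - x‖ = r) (hg : dist g p < ε) (hz : dist z x ≤ ρ)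
    (hpe : along v (p - x) ≤ 0) (htr : trv v g = trv v z) : along v g < along v z := by
  have h1 : ∀ a, along (-v) a = - along v a := fun a => by simp [along]; ring
  have h2 : ∀ a, trv (-v) a = - trv v a := fun a => by simp [trv]; ring
  have := end_estimate x (-v) p g z (by simpa using hv) hr hρ hp hg hz (by rw [h1]; linarith)
    (by rw [h2, h2, htr])
  rw [h1, h1] at this
  linarith

/-- A path close to the chord must meet every connected open set crossing the chord. -/
theorem core (x w v : EuclideanSpace ℝ (Fin 2)) (hv : v ≠ 0) {r ρ ε δ : ℝ} (hr : 0 < r)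
    (hε : 0 < ε) (hρ : ρ + ε < r) (hδ : ‖v‖ * ε ≤ δ) (U : Set (EuclideanSpace ℝ (Fin 2)))
    (hU : IsOpen U) (hUc : IsConnected U) (hUb : U ⊆ closedBall x ρ)
    {a b : EuclideanSpace ℝ (Fin 2)} (ha : a ∈ U) (hb : b ∈ U)
    (haw : trv v a < trv v w - δ) (hbw : trv v w + δ < trv v b)
    (γ : ℝ → EuclideanSpace ℝ (Fin 2)) (hγ : ContinuousOn γ (Icc 0 1))
    (hH : hausdorffDist (γ '' Icc 0 1) (lineThrough w v ∩ closedBall x r) < ε) :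
    (γ '' Icc 0 1 ∩ U).Nonempty := by
  have hvn : 0 < ‖v‖ := norm_pos_iff.mpr hv
  have hδ0 : 0 < δ := lt_of_lt_of_le (by positivity) hδ
  obtain ⟨m, hmU, hm⟩ : ∃ m ∈ U, trv v m = trv v w := by
    have := hUc.isPreconnected.intermediate_value ha hb (continuous_trans v).continuousOn
    exact this ⟨by linarith, by linarith⟩
  have hmx : dist m x ≤ ρ := hUb hmU
  -- foot of the perpendicular
  set q := m - (along v (m - x) / ‖v‖ ^ 2) • v with hq
  have hqv : along v (q - x) = 0 := by
    have : along v (q - x) = along v (m - x) - along v (m - x) / ‖v‖ ^ 2 * along v v := by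
      simp [along, hq]; ring
    rw [this, along_self]
    field_simp
    ring
  have hpyth : ∀ t : ℝ, ‖q + t • v - x‖ ^ 2 = ‖q - x‖ ^ 2 + t ^ 2 * ‖v‖ ^ 2 := fun t => by
    have : ‖q + t • v - x‖ ^ 2 = ‖q - x‖ ^ 2 + t ^ 2 * ‖v‖ ^ 2 + 2 * t * along v (q - x) := by
      simp only [norm_sq_two, along]
      simp
      ring
    rw [this, hqv]; ring
  have hqx : ‖q - x‖ ^ 2 ≤ r ^ 2 := by
    have h1 := hpyth (along v (m - x) / ‖v‖ ^ 2)
    have h2 : q + (along v (m - x) / ‖v‖ ^ 2) • v - x = m - x := by rw [hq]; abel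
    rw [h2, ← dist_eq_norm] at h1
    have : dist m x ^ 2 ≤ r ^ 2 := by
      apply pow_le_pow_left₀ dist_nonneg; linarith
    nlinarith [sq_nonneg (along v (m - x) / ‖v‖ ^ 2 * ‖v‖)]
  set τ := √(r ^ 2 - ‖q - x‖ ^ 2) / ‖v‖ with hτ
  have hτ0 : 0 ≤ τ := by positivity
  have hτv : τ ^ 2 * ‖v‖ ^ 2 = r ^ 2 - ‖q - x‖ ^ 2 := by
    rw [hτ, div_pow, Real.sq_sqrt (by linarith)]
    field_simp
  have hnorm : ∀ t : ℝ, t ^ 2 = τ ^ 2 → ‖q + t • v - x‖ = r := fun t ht => by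
    have h1 := hpyth t
    rw [ht, hτv] at h1
    have : ‖q + t • v - x‖ ^ 2 = r ^ 2 := by linarith
    exact (pow_left_inj₀ (norm_nonneg _) hr.le two_ne_zero).mp this
  have hline : ∀ t : ℝ, q + t • v ∈ lineThrough w v := fun t => by
    apply mem_line w v _ hv
    rw [← hm]
    simp [trv, hq]; ring
  have hal : ∀ t : ℝ, along v (q + t • v - x) = t * ‖v‖ ^ 2 := fun t => by
    have : along v (q + t • v - x) = along v (q - x) + t * along v v := by
      simp [along]; ring
    rw [this, hqv, along_self]; ring
  have hmem : ∀ t : ℝ, t ^ 2 = τ ^ 2 → q + t • v ∈ lineThrough w v ∩ closedBall x r :=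
    fun t ht => ⟨hline t, by rw [mem_closedBall, dist_eq_norm, hnorm t ht]⟩
  have hfin : hausdorffEDist (γ '' Icc 0 1) (lineThrough w v ∩ closedBall x r) ≠ ⊤ := by
    apply hausdorffEDist_ne_top_of_nonempty_of_bounded
    · exact (nonempty_Icc.mpr zero_le_one).image _
    · exact ⟨_, hmem τ rfl⟩
    · exact (isCompact_Icc.image_of_continuousOn hγ).isBounded
    · exact isBounded_closedBall.subset inter_subset_right
  obtain ⟨_, ⟨s₁, hs₁, rfl⟩, hd₁⟩ := exists_dist_lt_of_hausdorffDist_lt' (hmem τ rfl) hH hfin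
  obtain ⟨_, ⟨s₀, hs₀, rfl⟩, hd₀⟩ :=
    exists_dist_lt_of_hausdorffDist_lt' (hmem (-τ) (by ring)) hH hfin
  have hnear : ∀ s ∈ Icc (0 : ℝ) 1, |trv v (γ s) - trv v w| < δ := fun s hs => by
    obtain ⟨y, ⟨hy, -⟩, hd⟩ := exists_dist_lt_of_hausdorffDist_lt (mem_image_of_mem γ hs) hH hfin
    rw [← trans_of_mem_line w v y hy, ← trans_sub]
    refine (abs_trans_le _ _).trans_lt (lt_of_lt_of_le ?_ hδ)
    rw [← dist_eq_norm]
    exact mul_lt_mul_of_pos_left hd hvn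
  -- the path inside `U`
  have hJ : JoinedIn U a b := (hU.isConnected_iff_isPathConnected.mp hUc).joinedIn a ha b hb
  obtain ⟨P, hP⟩ := hJ
  have hσU : ∀ t, P.extend t ∈ U := fun t => by
    have : P.extend t ∈ range P.extend := mem_range_self t
    rw [Path.extend_range] at this
    obtain ⟨y, hy⟩ := this
    rw [← hy]; exact hP y
  -- the reparametrised path
  let c : ℝ → ℝ := fun s => s₀ + (projIcc (0 : ℝ) 1 zero_le_one s : ℝ) * (s₁ - s₀)
  have hc : ∀ s, c s ∈ Icc (0 : ℝ) 1 := fun s => by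
    have h := (projIcc (0 : ℝ) 1 zero_le_one s).2
    obtain ⟨h1, h2⟩ := h
    obtain ⟨h3, h4⟩ := hs₀
    obtain ⟨h5, h6⟩ := hs₁
    constructor
    · show 0 ≤ s₀ + _ * (s₁ - s₀)
      nlinarith
    · show s₀ + _ * (s₁ - s₀) ≤ 1
      nlinarith
  have hcc : Continuous c := by
    have := continuous_projIcc (a := (0 : ℝ)) (b := 1) (h := zero_le_one)
    fun_prop
  have hc0 : c 0 = s₀ := by simp [c]
  have hc1 : c 1 = s₁ := by simp [c]
  obtain ⟨s, t, hst⟩ := crossing v hv (fun s => γ (c s)) P.extend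
    (hγ.comp_continuous hcc hc) P.continuous_extend
    (fun s => by
      have := (abs_lt.mp (hnear _ (hc s))).1
      rw [Path.extend_zero]; linarith)
    (fun s => by
      have := (abs_lt.mp (hnear _ (hc s))).2
      rw [Path.extend_one]; linarith)
    (fun t h => by
      simp only [hc0] at h ⊢
      exact end_estimate_neg x v _ _ _ hv hr hρ (hnorm (-τ) (by ring)) hd₀ (hUb (hσU t))
        (by rw [hal]; nlinarith [sq_nonneg ‖v‖]) h)
    (fun t h => by
      simp only [hc1] at h ⊢
      exact end_estimate x v _ _ _ hv hr hρ (hnorm τ rfl) hd₁ (hUb (hσU t))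
        (by rw [hal]; positivity) h)
  exact ⟨γ (c s), mem_image_of_mem γ (hc s), by
    have : γ (c s) = P.extend t := hst
    rw [this]; exact hσU t⟩

/-- Two transversal coordinates for independent directions control the norm. -/
theorem exists_transversal_bound (v : Fin 2 → EuclideanSpace ℝ (Fin 2))
    (hv : LinearIndependent ℝ v) {e : ℝ} (he : 0 < e) :
    ∃ η > 0, ∀ z : EuclideanSpace ℝ (Fin 2), e < ‖z‖ → ∃ i, η ≤ |trv (v i) z| := by
  have hne : ∀ i, v i ≠ 0 := fun i => hv.ne_zero i
  set D := trv (v 0) (v 1) with hD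
  have hD0 : D ≠ 0 := by
    intro h
    have h1 := smul_eq_of_trans (v 0) (v 1) h (hne 0)
    have hind := LinearIndependent.pair_iff.mp (by
      have : v = ![v 0, v 1] := by ext i; fin_cases i <;> rfl
      rw [this] at hv; exact hv) (-(along (v 0) (v 1) / ‖v 0‖ ^ 2)) 1 (by
        rw [neg_smul, ← h1, one_smul]; abel)
    exact one_ne_zero hind.2
  have hDa : 0 < |D| := abs_pos.mpr hD0
  have hS : 0 < ‖v 0‖ + ‖v 1‖ := by
    have := norm_pos_iff.mpr (hne 0); positivity
  refine ⟨|D| * e / (‖v 0‖ + ‖v 1‖), by positivity, fun z hz => ?_⟩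
  by_contra hcon
  push Not at hcon
  have key : D • z = trv (v 0) z • v 1 - trv (v 1) z • v 0 := by
    ext i
    fin_cases i <;> simp [trv, hD] <;> ring
  have h1 : |D| * ‖z‖ ≤ |trv (v 0) z| * ‖v 1‖ + |trv (v 1) z| * ‖v 0‖ := by
    have := norm_sub_le (trv (v 0) z • v 1) (trv (v 1) z • v 0)
    rw [← key] at this
    simpa [norm_smul] using this
  have h2 := mul_le_mul_of_nonneg_right (hcon 0).le (norm_nonneg (v 1))
  have h3 := mul_le_mul_of_nonneg_right (hcon 1).le (norm_nonneg (v 0))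
  have h4 : |D| * e / (‖v 0‖ + ‖v 1‖) * ‖v 1‖ + |D| * e / (‖v 0‖ + ‖v 1‖) * ‖v 0‖ = |D| * e := by
    field_simp
    ring
  have h5 := mul_lt_mul_of_pos_left hz hDa
  linarith

/-- Bounded complementary components stay in the ball. -/
theorem component_subset {K Ω : Set (EuclideanSpace ℝ (Fin 2))} {x : EuclideanSpace ℝ (Fin 2)}
    {ρ : ℝ} (hρ : 0 ≤ ρ) (hK : K ⊆ closedBall x ρ)
    (hΩ : ∃ y ∈ Kᶜ, Ω = connectedComponentIn Kᶜ y)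
    (hb : Bornology.IsBounded Ω) : Ω ⊆ closedBall x ρ := by
  obtain ⟨y, hy, rfl⟩ := hΩ
  intro z hz
  by_contra hzx
  rw [mem_closedBall, not_le, dist_eq_norm] at hzx
  let R : ℝ → EuclideanSpace ℝ (Fin 2) := fun s => x + s • (z - x)
  have hR : Continuous R := by fun_prop
  have hsub : R '' Ici 1 ⊆ connectedComponentIn Kᶜ y := by
    rw [connectedComponentIn_eq hz]
    apply IsPreconnected.subset_connectedComponentIn
    · exact isPreconnected_Ici.image _ hR.continuousOn
    · exact ⟨1, self_mem_Ici, by simp [R]⟩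
    · rintro _ ⟨s, hs, rfl⟩ hmem
      have := hK hmem
      have hs' : (1 : ℝ) ≤ s := hs
      simp only [R, mem_closedBall, dist_eq_norm, add_sub_cancel_left, norm_smul,
        Real.norm_eq_abs, abs_of_nonneg (zero_le_one.trans hs')] at this
      nlinarith
  obtain ⟨M, hM⟩ := (hb.subset hsub).subset_closedBall x
  have hzp : 0 < ‖z - x‖ := lt_of_le_of_lt hρ hzx
  have hm := hM (mem_image_of_mem R (mem_Ici.mpr (le_max_left 1 ((M + 1) / ‖z - x‖))))
  have hs1 : (1 : ℝ) ≤ max 1 ((M + 1) / ‖z - x‖) := le_max_left _ _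
  have hs2 : (M + 1) / ‖z - x‖ ≤ max 1 ((M + 1) / ‖z - x‖) := le_max_right _ _
  simp only [R, mem_closedBall, dist_eq_norm, add_sub_cancel_left, norm_smul,
        Real.norm_eq_abs, abs_of_nonneg (zero_le_one.trans hs1)] at hm
  rw [div_le_iff₀ hzp] at hs2
  linarith

/-- A compact subset of an open ball lies in a smaller closed ball. -/
theorem exists_smaller {K : Set (EuclideanSpace ℝ (Fin 2))} (hK : IsCompact K)
    {x : EuclideanSpace ℝ (Fin 2)} {r : ℝ} (hr : 0 < r) (h : K ⊆ ball x r) :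
    ∃ ρ, 0 ≤ ρ ∧ ρ < r ∧ K ⊆ closedBall x ρ := by
  rcases K.eq_empty_or_nonempty with rfl | hne
  · exact ⟨0, le_rfl, hr, empty_subset _⟩
  · obtain ⟨y, hy, hmax⟩ := hK.exists_isMaxOn hne (f := fun y => dist y x)
      (by fun_prop)
    exact ⟨dist y x, dist_nonneg, h hy, fun z hz => hmax hz⟩

/-- Almost every line: transversal coordinates of good lines are dense. -/
theorem exists_good_line (v : EuclideanSpace ℝ (Fin 2)) (hv : v ≠ 0)
    (P : EuclideanSpace ℝ (Fin 2) → Prop)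
    (hP : ∀ᵐ w : ↥(Submodule.span ℝ {v})ᗮ, P (w : EuclideanSpace ℝ (Fin 2))) {p q : ℝ}
    (hpq : p < q) : ∃ w, P w ∧ p < trv v w ∧ trv v w < q := by
  have hd := Measure.dense_of_ae hP
  have hvn : ‖v‖ ^ 2 ≠ 0 := by simpa using hv
  have hopen : IsOpen {w : ↥(Submodule.span ℝ {v})ᗮ |
      trv v (w : EuclideanSpace ℝ (Fin 2)) ∈ Ioo p q} :=
    isOpen_Ioo.preimage ((continuous_trans v).comp continuous_subtype_val)
  have hne : {w : ↥(Submodule.span ℝ {v})ᗮ |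
      trv v (w : EuclideanSpace ℝ (Fin 2)) ∈ Ioo p q}.Nonempty := by
    let k := ((p + q) / 2) / ‖v‖ ^ 2
    let u : EuclideanSpace ℝ (Fin 2) := !₂[-(k * v 1), k * v 0]
    have hu : u ∈ (Submodule.span ℝ {v})ᗮ := by
      rw [Submodule.mem_orthogonal_singleton_iff_inner_right]
      simp [u, PiLp.inner_apply, Fin.sum_univ_two]
      ring
    have ht : trv v u = (p + q) / 2 := by
      have : trv v u = k * ‖v‖ ^ 2 := by
        rw [norm_sq_two]; simp [trv, u]; ring
      rw [this]; exact div_mul_cancel₀ _ hvn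
    refine ⟨⟨u, hu⟩, ?_⟩
    show trv v u ∈ Ioo p q
    rw [ht]
    constructor <;> linarith
  obtain ⟨w, hw, hPw⟩ := hd.exists_mem_open hopen hne
  exact ⟨w, by assumption, hPw.1, hPw.2⟩

theorem statement2 (K : Set (EuclideanSpace ℝ (Fin 2)))
    (Ω : ℕ → Set (EuclideanSpace ℝ (Fin 2))) (hK : IsDetourSet 2 K Ω)
    (h0 : IsUnboundedJordanRegion (Ω 0))
    (hk : ∀ k : ℕ, k ≠ 0 → IsJordanRegion (Ω k)) :
    Tendsto (fun k => EMetric.diam (Ω k)) atTop (𝓝 0) := by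
  obtain ⟨x, r, hr, hKr, v, hv, hdet⟩ := hK.detour
  obtain ⟨ρ, hρ0, hρr, hKρ⟩ := exists_smaller hK.compact hr hKr
  have hsub : ∀ k, k ≠ 0 → Ω k ⊆ closedBall x ρ := fun k hk0 =>
    component_subset hρ0 hKρ (hK.component k) (hK.bounded k hk0)
  have hopen : ∀ k, IsOpen (Ω k) := fun k => by
    obtain ⟨y, -, hy⟩ := hK.component k
    rw [hy]; exact hK.compact.isClosed.isOpen_compl.connectedComponentIn
  have hconn : ∀ k, IsConnected (Ω k) := fun k => by
    obtain ⟨y, hyK, hy⟩ := hK.component k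
    rw [hy]; exact isConnected_connectedComponentIn_iff.mpr hyK
  by_contra hcon
  rw [ENNReal.tendsto_atTop_zero] at hcon
  push Not at hcon
  obtain ⟨ε, hε, hN⟩ := hcon
  obtain ⟨e, he0, heε⟩ := ENNReal.lt_iff_exists_nnreal_btwn.mp hε
  have he : (0 : ℝ) < e := by exact_mod_cast he0
  obtain ⟨η, hη, hηv⟩ := exists_transversal_bound v hv he
  have hfreq : ∃ᶠ n in atTop, ∃ i : Fin 2, ∃ a ∈ Ω n, ∃ b ∈ Ω n,
      trv (v i) a + η ≤ trv (v i) b := by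
    rw [frequently_atTop]
    intro N
    obtain ⟨n, hn, hdn⟩ := hN N
    refine ⟨n, hn, ?_⟩
    obtain ⟨a, ha, b, hb, hab⟩ : ∃ a ∈ Ω n, ∃ b ∈ Ω n, (e : ℝ≥0∞) < edist a b := by
      by_contra hc
      push Not at hc
      exact absurd (Metric.ediam_le hc) (not_le.mpr (heε.trans hdn))
    have hab' : (e : ℝ) < ‖a - b‖ := by
      rw [edist_nndist] at hab
      rw [← dist_eq_norm, ← coe_nndist]
      exact_mod_cast hab
    obtain ⟨i, hi⟩ := hηv _ hab'
    rw [trans_sub] at hi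
    rcases le_abs.mp hi with h | h
    · exact ⟨i, b, hb, a, ha, by linarith⟩
    · exact ⟨i, a, ha, b, hb, by linarith⟩
  obtain ⟨i, hi⟩ : ∃ i : Fin 2, ∃ᶠ n in atTop, ∃ a ∈ Ω n, ∃ b ∈ Ω n,
      trv (v i) a + η ≤ trv (v i) b := by
    by_contra hc
    push Not at hc
    apply hfreq
    filter_upwards [eventually_all.mpr hc] with n hn ⟨i, a, ha, b, hb, h⟩
    exact absurd (hn i a ha b hb) (not_lt.mpr h)
  have hvi : v i ≠ 0 := hv.ne_zero i
  obtain ⟨φ, hφ, hφP⟩ := extraction_of_frequently_atTop (hi.and_eventually (eventually_ge_atTop 1))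
  choose hφa hφ1 using hφP
  choose a ha b hb hab using hφa
  have hcomp : IsCompact (closedBall x ρ) := isCompact_closedBall x ρ
  obtain ⟨y, -, ψ, hψ, hlim⟩ := hcomp.tendsto_subseq
    (fun n => hsub (φ n) (by have := hφ1 n; omega) (ha n))
  have hlim' : Tendsto (fun n => trv (v i) (a (ψ n))) atTop (𝓝 (trv (v i) y)) :=
    ((continuous_trans (v i)).tendsto y).comp hlim
  set A := trv (v i) y
  obtain ⟨w, hw, hw1, hw2⟩ := exists_good_line (v i) hvi
    (fun w => HasDetourProperty Ω (closedBall x r) (lineThrough w (v i))) (hdet i)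
    (p := A + 3 * η / 8) (q := A + 5 * η / 8) (by linarith)
  have hvn : 0 < ‖v i‖ := norm_pos_iff.mpr hvi
  set ε₀ := min ((r - ρ) / 2) (η / 8 / ‖v i‖) with hε₀
  have hε₀p : 0 < ε₀ := lt_min (by linarith) (by positivity)
  obtain ⟨γ, hγ, hH, -, hfin, -⟩ := hw (ε₀ / 2) (by positivity)
  have hev : ∀ᶠ n in atTop, trv (v i) (a (ψ n)) ∈ Ioo (A - η / 4) (A + η / 4) :=
    hlim' (Ioo_mem_nhds (by linarith) (by linarith))
  obtain ⟨N, hN'⟩ := eventually_atTop.mp hev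
  have hmem : ∀ n ≥ N, φ (ψ n) ∈ {k | (γ '' Icc 0 1 ∩ closure (Ω k)).Nonempty} := fun n hn => by
    have h1 := hN' n hn
    have h2 := hab (ψ n)
    have h3 := core x w (v i) hvi hr hε₀p (ρ := ρ) (δ := η / 8)
      (by have := min_le_left ((r - ρ) / 2) (η / 8 / ‖v i‖); linarith)
      (by
        have := min_le_right ((r - ρ) / 2) (η / 8 / ‖v i‖)
        rw [← hε₀, le_div_iff₀ hvn] at this
        linarith)
      (Ω (φ (ψ n))) (hopen _) (hconn _)
      (hsub _ (by have := hφ1 (ψ n); omega)) (ha (ψ n)) (hb (ψ n))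
      (by linarith [h1.2]) (by linarith [h1.1]) γ hγ (by linarith)
    exact h3.mono (inter_subset_inter_right _ subset_closure)
  have hinf : ((fun n => φ (ψ n)) '' Ici N).Infinite :=
    (Ici_infinite N).image ((hφ.comp hψ).injective.injOn)
  exact hinf (hfin.subset (by rintro _ ⟨n, hn, rfl⟩; exact hmem n hn))
end

section
/- Let K ⊆ ℝ² be a detour set whose complementary components are Jordan regions when regarded as subsets of the Riemann sphere (i.e., each bounded component Ω_k, k ≥ 1, is a Jordan region, and the unbounded component Ω₀ is an unbounded Jordan region). Then K is locally connected. -/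
open MeasureTheory Metric Set Filter
open scoped ENNReal NNReal Topology

lemma abs_sub_lt_pi_of_cos (h : ℝ → ℝ) (hc : Continuous h) (hn : ∀ x, Real.cos (h x) ≠ 0)
    (x y : ℝ) : |h x - h y| < Real.pi := by
  by_contra hcon
  push Not at hcon
  wlog hxy : h y ≤ h x generalizing x y
  · exact this y x (by rwa [abs_sub_comm]) (le_of_lt (not_le.mp hxy))
  rw [abs_of_nonneg (by linarith)] at hcon
  have hpi := Real.pi_pos
  set n : ℤ := ⌈(h y - Real.pi / 2) / Real.pi⌉ with hnn
  have h1 : (h y - Real.pi / 2) / Real.pi ≤ n := Int.le_ceil _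
  have h2 : (n : ℝ) < (h y - Real.pi / 2) / Real.pi + 1 := Int.ceil_lt_add_one _
  rw [div_le_iff₀ hpi] at h1
  have h3 : (n : ℝ) * Real.pi < h y - Real.pi / 2 + Real.pi := by
    have := mul_lt_mul_of_pos_right h2 hpi
    rwa [add_mul, div_mul_cancel₀ _ hpi.ne', one_mul] at this
  have hmem : (n : ℝ) * Real.pi + Real.pi / 2 ∈ range h :=
    mem_range_of_exists_le_of_exists_ge hc ⟨y, by linarith⟩ ⟨x, by linarith⟩
  obtain ⟨z, hz⟩ := hmem
  apply hn z
  rw [hz, Real.cos_eq_zero_iff]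
  exact ⟨n, by ring⟩

lemma abs_sub_lt_pi_of_sin (h : ℝ → ℝ) (hc : Continuous h) (hn : ∀ x, Real.sin (h x) ≠ 0)
    (x y : ℝ) : |h x - h y| < Real.pi := by
  have := abs_sub_lt_pi_of_cos (fun x => h x - Real.pi / 2) (by fun_prop)
    (fun x => by rw [Real.cos_sub_pi_div_two]; exact hn x) x y
  simpa using this

lemma pos_of_sin_pos {a b : ℝ} (h : |b - a| < Real.pi)
    (hs : 0 < Real.sin b * Real.cos a - Real.cos b * Real.sin a) : 0 < b - a := by
  rw [← Real.sin_sub] at hs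
  by_contra hcon
  push Not at hcon
  have := Real.sin_nonpos_of_nonpos_of_neg_pi_le hcon (by linarith [(abs_lt.mp h).1])
  linarith

lemma crossing_s3 (F : ℝ × ℝ → ℂ) (hF : Continuous F) (h0 : ∀ z, F z ≠ 0) (s0 s1 t0 t1 : ℝ)
    (ht0 : ∀ s, 0 < (F (s, t0)).re) (ht1 : ∀ s, (F (s, t1)).re < 0)
    (hs0 : ∀ t, (F (s0, t)).im < 0) (hs1 : ∀ t, 0 < (F (s1, t)).im) : False := by
  obtain ⟨ℓ, ⟨-, hℓ⟩, -⟩ := Complex.isCoveringMapOn_exp.existsUnique_continuousMap_lifts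
    (⟨F, hF⟩ : C(ℝ × ℝ, ℂ)) (a₀ := (0, 0)) (e₀ := Complex.log (F (0, 0)))
    (by simp [Complex.exp_log (h0 _)]) (by intro z; simpa using h0 z)
  have hE : ∀ z, F z = Complex.exp (ℓ z) := fun z => (congrFun hℓ z).symm
  set θ : ℝ × ℝ → ℝ := fun z => (ℓ z).im with hθ
  have hθc : Continuous θ := Complex.continuous_im.comp ℓ.continuous
  have hre : ∀ z, (F z).re = Real.exp (ℓ z).re * Real.cos (θ z) := fun z => by
    rw [hE, Complex.exp_re]
  have him : ∀ z, (F z).im = Real.exp (ℓ z).re * Real.sin (θ z) := fun z => by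
    rw [hE, Complex.exp_im]
  have e := fun z => Real.exp_pos (ℓ z).re
  have c0 : ∀ s, 0 < Real.cos (θ (s, t0)) := fun s => by
    have := ht0 s; rw [hre] at this; exact (pos_iff_pos_of_mul_pos this).mp (e _)
  have c1 : ∀ s, Real.cos (θ (s, t1)) < 0 := fun s => by
    have := ht1 s; rw [hre] at this; exact neg_of_mul_neg_right this (e _).le
  have c2 : ∀ t, Real.sin (θ (s0, t)) < 0 := fun s => by
    have := hs0 s; rw [him] at this; exact neg_of_mul_neg_right this (e _).le
  have c3 : ∀ t, 0 < Real.sin (θ (s1, t)) := fun s => by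
    have := hs1 s; rw [him] at this; exact (pos_iff_pos_of_mul_pos this).mp (e _)
  have a1 := pos_of_sin_pos (abs_sub_lt_pi_of_cos (fun s => θ (s, t0)) (by fun_prop)
    (fun s => (c0 s).ne') s1 s0) (by nlinarith [mul_pos (c3 t0) (c0 s0), mul_pos_of_neg_of_neg (c2 t0) (neg_lt_zero.mpr (c0 s1))])
  have a2 := pos_of_sin_pos (abs_sub_lt_pi_of_sin (fun t => θ (s1, t)) (by fun_prop)
    (fun s => (c3 s).ne') t1 t0) (by nlinarith [mul_pos (c3 t1) (c0 s1), mul_pos_of_neg_of_neg (c1 s1) (neg_lt_zero.mpr (c3 t0))])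
  have a3 := pos_of_sin_pos (abs_sub_lt_pi_of_cos (fun s => θ (s, t1)) (by fun_prop)
    (fun s => (c1 s).ne) s0 s1) (by nlinarith [mul_pos_of_neg_of_neg (c2 t1) (c1 s1), mul_pos_of_neg_of_neg (c1 s0) (neg_lt_zero.mpr (c3 t1))])
  have a4 := pos_of_sin_pos (abs_sub_lt_pi_of_sin (fun t => θ (s0, t)) (by fun_prop)
    (fun s => (c2 s).ne) t0 t1) (by nlinarith [mul_pos_of_neg_of_neg (c2 t0) (c1 s0), mul_pos_of_neg_of_neg (c2 t1) (neg_lt_zero.mpr (c0 s0))])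
  linarith

lemma jordan_ulc {J : Set (EuclideanSpace ℝ (Fin 2))} (hJ : IsJordanCurve J) (ε : ℝ) (hε : 0 < ε) :
    ∃ δ > 0, ∀ a ∈ J, ∀ b ∈ J, dist a b < δ →
      ∃ C ⊆ J, IsPreconnected C ∧ a ∈ C ∧ b ∈ C ∧ C ⊆ ball a ε := by
  obtain ⟨f, hfc, hfi, rfl⟩ := hJ
  have : Fact (Module.finrank ℝ (EuclideanSpace ℝ (Fin 2)) = 1 + 1) := ⟨by simp⟩
  have : LocallyConnectedSpace (sphere (0 : EuclideanSpace ℝ (Fin 2)) 1) :=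
    ChartedSpace.locallyConnectedSpace (EuclideanSpace ℝ (Fin 1)) _
  have hemb : Topology.IsClosedEmbedding f := hfc.isClosedEmbedding hfi
  let e := hemb.isEmbedding.toHomeomorph
  have : LocallyConnectedSpace (range f) := e.symm.locallyConnectedSpace
  have hcomp : CompactSpace (range f) := isCompact_iff_compactSpace.mp (isCompact_range hfc)
  have hV : ∀ x : range f, ∃ V : Set (range f), V ⊆ ball x (ε / 2) ∧ IsOpen V ∧ x ∈ V ∧
      IsConnected V := fun x =>
    locallyConnectedSpace_iff_subsets_isOpen_isConnected.mp inferInstance x _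
      (ball_mem_nhds x (half_pos hε))
  choose V hV1 hV2 hV3 hV4 using hV
  obtain ⟨δ, hδ, hL⟩ := lebesgue_number_lemma_of_metric (isCompact_univ (X := range f)) hV2
    (fun x _ => mem_iUnion.mpr ⟨x, hV3 x⟩)
  refine ⟨δ, hδ, fun a ha b hb hab => ?_⟩
  obtain ⟨i, hi⟩ := hL ⟨a, ha⟩ (mem_univ _)
  have haV : (⟨a, ha⟩ : range f) ∈ V i := hi (mem_ball_self hδ)
  have hbV : (⟨b, hb⟩ : range f) ∈ V i := hi (by
    rw [mem_ball, dist_comm]; exact hab)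
  refine ⟨Subtype.val '' V i, ?_, (hV4 i).isPreconnected.image _ continuous_subtype_val.continuousOn,
    ⟨_, haV, rfl⟩, ⟨_, hbV, rfl⟩, ?_⟩
  · rintro _ ⟨z, _, rfl⟩; exact z.2
  · rintro _ ⟨z, hz, rfl⟩
    have h1 := hV1 i hz
    have h2 := hV1 i haV
    rw [mem_ball] at *
    have h3 : dist z (⟨a, ha⟩ : range f) < ε := by
      linarith [dist_triangle_right z (⟨a, ha⟩ : range f) i]
    exact h3

lemma jordan_connected {J : Set (EuclideanSpace ℝ (Fin 2))} (hJ : IsJordanCurve J) :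
    IsPreconnected J := by
  obtain ⟨f, hfc, hfi, rfl⟩ := hJ
  have : IsConnected (sphere (0 : EuclideanSpace ℝ (Fin 2)) 1) :=
    isConnected_sphere (by rw [← Module.finrank_eq_rank]; simp) 0 zero_le_one
  have := isPreconnected_iff_preconnectedSpace.mp this.isPreconnected
  exact isPreconnected_range hfc

lemma separate {X : Type*} [TopologicalSpace X] [T2Space X] {M : Set X} (hM : IsCompact M)
    {x y : X} (hx : x ∈ M) (hy : y ∈ M) (h : y ∉ connectedComponentIn M x) :
    ∃ A B : Set X, IsClosed A ∧ IsClosed B ∧ Disjoint A B ∧ A ∪ B = M ∧ x ∈ A ∧ y ∈ B := by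
  have := isCompact_iff_compactSpace.mp hM
  rw [connectedComponentIn_eq_image hx, connectedComponent_eq_iInter_isClopen] at h
  have h2 : (⟨y, hy⟩ : M) ∉ ⋂ s : { s : Set M // IsClopen s ∧ (⟨x, hx⟩ : M) ∈ s }, (s : Set M) :=
    fun hh => h ⟨_, hh, rfl⟩
  simp only [mem_iInter, not_forall] at h2
  obtain ⟨⟨s, hs, hxs⟩, hys⟩ := h2
  refine ⟨Subtype.val '' s, Subtype.val '' sᶜ,
    (hM.isClosed.isClosedEmbedding_subtypeVal.isClosedMap _ hs.1),
    (hM.isClosed.isClosedEmbedding_subtypeVal.isClosedMap _ hs.compl.1), ?_, ?_,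
    ⟨_, hxs, rfl⟩, ⟨_, hys, rfl⟩⟩
  · exact (disjoint_image_iff Subtype.val_injective).mpr disjoint_compl_right
  · rw [← image_union, union_compl_self, image_univ, Subtype.range_coe]

lemma gap {A B : Set ℝ} (hA : IsClosed A) (hB : IsClosed B) (hAB : Disjoint A B)
    (h0 : (0 : ℝ) ∈ A) (h1 : (1 : ℝ) ∈ B) :
    ∃ a b : ℝ, 0 ≤ a ∧ a < b ∧ b ≤ 1 ∧ a ∈ A ∧ b ∈ B ∧ ∀ t ∈ Ioo a b, t ∉ A ∧ t ∉ B := by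
  have cB : IsCompact (Icc (0 : ℝ) 1 ∩ B) := isCompact_Icc.inter_right hB
  have hb := cB.sInf_mem ⟨1, by simp, h1⟩
  set b := sInf (Icc (0 : ℝ) 1 ∩ B) with hbdef
  have cA : IsCompact (Icc (0 : ℝ) b ∩ A) := isCompact_Icc.inter_right hA
  have ha := cA.sSup_mem ⟨0, ⟨le_refl _, hb.1.1⟩, h0⟩
  set a := sSup (Icc (0 : ℝ) b ∩ A) with hadef
  refine ⟨a, b, ha.1.1, lt_of_le_of_ne ha.1.2 ?_, hb.1.2, ha.2, hb.2, ?_⟩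
  · intro hh
    exact disjoint_left.mp hAB ha.2 (hh ▸ hb.2)
  · intro t ht
    constructor
    · intro htA
      have := le_csSup cA.bddAbove ⟨⟨by linarith [ha.1.1, ht.1], ht.2.le⟩, htA⟩
      linarith [ht.1]
    · intro htB
      have := csInf_le cB.bddBelow ⟨⟨by linarith [ha.1.1, ht.1], by linarith [ht.2, hb.1.2]⟩, htB⟩
      linarith [ht.2]

lemma frontier_sub {K : Set (EuclideanSpace ℝ (Fin 2))} {Ω : ℕ → Set (EuclideanSpace ℝ (Fin 2))}
    (hK : IsDetourSet 2 K Ω) (k : ℕ) :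
    IsOpen (Ω k) ∧ IsConnected (Ω k) ∧ Ω k ⊆ Kᶜ ∧ frontier (Ω k) ⊆ K := by
  obtain ⟨x, hx, he⟩ := hK.component k
  have hKo : IsOpen Kᶜ := hK.compact.isClosed.isOpen_compl
  have hop : IsOpen (Ω k) := he ▸ hKo.connectedComponentIn
  refine ⟨hop, he ▸ isConnected_connectedComponentIn_iff.mpr hx,
    he ▸ connectedComponentIn_subset _ _, ?_⟩
  intro z hz
  by_contra hzK
  have hzc : z ∈ Kᶜ := hzK
  rw [hop.frontier_eq] at hz
  obtain ⟨w, hw1, hw2⟩ := mem_closure_iff.mp hz.1 _ (hKo.connectedComponentIn (x := z))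
    (mem_connectedComponentIn hzc)
  rw [he] at hw2
  have h1 := connectedComponentIn_eq hw1
  have h2 := connectedComponentIn_eq hw2
  apply hz.2
  rw [he, h2, ← h1]
  exact mem_connectedComponentIn hzc

lemma locConn {K : Set (EuclideanSpace ℝ (Fin 2))} {Ω : ℕ → Set (EuclideanSpace ℝ (Fin 2))}
    (hK : IsDetourSet 2 K Ω)
    (hu : ∀ ε > 0, ∃ δ > 0, ∀ k, ∀ a ∈ frontier (Ω k), ∀ b ∈ frontier (Ω k), dist a b < δ →
      ∃ C ⊆ frontier (Ω k), IsPreconnected C ∧ a ∈ C ∧ b ∈ C ∧ C ⊆ ball a ε) :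
    LocallyConnectedSpace K := by
  rw [locallyConnectedSpace_iff_connected_subsets]
  rintro ⟨x, hx⟩ U hU
  obtain ⟨ε, hε, hεU⟩ := Metric.mem_nhds_iff.mp hU
  set M := K ∩ closedBall x (ε / 2) with hMdef
  have hM : IsCompact M := hK.compact.inter_right isClosed_closedBall
  have hxM : x ∈ M := ⟨hx, mem_closedBall_self (by linarith)⟩
  have hsub : connectedComponentIn M x ⊆ M := connectedComponentIn_subset _ _
  obtain ⟨δ, hδ, hC⟩ := hu (ε / 4) (by linarith)
  refine ⟨Subtype.val ⁻¹' (connectedComponentIn M x), ?_, ?_, ?_⟩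
  · rw [Metric.mem_nhds_iff]
    refine ⟨min δ (ε / 4), by positivity, ?_⟩
    rintro ⟨y, hyK⟩ hy
    have hyd : dist y x < min δ (ε / 4) := hy
    have hyδ : dist y x < δ := lt_of_lt_of_le hyd (min_le_left _ _)
    have hyε : dist y x < ε / 4 := lt_of_lt_of_le hyd (min_le_right _ _)
    show y ∈ connectedComponentIn M x
    by_contra hcon
    have hyM : y ∈ M := ⟨hyK, by rw [mem_closedBall]; linarith⟩
    obtain ⟨A, B, hA, hB, hAB, hABM, hxA, hyB⟩ := separate hM hxM hyM hcon
    set γ : ℝ → EuclideanSpace ℝ (Fin 2) := fun t => AffineMap.lineMap x y t with hγ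
    have hγc : Continuous γ := AffineMap.lineMap_continuous
    obtain ⟨a, b, ha0, hab, hb1, haA, hbB, hgap⟩ := gap (hA.preimage hγc) (hB.preimage hγc)
      (hAB.preimage γ) (by simpa [γ] using hxA) (by simpa [γ] using hyB)
    have hdist : ∀ t ∈ Icc (0 : ℝ) 1, dist (γ t) x < ε / 4 := by
      intro t ht
      have : dist (γ t) x = |t| * dist x y := by
        simp only [γ, dist_lineMap_left, Real.norm_eq_abs]
      rw [this, abs_of_nonneg ht.1, dist_comm x y]
      nlinarith [ht.2, dist_nonneg (x := y) (y := x)]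
    have hK' : ∀ t ∈ Ioo a b, γ t ∈ Kᶜ := by
      intro t ht htK
      have : γ t ∈ A ∪ B := by
        rw [hABM]
        exact ⟨htK, by
          rw [mem_closedBall]
          linarith [hdist t ⟨by linarith [ht.1], by linarith [ht.2]⟩]⟩
      exact this.elim (hgap t ht).1 (hgap t ht).2
    have hmid : (a + b) / 2 ∈ Ioo a b := ⟨by linarith, by linarith⟩
    obtain ⟨k, hk⟩ := hK.surj (γ ((a + b) / 2)) (hK' _ hmid)
    obtain ⟨hop, -, hΩK, hfr⟩ := frontier_sub hK k
    have hin : γ '' Ioo a b ⊆ Ω k := by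
      rw [hk]
      exact (isPreconnected_Ioo.image _ hγc.continuousOn).subset_connectedComponentIn
        ⟨_, hmid, rfl⟩ (by rintro _ ⟨t, ht, rfl⟩; exact hK' t ht)
    have hcl : ∀ t ∈ Icc a b, γ t ∈ closure (Ω k) := by
      intro t ht
      rw [← closure_Ioo hab.ne] at ht
      exact closure_mono hin (image_closure_subset_closure_image hγc ⟨t, ht, rfl⟩)
    have hAK : A ⊆ K := fun z hz => (hABM ▸ (Or.inl hz : z ∈ A ∪ B) : z ∈ M).1
    have hBK : B ⊆ K := fun z hz => (hABM ▸ (Or.inr hz : z ∈ A ∪ B) : z ∈ M).1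
    have hfa : γ a ∈ frontier (Ω k) := by
      rw [hop.frontier_eq]
      exact ⟨hcl a ⟨le_refl _, hab.le⟩, fun h => hΩK h (hAK haA)⟩
    have hfb : γ b ∈ frontier (Ω k) := by
      rw [hop.frontier_eq]
      exact ⟨hcl b ⟨hab.le, le_refl _⟩, fun h => hΩK h (hBK hbB)⟩
    have hdab : dist (γ a) (γ b) < δ := by
      have : dist (γ a) (γ b) = |a - b| * dist x y := by
        simp only [γ, dist_lineMap_lineMap, Real.dist_eq]
      rw [this, abs_of_neg (by linarith), dist_comm x y]
      nlinarith [dist_nonneg (x := y) (y := x)]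
    obtain ⟨C, hCf, hCp, haC, hbC, hCb⟩ := hC k _ hfa _ hfb hdab
    have hCM : C ⊆ A ∪ B := by
      intro z hz
      rw [hABM]
      refine ⟨hfr (hCf hz), ?_⟩
      have h1 : dist z (γ a) < ε / 4 := hCb hz
      have h2 := hdist a ⟨ha0, by linarith⟩
      rw [mem_closedBall]
      linarith [dist_triangle z (γ a) x]
    rcases (isPreconnected_iff_subset_of_disjoint_closed.mp hCp) A B hA hB hCM
      (by rw [hAB.inter_eq, inter_empty]) with h | h
    · exact disjoint_left.mp hAB (h hbC) hbB
    · exact disjoint_left.mp hAB haA (h haC)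
  · rw [← Topology.IsInducing.subtypeVal.isPreconnected_image, image_preimage_eq_of_subset]
    · exact isPreconnected_connectedComponentIn
    · rw [Subtype.range_coe]; exact fun z hz => (hsub hz).1
  · intro z hz
    apply hεU
    have : dist (z : EuclideanSpace ℝ (Fin 2)) x ≤ ε / 2 := (hsub hz).2
    show dist (z : EuclideanSpace ℝ (Fin 2)) x < ε
    linarith

noncomputable def rotv (v : EuclideanSpace ℝ (Fin 2)) : EuclideanSpace ℝ (Fin 2) := !₂[-v 1, v 0]

lemma rotv_sq (v z : EuclideanSpace ℝ (Fin 2)) :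
    (inner ℝ (rotv v) z) ^ 2 + (inner ℝ v z) ^ 2 = ‖v‖ ^ 2 * ‖z‖ ^ 2 := by
  simp only [rotv, PiLp.inner_apply, EuclideanSpace.norm_sq_eq, Fin.sum_univ_two, Real.norm_eq_abs,
    sq_abs]
  simp
  ring

lemma rotv_perp (v : EuclideanSpace ℝ (Fin 2)) : inner ℝ (rotv v) v = 0 := by
  simp only [rotv, PiLp.inner_apply, Fin.sum_univ_two]
  simp
  ring

lemma rotv_norm (v : EuclideanSpace ℝ (Fin 2)) : ‖rotv v‖ = ‖v‖ := by
  have : ‖rotv v‖ ^ 2 = ‖v‖ ^ 2 := by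
    simp only [rotv, EuclideanSpace.norm_sq_eq, Fin.sum_univ_two, Real.norm_eq_abs, sq_abs]
    simp
    ring
  exact (pow_left_inj₀ (norm_nonneg _) (norm_nonneg _) two_ne_zero).mp this

lemma eq_zero_of_rotv {v z : EuclideanSpace ℝ (Fin 2)} (hv : v ≠ 0)
    (h1 : inner ℝ (rotv v) z = 0) (h2 : inner ℝ v z = 0) : z = 0 := by
  have := rotv_sq v z
  rw [h1, h2] at this
  have hv' : ‖v‖ ≠ 0 := norm_ne_zero_iff.mpr hv
  have h3 : ‖v‖ * ‖z‖ = 0 := by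
    have : (‖v‖ * ‖z‖) ^ 2 = 0 := by rw [mul_pow]; linarith
    exact pow_eq_zero_iff two_ne_zero |>.mp this
  exact norm_eq_zero.mp ((mul_eq_zero.mp h3).resolve_left hv')

lemma par_of_rotv {v z : EuclideanSpace ℝ (Fin 2)} (hv : v ≠ 0)
    (h1 : inner ℝ (rotv v) z = 0) : ∃ t : ℝ, z = t • v := by
  have hv' : ‖v‖ ≠ 0 := norm_ne_zero_iff.mpr hv
  refine ⟨inner ℝ v z / ‖v‖ ^ 2, ?_⟩
  rw [← sub_eq_zero]
  apply eq_zero_of_rotv hv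
  · rw [inner_sub_right, inner_smul_right, rotv_perp, h1]; ring
  · rw [inner_sub_right, inner_smul_right, real_inner_self_eq_norm_sq]
    field_simp
    ring

lemma ray_hits {K : Set (EuclideanSpace ℝ (Fin 2))} {Ω : ℕ → Set (EuclideanSpace ℝ (Fin 2))}
    (hK : IsDetourSet 2 K Ω) {k : ℕ} (hk : k ≠ 0) {z v : EuclideanSpace ℝ (Fin 2)}
    (hz : z ∈ Ω k) (hv : v ≠ 0) : ∃ t : ℝ, 0 ≤ t ∧ z + t • v ∈ K := by
  by_contra hcon
  push Not at hcon
  obtain ⟨x, hx, he⟩ := hK.component k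
  have hc : Continuous (fun t : ℝ => z + t • v) := by fun_prop
  have hsub : (fun t : ℝ => z + t • v) '' Ici 0 ⊆ Ω k := by
    rw [he] at hz ⊢
    rw [connectedComponentIn_eq hz]
    apply (isPreconnected_Ici.image _ hc.continuousOn).subset_connectedComponentIn
    · exact ⟨0, by simp, by simp⟩
    · rintro _ ⟨t, ht, rfl⟩; exact hcon t ht
  obtain ⟨R, hR⟩ := (hK.bounded k hk).subset_closedBall z
  have hv' : 0 < ‖v‖ := norm_pos_iff.mpr hv
  have hR0 : 0 ≤ R := by
    have := hR hz
    rw [mem_closedBall, dist_self] at this; exact this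
  have := hR (hsub ⟨(R + 1) / ‖v‖, mem_Ici.mpr (by positivity), rfl⟩)
  rw [mem_closedBall, dist_eq_norm, add_sub_cancel_left, norm_smul, Real.norm_eq_abs,
    abs_of_nonneg (by positivity), div_mul_cancel₀ _ hv'.ne'] at this
  linarith

lemma comp_sub_ball {K : Set (EuclideanSpace ℝ (Fin 2))} {Ω : ℕ → Set (EuclideanSpace ℝ (Fin 2))}
    (hK : IsDetourSet 2 K Ω) {k : ℕ} (hk : k ≠ 0) {x : EuclideanSpace ℝ (Fin 2)} {r : ℝ}
    (hr : 0 ≤ r) (hKr : K ⊆ closedBall x r) : Ω k ⊆ closedBall x r := by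
  intro z hz
  by_cases hzx : z - x = 0
  · rw [sub_eq_zero.mp hzx]; exact mem_closedBall_self hr
  obtain ⟨t, ht, htK⟩ := ray_hits hK hk hz hzx
  have h1 := hKr htK
  have h2 : z + t • (z - x) - x = (1 + t) • (z - x) := by rw [add_smul, one_smul]; abel
  rw [mem_closedBall, dist_eq_norm, h2, norm_smul, Real.norm_eq_abs, abs_of_nonneg (by linarith)]
    at h1
  rw [mem_closedBall, dist_eq_norm]
  nlinarith [norm_nonneg (z - x)]

lemma halfplane {x e g y : EuclideanSpace ℝ (Fin 2)} {r r' ε : ℝ} (hr : 0 < r)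
    (he : dist e x = r) (hg : dist g e ≤ ε) (hy : dist y x ≤ r') (hε : ε + r' < r) :
    0 < inner ℝ (e - x) (g - y) := by
  have h1 : g - y = (g - e) + (e - x) - (y - x) := by abel
  rw [dist_eq_norm] at he hg hy
  rw [h1, inner_sub_right, inner_add_right, real_inner_self_eq_norm_sq, he]
  have h2 := (abs_le.mp (abs_real_inner_le_norm (e - x) (g - e))).1
  have h3 := (abs_le.mp (abs_real_inner_le_norm (e - x) (y - x))).2
  rw [he] at h2 h3
  nlinarith

lemma exit_point {x z v : EuclideanSpace ℝ (Fin 2)} {r r' : ℝ} (hr : r' < r) (hv : v ≠ 0)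
    (hz : dist z x ≤ r') :
    ∃ t : ℝ, 0 < t ∧ dist (z + t • v) x = r ∧ 0 < inner ℝ (z + t • v - x) v := by
  have hr0 : 0 ≤ r' := dist_nonneg.trans hz
  have hr1 : 0 < r := by linarith
  have hv' : 0 < ‖v‖ := norm_pos_iff.mpr hv
  have hc : ContinuousOn (fun t : ℝ => dist (z + t • v) x) (Icc 0 ((r + r') / ‖v‖)) := by fun_prop
  obtain ⟨t, ht, hte⟩ := intermediate_value_Icc (by positivity) hc
    (show r ∈ Icc _ _ from by
      constructor
      · simp; linarith
      · have h1 : dist (z + ((r + r') / ‖v‖) • v) z = r + r' := by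
          rw [dist_eq_norm, add_sub_cancel_left, norm_smul, Real.norm_eq_abs,
            abs_of_nonneg (by positivity), div_mul_cancel₀ _ hv'.ne']
        have := dist_triangle_right (z + ((r + r') / ‖v‖) • v) z x
        show r ≤ dist (z + ((r + r') / ‖v‖) • v) x
        linarith)
  have hte' : dist (z + t • v) x = r := hte
  have h2 := halfplane (g := z + t • v) (y := z) (ε := 0) (r' := r') (by linarith) hte' (by simp) hz
    (by linarith)
  rw [add_sub_cancel_left, inner_smul_right] at h2
  have ht0 : 0 < t := lt_of_le_of_ne ht.1 (fun h => by rw [← h, zero_mul] at h2; exact lt_irrefl _ h2)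
  exact ⟨t, ht0, hte', (pos_iff_pos_of_mul_pos h2).mp ht0⟩

lemma cross_core {v x e0 e1 : EuclideanSpace ℝ (Fin 2)} {r r' ε s0 s1 : ℝ} (hv : v ≠ 0)
    (hr : 0 < r) (hε : ε + r' < r) {γ σ : ℝ → EuclideanSpace ℝ (Fin 2)}
    (hγ : ContinuousOn γ (Icc 0 1)) (hσ : Continuous σ) (hσr : ∀ t, dist (σ t) x ≤ r')
    (he0 : dist e0 x = r) (he1 : dist e1 x = r)
    (hv0 : inner ℝ (e0 - x) v < 0) (hv1 : 0 < inner ℝ (e1 - x) v)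
    (hs0 : s0 ∈ Icc (0 : ℝ) 1) (hs1 : s1 ∈ Icc (0 : ℝ) 1)
    (hγ0 : dist (γ s0) e0 ≤ ε) (hγ1 : dist (γ s1) e1 ≤ ε)
    (ha : ∀ s ∈ Icc (0 : ℝ) 1, inner ℝ (rotv v) (σ 0) < inner ℝ (rotv v) (γ s))
    (hb : ∀ s ∈ Icc (0 : ℝ) 1, inner ℝ (rotv v) (γ s) < inner ℝ (rotv v) (σ 1))
    (hne : ∀ s ∈ Icc (0 : ℝ) 1, ∀ t, γ s ≠ σ t) : False := by
  set κ : ℝ → ℝ := fun s => max 0 (min 1 s) with hκ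
  have hκc : Continuous κ := by fun_prop
  have hκ01 : ∀ s, κ s ∈ Icc (0 : ℝ) 1 := fun s =>
    ⟨le_max_left _ _, max_le zero_le_one (min_le_left _ _)⟩
  set ρ : ℝ → ℝ := fun s => s0 + κ s * (s1 - s0) with hρ
  have hρc : Continuous ρ := by fun_prop
  have hρ01 : ∀ s, ρ s ∈ Icc (0 : ℝ) 1 := by
    intro s
    obtain ⟨h1, h2⟩ := hκ01 s
    obtain ⟨h3, h4⟩ := hs0
    obtain ⟨h5, h6⟩ := hs1
    constructor
    · show 0 ≤ s0 + κ s * (s1 - s0)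
      nlinarith
    · show s0 + κ s * (s1 - s0) ≤ 1
      nlinarith
  have hγρ : Continuous (fun s => γ (ρ s)) := hγ.comp_continuous hρc hρ01
  set g : ℝ → EuclideanSpace ℝ (Fin 2) := fun s => γ (ρ s) + (s - κ s) • v with hg
  have hgc : Continuous g := hγρ.add ((continuous_id.sub hκc).smul continuous_const)
  have hvp : 0 < ‖v‖ := norm_pos_iff.mpr hv
  have hpg : ∀ s, inner ℝ (rotv v) (g s) = inner ℝ (rotv v) (γ (ρ s)) := by
    intro s
    simp only [g, inner_add_right, inner_smul_right, rotv_perp, mul_zero, add_zero]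
  have hrnn : 0 ≤ r' := dist_nonneg.trans (hσr 0)
  have hε0 : 0 ≤ ε := dist_nonneg.trans hγ0
  set D : ℝ := ε + r + r' with hD
  set M : ℝ := (‖v‖ * D + 1) / ‖v‖ ^ 2 with hM
  have hM0 : 0 < M := by positivity
  have hMv : M * ‖v‖ ^ 2 = ‖v‖ * D + 1 := div_mul_cancel₀ _ (by positivity)
  have hg1 : ∀ s, 1 ≤ s → g s = γ s1 + (s - 1) • v := by
    intro s hs
    have : κ s = 1 := by simp [κ, hs]
    simp only [g, ρ, this]
    congr 2
    ring
  have hg0 : ∀ s, s ≤ 0 → g s = γ s0 + s • v := by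
    intro s hs
    have : κ s = 0 := by
      simp only [κ]
      exact max_eq_left ((min_le_right _ _).trans hs)
    simp only [g, ρ, this]
    simp
  have hgm : ∀ s ∈ Icc (0 : ℝ) 1, g s = γ (ρ s) := by
    intro s hs
    have : κ s = s := by simp [κ, hs.1, hs.2]
    simp only [g, this]
    simp
  have hd1 : ∀ t, ‖γ s1 - σ t‖ ≤ D := by
    intro t
    rw [← dist_eq_norm]
    have h1 := dist_triangle (γ s1) e1 (σ t)
    have h2 := dist_triangle_right e1 (σ t) x
    have h3 := hσr t
    linarith
  have hd0 : ∀ t, ‖γ s0 - σ t‖ ≤ D := by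
    intro t
    rw [← dist_eq_norm]
    have h1 := dist_triangle (γ s0) e0 (σ t)
    have h2 := dist_triangle_right e0 (σ t) x
    have h3 := hσr t
    linarith
  refine crossing_s3 (fun z => ⟨inner ℝ (rotv v) (g z.1 - σ z.2), inner ℝ v (g z.1 - σ z.2)⟩)
    ?_ ?_ (-M) (1 + M) 0 1 ?_ ?_ ?_ ?_
  · have h1 : Continuous fun z : ℝ × ℝ => inner ℝ (rotv v) (g z.1 - σ z.2) := by fun_prop
    have h2 : Continuous fun z : ℝ × ℝ => inner ℝ v (g z.1 - σ z.2) := by fun_prop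
    exact Complex.equivRealProdCLM.symm.continuous.comp (h1.prodMk h2)
  · rintro ⟨s, t⟩ h0
    have h1 := congrArg Complex.re h0
    have h2 := congrArg Complex.im h0
    simp only [Complex.zero_re, Complex.zero_im] at h1 h2
    have h3 := eq_zero_of_rotv hv h1 h2
    rcases le_total 1 s with hs | hs
    · rw [hg1 s hs] at h3
      have h4 := halfplane hr he1 hγ1 (hσr t) hε
      have h5 : γ s1 - σ t = -((s - 1) • v) := by
        rw [eq_neg_iff_add_eq_zero, ← h3]; abel
      rw [h5, inner_neg_right, inner_smul_right] at h4
      nlinarith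
    · rcases le_total s 0 with hs' | hs'
      · rw [hg0 s hs'] at h3
        have h4 := halfplane hr he0 hγ0 (hσr t) hε
        have h5 : γ s0 - σ t = -(s • v) := by
          rw [eq_neg_iff_add_eq_zero, ← h3]; abel
        rw [h5, inner_neg_right, inner_smul_right] at h4
        nlinarith
      · rw [hgm s ⟨hs', hs⟩] at h3
        exact hne _ (hρ01 s) t (sub_eq_zero.mp h3)
  · intro s
    show 0 < inner ℝ (rotv v) (g s - σ 0)
    rw [inner_sub_right, hpg]
    linarith [ha _ (hρ01 s)]
  · intro s
    show inner ℝ (rotv v) (g s - σ 1) < 0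
    rw [inner_sub_right, hpg]
    linarith [hb _ (hρ01 s)]
  · intro t
    show inner ℝ v (g (-M) - σ t) < 0
    rw [hg0 _ (by linarith), show γ s0 + -M • v - σ t = (γ s0 - σ t) - M • v by
      rw [neg_smul]; abel, inner_sub_right, inner_smul_right, real_inner_self_eq_norm_sq, hMv]
    have h1 := (abs_le.mp (abs_real_inner_le_norm v (γ s0 - σ t))).2
    nlinarith [hd0 t]
  · intro t
    show 0 < inner ℝ v (g (1 + M) - σ t)
    rw [hg1 _ (by linarith), show γ s1 + (1 + M - 1) • v - σ t = (γ s1 - σ t) + M • v by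
      rw [add_sub_cancel_left]; abel, inner_add_right, inner_smul_right,
      real_inner_self_eq_norm_sq, hMv]
    have h1 := (abs_le.mp (abs_real_inner_le_norm v (γ s1 - σ t))).1
    nlinarith [hd1 t]

lemma finite_strip {K : Set (EuclideanSpace ℝ (Fin 2))} {Ω : ℕ → Set (EuclideanSpace ℝ (Fin 2))}
    (hK : IsDetourSet 2 K Ω) {x v : EuclideanSpace ℝ (Fin 2)} {r r' : ℝ} (hrnn : 0 ≤ r')
    (hr : r' < r) (hKr : K ⊆ closedBall x r') (hv : v ≠ 0)
    (hae : ∀ᵐ w : ↥(Submodule.span ℝ {v})ᗮ, HasDetourProperty Ω (closedBall x r)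
      (lineThrough (w : EuclideanSpace ℝ (Fin 2)) v)) {α β : ℝ} (hαβ : α < β) :
    {k : ℕ | k ≠ 0 ∧ ∃ a ∈ Ω k, ∃ b ∈ Ω k, inner ℝ (rotv v) a ≤ α ∧
      β ≤ inner ℝ (rotv v) b}.Finite := by
  have hvp : 0 < ‖v‖ := norm_pos_iff.mpr hv
  have hup : 0 < ‖rotv v‖ := by rw [rotv_norm]; exact hvp
  have hdense := MeasureTheory.Measure.dense_of_ae hae
  have hopen : IsOpen {w : ↥(Submodule.span ℝ {v})ᗮ |
      inner ℝ (rotv v) (w : EuclideanSpace ℝ (Fin 2)) ∈ Ioo α β} :=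
    isOpen_Ioo.preimage (by fun_prop)
  obtain ⟨w, hw, hgood⟩ := hdense.inter_open_nonempty _ hopen (by
    refine ⟨⟨((α + β) / 2 / ‖rotv v‖ ^ 2) • rotv v, ?_⟩, ?_⟩
    · rw [Submodule.mem_orthogonal_singleton_iff_inner_left]
      rw [inner_smul_left, rotv_perp, mul_zero]
    · show inner ℝ (rotv v) (((α + β) / 2 / ‖rotv v‖ ^ 2) • rotv v) ∈ Ioo α β
      rw [inner_smul_right, real_inner_self_eq_norm_sq, div_mul_cancel₀ _ (by positivity)]
      constructor <;> linarith)
  set c := inner ℝ (rotv v) (w : EuclideanSpace ℝ (Fin 2)) with hc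
  set L := lineThrough (w : EuclideanSpace ℝ (Fin 2)) v with hL
  have hcL : ∀ y ∈ L, inner ℝ (rotv v) y = c := by
    rintro y ⟨t, rfl⟩
    rw [inner_add_right, inner_smul_right, rotv_perp, mul_zero, add_zero]
  obtain ⟨ε, hε0, hε1, hε2, hε3⟩ : ∃ ε > 0, ε + r' < r ∧ ‖rotv v‖ * ε ≤ c - α ∧
      ‖rotv v‖ * ε ≤ β - c := by
    have h1 : 0 < c - α := by linarith [hw.1]
    have h2 : 0 < β - c := by linarith [hw.2]
    refine ⟨min ((r - r') / 2) (min (c - α) (β - c) / ‖rotv v‖), ?_, ?_, ?_, ?_⟩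
    · have : 0 < r - r' := by linarith
      positivity
    · have := min_le_left ((r - r') / 2) (min (c - α) (β - c) / ‖rotv v‖)
      linarith
    all_goals
      have h3 := mul_le_mul_of_nonneg_left
        (min_le_right ((r - r') / 2) (min (c - α) (β - c) / ‖rotv v‖)) hup.le
      rw [mul_div_cancel₀ _ hup.ne'] at h3
    · exact h3.trans (min_le_left _ _)
    · exact h3.trans (min_le_right _ _)
  obtain ⟨γ, hγc, hγd, -, hfin, -⟩ := hgood (ε / 2) (by linarith)
  refine hfin.subset ?_
  rintro k ⟨hk0, a, haΩ, b, hbΩ, haα, hbβ⟩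
  by_contra hkT
  have hkT' : ¬ (γ '' Icc 0 1 ∩ closure (Ω k)).Nonempty := hkT
  obtain ⟨hop, hconn, -, -⟩ := frontier_sub hK k
  have hΩr := comp_sub_ball hK hk0 hrnn hKr
  obtain ⟨z, hzΩ, hzc⟩ : ∃ z ∈ Ω k, inner ℝ (rotv v) z = c := by
    have := hconn.isPreconnected.intermediate_value haΩ hbΩ
      (f := fun z => inner ℝ (rotv v) z) (by fun_prop)
    exact this ⟨by linarith [hw.1], by linarith [hw.2]⟩
  have hzL : z ∈ L := by
    obtain ⟨t, ht⟩ := par_of_rotv hv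
      (z := z - w) (by rw [inner_sub_right, hzc, hc, sub_self])
    exact ⟨t, by rw [← ht]; abel⟩
  have hLadd : ∀ t : ℝ, z + t • v ∈ L := by
    obtain ⟨t0, ht0⟩ := hzL
    intro t
    exact ⟨t0 + t, by rw [ht0, add_smul]; abel⟩
  have hzr : dist z x ≤ r' := hΩr hzΩ
  obtain ⟨t1, -, he1, hv1⟩ := exit_point hr hv hzr
  obtain ⟨t0, -, he0, hv0⟩ := exit_point hr (neg_ne_zero.mpr hv) hzr
  rw [smul_neg, ← neg_smul] at he0 hv0
  rw [inner_neg_right] at hv0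
  have hne : Metric.hausdorffEDist (γ '' Icc 0 1) (L ∩ closedBall x r) ≠ ⊤ :=
    Metric.hausdorffEDist_ne_top_of_nonempty_of_bounded ⟨_, 0, by simp, rfl⟩
      ⟨_, hLadd t1, by rw [mem_closedBall, he1]⟩
      (isCompact_Icc.image_of_continuousOn hγc).isBounded
      (isBounded_closedBall.subset inter_subset_right)
  have hlt : hausdorffDist (γ '' Icc 0 1) (L ∩ closedBall x r) < ε := by linarith
  obtain ⟨_, ⟨s1, hs1, rfl⟩, hd1⟩ := Metric.exists_dist_lt_of_hausdorffDist_lt'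
    (show z + t1 • v ∈ L ∩ closedBall x r from ⟨hLadd t1, by rw [mem_closedBall, he1]⟩) hlt hne
  obtain ⟨_, ⟨s0, hs0, rfl⟩, hd0⟩ := Metric.exists_dist_lt_of_hausdorffDist_lt'
    (show z + (-t0) • v ∈ L ∩ closedBall x r from ⟨hLadd (-t0), by rw [mem_closedBall, he0]⟩) hlt hne
  have hstrip : ∀ s ∈ Icc (0 : ℝ) 1, |inner ℝ (rotv v) (γ s) - c| < ‖rotv v‖ * ε := by
    intro s hs
    obtain ⟨y, hy, hyd⟩ := Metric.exists_dist_lt_of_hausdorffDist_lt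
      (mem_image_of_mem γ hs) hlt hne
    rw [← hcL y hy.1, ← inner_sub_right]
    rw [dist_eq_norm] at hyd
    exact lt_of_le_of_lt (abs_real_inner_le_norm _ _) (mul_lt_mul_of_pos_left hyd hup)
  have hJ : JoinedIn (Ω k) a b :=
    ((hop.isConnected_iff_isPathConnected).mp hconn).joinedIn a haΩ b hbΩ
  have hσmem : ∀ t, hJ.somePath.extend t ∈ Ω k := by
    intro t
    have : hJ.somePath.extend t ∈ range hJ.somePath := by
      rw [← Path.extend_range]; exact mem_range_self t
    obtain ⟨y, hy⟩ := this
    rw [← hy]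
    exact hJ.somePath_mem y
  refine cross_core (γ := γ) (σ := hJ.somePath.extend) (ε := ε) (r' := r') hv (by linarith) hε1 hγc
    hJ.somePath.continuous_extend (fun t => hΩr (hσmem t)) he0 he1 (by linarith) hv1 hs0 hs1
    hd0.le hd1.le ?_ ?_ ?_
  · intro s hs
    rw [Path.extend_zero]
    have := (abs_lt.mp (hstrip s hs)).1
    linarith
  · intro s hs
    rw [Path.extend_one]
    have := (abs_lt.mp (hstrip s hs)).2
    linarith
  · intro s hs t h
    exact hkT' ⟨_, ⟨s, hs, rfl⟩, subset_closure (h ▸ hσmem t)⟩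

lemma finite_osc {K : Set (EuclideanSpace ℝ (Fin 2))} {Ω : ℕ → Set (EuclideanSpace ℝ (Fin 2))}
    (hK : IsDetourSet 2 K Ω) {x v : EuclideanSpace ℝ (Fin 2)} {r r' : ℝ} (hrnn : 0 ≤ r')
    (hr : r' < r) (hKr : K ⊆ closedBall x r') (hv : v ≠ 0)
    (hae : ∀ᵐ w : ↥(Submodule.span ℝ {v})ᗮ, HasDetourProperty Ω (closedBall x r)
      (lineThrough (w : EuclideanSpace ℝ (Fin 2)) v)) {η : ℝ} (hη : 0 < η) :
    {k : ℕ | k ≠ 0 ∧ ∃ a ∈ Ω k, ∃ b ∈ Ω k,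
      η ≤ inner ℝ (rotv v) b - inner ℝ (rotv v) a}.Finite := by
  set R := ‖rotv v‖ * (‖x‖ + r') / (η / 3) with hR
  have hη3 : 0 < η / 3 := by linarith
  refine ((Set.finite_Icc (⌊-R⌋ : ℤ) (⌊R⌋ : ℤ)).biUnion fun j _ =>
    finite_strip hK hrnn hr hKr hv hae (α := (j + 1) * (η / 3)) (β := (j + 2) * (η / 3))
      (by nlinarith)).subset ?_
  rintro k ⟨hk0, a, ha, b, hb, hab⟩
  have h1 : |inner ℝ (rotv v) a / (η / 3)| ≤ R := by
    rw [abs_div, abs_of_pos hη3, hR]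
    apply div_le_div_of_nonneg_right _ hη3.le
    refine (abs_real_inner_le_norm _ _).trans ?_
    apply mul_le_mul_of_nonneg_left _ (norm_nonneg _)
    have := comp_sub_ball hK hk0 hrnn hKr ha
    rw [mem_closedBall, dist_eq_norm] at this
    have h2 := norm_add_le x (a - x)
    rw [add_sub_cancel] at h2
    linarith
  set j := ⌊inner ℝ (rotv v) a / (η / 3)⌋ with hj
  have h2 : (j : ℝ) ≤ inner ℝ (rotv v) a / (η / 3) := Int.floor_le _
  have h3 : inner ℝ (rotv v) a / (η / 3) < j + 1 := Int.lt_floor_add_one _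
  rw [le_div_iff₀ hη3] at h2
  rw [div_lt_iff₀ hη3] at h3
  refine mem_biUnion (x := j) ⟨Int.floor_le_floor (abs_le.mp h1).1, Int.floor_le_floor (abs_le.mp h1).2⟩ ?_
  exact ⟨hk0, a, ha, b, hb, h3.le, by nlinarith⟩

lemma finite_diam {K : Set (EuclideanSpace ℝ (Fin 2))} {Ω : ℕ → Set (EuclideanSpace ℝ (Fin 2))}
    (hK : IsDetourSet 2 K Ω) {ε : ℝ} (hε : 0 < ε) :
    {k : ℕ | ¬ (∀ a ∈ Ω k, ∀ b ∈ Ω k, dist a b ≤ ε)}.Finite := by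
  obtain ⟨x, r, hr, hKr, v, hv, hae⟩ := hK.detour
  obtain ⟨r', hrnn, hr', hKr'⟩ : ∃ r', 0 ≤ r' ∧ r' < r ∧ K ⊆ closedBall x r' := by
    obtain ⟨r', h1, h2⟩ := exists_lt_subset_ball hK.compact.isClosed hKr
    refine ⟨max 0 r', le_max_left _ _, max_lt hr h1,
      (h2.trans ball_subset_closedBall).trans (closedBall_subset_closedBall (le_max_right _ _))⟩
  have hv0 : ∀ i, v i ≠ 0 := fun i => hv.ne_zero i
  set f : EuclideanSpace ℝ (Fin 2) →ₗ[ℝ] ℝ × ℝ :=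
    ((innerSL ℝ (rotv (v 0))).toLinearMap).prod (innerSL ℝ (rotv (v 1))).toLinearMap with hf
  have hfz : ∀ z, f z = (inner ℝ (rotv (v 0)) z, inner ℝ (rotv (v 1)) z) := fun z => rfl
  obtain ⟨C, hC0, hC⟩ := f.exists_antilipschitzWith (by
    rw [LinearMap.ker_eq_bot']
    intro z hz
    rw [hfz, Prod.mk_eq_zero] at hz
    obtain ⟨s, hs⟩ := par_of_rotv (hv0 0) hz.1
    obtain ⟨t, ht⟩ := par_of_rotv (hv0 1) hz.2
    have hli := LinearIndependent.pair_iff.mp (show LinearIndependent ℝ ![v 0, v 1] by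
      convert hv using 1; ext i; fin_cases i <;> rfl) s (-t) (by rw [neg_smul, ← ht, ← hs]; abel)
    rw [hs, hli.1, zero_smul])
  have hCp : (0 : ℝ) < C := hC0
  have hη : 0 < ε / C := by positivity
  refine ((finite_singleton 0).union ((finite_osc hK hrnn hr' hKr' (hv0 0) (hae 0) hη).union
    (finite_osc hK hrnn hr' hKr' (hv0 1) (hae 1) hη))).subset ?_
  intro k hk
  by_contra hcon
  simp only [mem_union, mem_singleton_iff, Set.mem_ofPred_eq, not_or, not_and, not_exists, not_le] at hcon
  obtain ⟨hk0, h0, h1⟩ := hcon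
  apply hk
  intro a ha b hb
  have hd := hC.le_mul_dist a b
  refine hd.trans ?_
  have : dist (f a) (f b) ≤ ε / C := by
    rw [hfz, hfz, Prod.dist_eq, Real.dist_eq, Real.dist_eq]
    apply max_le
    · exact abs_le.mpr ⟨by linarith [h0 hk0 a ha b hb], by linarith [h0 hk0 b hb a ha]⟩
    · exact abs_le.mpr ⟨by linarith [h1 hk0 a ha b hb], by linarith [h1 hk0 b hb a ha]⟩
  calc (C : ℝ) * dist (f a) (f b) ≤ C * (ε / C) := by gcongr
    _ = ε := mul_div_cancel₀ _ hCp.ne'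

theorem statement3 (K : Set (EuclideanSpace ℝ (Fin 2)))
    (Ω : ℕ → Set (EuclideanSpace ℝ (Fin 2))) (hK : IsDetourSet 2 K Ω)
    (h0 : IsUnboundedJordanRegion (Ω 0))
    (hk : ∀ k : ℕ, k ≠ 0 → IsJordanRegion (Ω k)) :
    LocallyConnectedSpace K := by
  have hJ : ∀ k, IsJordanCurve (frontier (Ω k)) := by
    intro k
    by_cases h : k = 0
    · rw [h]; exact h0.1
    · exact (hk k h).2
  apply locConn hK
  intro ε hε
  have hT := finite_diam hK (half_pos hε)
  choose d hd0 hd using fun k => jordan_ulc (hJ k) ε hε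
  have hev : ∀ᶠ δ in 𝓝[>] (0 : ℝ), ∀ k ∈ {k : ℕ | ¬ (∀ a ∈ Ω k, ∀ b ∈ Ω k, dist a b ≤ ε / 2)},
      δ < d k :=
    (Filter.eventually_all_finite hT).mpr fun k _ =>
      Filter.Eventually.filter_mono nhdsWithin_le_nhds (eventually_lt_nhds (hd0 k))
  obtain ⟨δ, hδ, hδ0⟩ := (hev.and self_mem_nhdsWithin).exists
  refine ⟨δ, hδ0, fun k a ha b hb hab => ?_⟩
  by_cases hkT : ∀ a ∈ Ω k, ∀ b ∈ Ω k, dist a b ≤ ε / 2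
  · refine ⟨_, subset_rfl, jordan_connected (hJ k), ha, hb, fun z hz => ?_⟩
    have hbd : Bornology.IsBounded (Ω k) := Metric.isBounded_iff.mpr ⟨_, fun a ha b hb => hkT a ha b hb⟩
    have h1 : diam (closure (Ω k)) ≤ ε / 2 := by
      rw [Metric.diam_closure]
      exact Metric.diam_le_of_forall_dist_le (by linarith) hkT
    have h2 := Metric.dist_le_diam_of_mem hbd.closure (frontier_subset_closure hz)
      (frontier_subset_closure ha)
    rw [mem_ball]
    linarith
  · exact hd k a ha b hb (hab.trans (hδ k hkT))
end

section
/- Let K ⊆ ℝ² be a detour set whose complementary components are Jordan regions when regarded as subsets of the Riemann sphere (i.e., each bounded component Ω_k, k ≥ 1, is a Jordan region, and the unbounded component Ω₀ is an unbounded Jordan region). Then the set of local cut points of K is dense in K. -/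
open MeasureTheory Metric Set Filter
open scoped ENNReal NNReal Topology

/-- A point `x` of a topological space is a local cut point if it has a connected open
neighborhood `U` such that `U \ {x}` is disconnected. -/
def IsLocalCutPoint (X : Type*) [TopologicalSpace X] (x : X) : Prop :=
  ∃ U : Set X, IsOpen U ∧ x ∈ U ∧ IsConnected U ∧ ¬ IsPreconnected (U \ {x})


lemma isSimplyConnected_of_convex {U : Set ℂ} (hU : Convex ℝ U) (hne : U.Nonempty) :
    IsSimplyConnected U := by
  have : ContractibleSpace U := hU.contractibleSpace hne
  change SimplyConnectedSpace U
  infer_instance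

/-- `f` has a continuous logarithm on `X`. -/
def HasLog (X : Set ℂ) (f : ℂ → ℂ) : Prop :=
  ∃ g : ℂ → ℂ, ContinuousOn g X ∧ ∀ z ∈ X, Complex.exp (g z) = f z

lemma HasLog.mono {X Y : Set ℂ} {f : ℂ → ℂ} (h : HasLog Y f) (hXY : X ⊆ Y) : HasLog X f := by
  obtain ⟨g, hg, hg'⟩ := h
  exact ⟨g, hg.mono hXY, fun z hz => hg' z (hXY hz)⟩

lemma HasLog.congr {X : Set ℂ} {f f' : ℂ → ℂ} (h : HasLog X f) (hff : ∀ z ∈ X, f z = f' z) :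
    HasLog X f' := by
  obtain ⟨g, hg, hg'⟩ := h
  exact ⟨g, hg, fun z hz => (hg' z hz).trans (hff z hz)⟩

lemma HasLog.mul {X : Set ℂ} {f f' : ℂ → ℂ} (h : HasLog X f) (h' : HasLog X f') :
    HasLog X (fun z => f z * f' z) := by
  obtain ⟨g, hg, hg1⟩ := h
  obtain ⟨g', hg', hg1'⟩ := h'
  exact ⟨fun z => g z + g' z, hg.add hg', fun z hz => by
    simp only [Complex.exp_add, hg1 z hz, hg1' z hz]⟩

lemma HasLog.inv {X : Set ℂ} {f : ℂ → ℂ} (h : HasLog X f) :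
    HasLog X (fun z => (f z)⁻¹) := by
  obtain ⟨g, hg, hg1⟩ := h
  exact ⟨fun z => - g z, hg.neg, fun z hz => by
    simp only [Complex.exp_neg, hg1 z hz]⟩

lemma HasLog.div {X : Set ℂ} {f f' : ℂ → ℂ} (h : HasLog X f) (h' : HasLog X f') :
    HasLog X (fun z => f z / f' z) := by
  simpa [div_eq_mul_inv] using h.mul h'.inv

/-- principal branch near 1 -/
lemma hasLog_of_near_one {X : Set ℂ} {f : ℂ → ℂ} (hf : ContinuousOn f X)
    (h : ∀ z ∈ X, ‖f z - 1‖ < 1) : HasLog X f := by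
  have key : ∀ z ∈ X, f z ∈ Complex.slitPlane := by
    intro z hz
    have := Complex.mem_slitPlane_of_norm_lt_one (h z hz)
    simpa using this
  exact ⟨fun z => Complex.log (f z), hf.clog key, fun z hz =>
    Complex.exp_log (Complex.slitPlane_ne_zero (key z hz))⟩

lemma hasLog_quot {X : Set ℂ} {q q' : ℂ} (h : ∀ z ∈ X, ‖q' - q‖ < ‖z - q'‖) :
    HasLog X (fun z => (z - q) / (z - q')) := by
  have hne : ∀ z ∈ X, z - q' ≠ 0 := fun z hz h0 => by
    have := h z hz
    rw [h0, norm_zero] at this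
    exact absurd this (not_lt.2 (norm_nonneg _))
  apply hasLog_of_near_one
  · exact ContinuousOn.div (by fun_prop) (by fun_prop) hne
  · intro z hz
    have : (z - q) / (z - q') - 1 = (q' - q) / (z - q') := by
      field_simp [hne z hz]
      ring
    rw [this, norm_div, div_lt_one (norm_pos_iff.2 (hne z hz))]
    exact h z hz

/-- no continuous log of `z` on a circle -/
lemma not_hasLog_circle {R : ℝ} (hR : 0 < R) : ¬ HasLog (sphere (0 : ℂ) R) (fun z => z) := by
  rintro ⟨g, hg, hg'⟩
  have hc : ∀ t : ℝ, (R : ℂ) * Complex.exp (t * Complex.I) ∈ sphere (0 : ℂ) R := by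
    intro t
    simp [Complex.norm_exp_ofReal_mul_I, abs_of_pos hR]
  let k : ℝ → ℂ := fun t => g ((R : ℂ) * Complex.exp (t * Complex.I)) - t * Complex.I
  have hk : Continuous k := by
    apply Continuous.sub
    · exact hg.comp_continuous (by fun_prop) hc
    · fun_prop
  have hk' : ∀ t, Complex.exp (k t) = R := by
    intro t
    simp only [k, Complex.exp_sub, hg' _ (hc t)]
    field_simp [Complex.exp_ne_zero]
  -- k takes values in a discrete set
  have hper : k (2 * Real.pi) = k 0 - 2 * Real.pi * Complex.I := by
    simp only [k]
    push_cast
    rw [Complex.exp_two_pi_mul_I]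
    simp
  have hconst : ∀ t, k t = k 0 := by
    intro t
    let F : C(ℝ, ℂ) := ⟨k, hk⟩
    have h1 := Complex.isCoveringMap_exp.eq_of_comp_eq (A := ℝ) (g₁ := k) (g₂ := fun _ => k 0)
      hk continuous_const (by
        funext s
        apply Subtype.ext
        simp [hk']) 0 rfl
    exact congrFun h1 t
  have h2 := hconst (2 * Real.pi)
  rw [hper] at h2
  have : (2 * Real.pi * Complex.I : ℂ) = 0 := by linear_combination -h2
  simp [Real.pi_ne_zero] at this

/-- a nonvanishing continuous map of the plane is not at bounded distance from the identity -/
lemma no_nonvanishing {h : ℂ → ℂ} (hc : Continuous h) (h0 : ∀ z, h z ≠ 0) {C : ℝ}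
    (hb : ∀ z, ‖h z - z‖ ≤ C) : False := by
  have hC : 0 ≤ C := (norm_nonneg _).trans (hb 0)
  obtain ⟨g, hg, hg'⟩ := Complex.exists_continuousOn_eqOn_exp_comp (U := (univ : Set ℂ)) (g := h)
    (isSimplyConnected_of_convex convex_univ ⟨0, mem_univ _⟩) isOpen_univ hc.continuousOn (by rintro ⟨z, -, hz⟩; exact h0 z hz)
  have hR : 0 < C + 1 := by linarith
  apply not_hasLog_circle hR
  have l1 : HasLog (sphere (0 : ℂ) (C + 1)) h := ⟨g, hg.mono (subset_univ _), fun z _ => hg' (mem_univ z)⟩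
  have hz0 : ∀ z ∈ sphere (0 : ℂ) (C + 1), z ≠ 0 := by
    rintro z hz rfl
    simp at hz; linarith
  have l2 : HasLog (sphere (0 : ℂ) (C + 1)) (fun z => h z / z) := by
    apply hasLog_of_near_one
    · exact hc.continuousOn.div continuousOn_id hz0
    · intro z hz
      have hz1 : ‖z‖ = C + 1 := by simpa using hz
      have : h z / z - 1 = (h z - z) / z := by field_simp [hz0 z hz]
      rw [this, norm_div, hz1, div_lt_one hR]
      linarith [hb z]
  refine (l1.div l2).congr fun z hz => ?_
  have := hz0 z hz
  have := h0 z
  field_simp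

lemma hasLog_ball {p q : ℂ} {ρ : ℝ} (hρ : 0 < ρ) (hq : q ∉ ball p ρ) :
    HasLog (ball p ρ) (fun z => z - q) := by
  obtain ⟨g, hg, hg'⟩ := Complex.exists_continuousOn_eqOn_exp_comp (U := ball p ρ)
    (g := fun z => z - q)
    (isSimplyConnected_of_convex (convex_ball p ρ) ⟨p, mem_ball_self hρ⟩) isOpen_ball
    (by fun_prop) (by
      rintro ⟨z, hz, h0⟩
      rw [sub_eq_zero] at h0
      exact hq (h0 ▸ hz))
  exact ⟨g, hg, fun z hz => hg' hz⟩

lemma hasLog_component {X C : Set ℂ} (hX : IsClosed X) (hC : IsPreconnected C) (hCX : C ⊆ Xᶜ)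
    {q q' : ℂ} (hq : q ∈ C) (hq' : q' ∈ C) : HasLog X (fun z => (z - q) / (z - q')) := by
  refine hC.induction₂ (fun q q' => HasLog X (fun z => (z - q) / (z - q'))) ?_ ?_ ?_ hq hq'
  · intro x hx
    obtain ⟨δ, hδ, hball⟩ := Metric.isOpen_iff.1 hX.isOpen_compl x (hCX hx)
    apply mem_nhdsWithin_of_mem_nhds
    filter_upwards [ball_mem_nhds x (half_pos hδ)] with y hy
    apply hasLog_quot
    intro z hz
    have h1 : δ ≤ dist z x := by
      by_contra hlt
      exact hball (mem_ball.2 (not_le.1 hlt)) hz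
    have h2 : dist y x < δ / 2 := hy
    have h3 := dist_triangle z y x
    rw [← dist_eq_norm, ← dist_eq_norm]
    linarith
  · intro x y z hx hy hz h1 h2
    refine (h1.mul h2).congr fun w hw => ?_
    have hw1 : w - y ≠ 0 := sub_ne_zero.2 (fun h => hCX hy (h ▸ hw))
    by_cases h : w - z = 0
    · simp [h]
    · field_simp
  · intro x y hx hy h
    refine h.inv.congr fun w hw => ?_
    simp

lemma hasLog_glue {X Y : Set ℂ} {f : ℂ → ℂ} (hX : IsClosed X) (hY : IsClosed Y)
    (hS : IsPreconnected (X ∩ Y)) (h1 : HasLog X f) (h2 : HasLog Y f) : HasLog (X ∪ Y) f := by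
  classical
  obtain ⟨g, hg, hg'⟩ := h1
  obtain ⟨k, hk, hk'⟩ := h2
  obtain ⟨c, hc, hgk⟩ : ∃ c : ℂ, Complex.exp c = 1 ∧ ∀ z ∈ X ∩ Y, g z = k z + c := by
    rcases (X ∩ Y).eq_empty_or_nonempty with he | ⟨s, hs⟩
    · exact ⟨0, by simp, by simp [he]⟩
    · have hexp : Complex.exp (g s - k s) = 1 := by
        rw [Complex.exp_sub, hg' s hs.1, hk' s hs.2, div_self]
        rw [← hg' s hs.1]
        exact Complex.exp_ne_zero _
      refine ⟨g s - k s, hexp, ?_⟩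
      refine Complex.isCoveringMap_exp.eqOn_of_comp_eqOn hS (hg.mono inter_subset_left)
        ((hk.mono inter_subset_right).add continuousOn_const) ?_ hs (by ring)
      intro z hz
      apply Subtype.ext
      simp only [Function.comp, Complex.exp_add, hexp, hg' z hz.1, hk' z hz.2, mul_one]
  refine ⟨X.piecewise g (fun z => k z + c), ?_, ?_⟩
  · apply ContinuousOn.union_of_isClosed _ _ hX hY
    · exact hg.congr fun z hz => by simp [hz]
    · refine (hk.add (continuousOn_const (c := c))).congr fun z hz => ?_
      by_cases hzX : z ∈ X
      · simp only [hzX, piecewise_eq_of_mem]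
        exact hgk z ⟨hzX, hz⟩
      · simp [hzX]
  · intro z hz
    by_cases hzX : z ∈ X
    · simp [hzX, hg' z hzX]
    · simp [hzX, Complex.exp_add, hc, hk' z (hz.resolve_left hzX)]

/-- The boundary of a bounded open set carries no log of the quotient of two linear factors, one inside and one
outside. -/
lemma not_hasLog_frontier {V : Set ℂ} (hb : Bornology.IsBounded V) {q q' : ℂ}
    (hq : q ∈ V) (hq' : q' ∉ closure V) :
    ¬ HasLog (frontier V) (fun z => (z - q) / (z - q')) := by
  classical
  rintro ⟨g, hg, hg'⟩
  obtain ⟨G, hG⟩ := ContinuousMap.exists_restrict_eq (Y := ℂ) (isClosed_frontier (s := V))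
    ⟨(frontier V).domRestrict g, continuousOn_iff_continuous_domRestrict.1 hg⟩
  have hG' : ∀ z ∈ frontier V, G z = g z := fun z hz => by
    have := DFunLike.congr_fun hG ⟨z, hz⟩
    simpa using this
  let h1 : ℂ → ℂ := fun z => (z - q') * Complex.exp (G z)
  have hh1 : Continuous h1 := by fun_prop
  let h : ℂ → ℂ := fun z => if z ∈ V then h1 z else z - q
  have hc : Continuous h := by
    apply Continuous.if _ hh1 (by fun_prop)
    intro z hz
    have hz' : z ∈ frontier V := hz
    have : z - q' ≠ 0 := sub_ne_zero.2 fun h => hq' (h ▸ frontier_subset_closure hz')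
    simp only [h1, hG' z hz', hg' z hz']
    field_simp
  have hcomp : IsCompact (closure V) := hb.isCompact_closure
  obtain ⟨C, hC⟩ := hcomp.exists_bound_of_continuousOn (f := fun z => h1 z - z) (by fun_prop)
  refine no_nonvanishing hc (C := max C ‖q‖) ?_ ?_
  · intro z
    by_cases hz : z ∈ V
    · simp only [h, hz, if_true, h1]
      refine mul_ne_zero (sub_ne_zero.2 fun h => hq' (h ▸ subset_closure hz))
        (Complex.exp_ne_zero _)
    · simp only [h, hz, if_false]
      exact sub_ne_zero.2 fun h => hz (h ▸ hq)
  · intro z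
    by_cases hz : z ∈ V
    · simp only [h, hz, if_true]
      exact (hC z (subset_closure hz)).trans (le_max_left _ _)
    · simp only [h, hz, if_false]
      simp

/-- crossing lemma -/
lemma crossing_s4 {x1 y1 x2 y2 : ℝ → ℝ} (hx1 : Continuous x1) (hy1 : Continuous y1)
    (hx2 : Continuous x2) (hy2 : Continuous y2) {N : ℝ} (hN : 0 < N)
    (hx : ∀ t ∈ Icc (0 : ℝ) 1, x1 (-N) < x2 t ∧ x2 t < x1 N)
    (hy : ∀ s ∈ Icc (-N) N, y2 0 < y1 s ∧ y1 s < y2 1) :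
    ∃ s ∈ Icc (-N) N, ∃ t ∈ Icc (0 : ℝ) 1, x1 s = x2 t ∧ y1 s = y2 t := by
  by_contra hcon
  push Not at hcon
  let S : ℂ → ℝ := fun z => max (-N) (min N z.re)
  let T : ℂ → ℝ := fun z => max 0 (min 1 (-z.im))
  have hS : Continuous S := by fun_prop
  have hT : Continuous T := by fun_prop
  have hSm : ∀ z, S z ∈ Icc (-N) N := fun z =>
    ⟨le_max_left _ _, max_le (by linarith) (min_le_left _ _)⟩
  have hTm : ∀ z, T z ∈ Icc (0 : ℝ) 1 := fun z =>
    ⟨le_max_left _ _, max_le (by linarith) (min_le_left _ _)⟩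
  let k : ℝ × ℝ → ℂ := fun p => ((x1 p.1 - x2 p.2 - p.1 : ℝ) : ℂ)
    + ((y1 p.1 - y2 p.2 + p.2 : ℝ) : ℂ) * Complex.I
  have hk : Continuous k := by fun_prop
  have hcomp : IsCompact (Icc (-N) N ×ˢ Icc (0 : ℝ) 1) := isCompact_Icc.prod isCompact_Icc
  obtain ⟨C, hC⟩ := hcomp.exists_bound_of_continuousOn hk.continuousOn
  refine no_nonvanishing (h := fun z => z + k (S z, T z)) (by fun_prop) (C := C) ?_ ?_
  · intro z h0
    have hre : z.re + (x1 (S z) - x2 (T z) - S z) = 0 := by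
      have := congrArg Complex.re h0
      simpa [k] using this
    have him : z.im + (y1 (S z) - y2 (T z) + T z) = 0 := by
      have := congrArg Complex.im h0
      simpa [k] using this
    have a1 := hx (T z) (hTm z)
    have a2 := hy (S z) (hSm z)
    have r1 : z.re = S z := by
      rcases lt_or_ge z.re (-N) with h | h
      · have : S z = -N := by simp only [S]; rw [max_eq_left]; exact (min_le_right _ _).trans h.le
        rw [this] at hre
        linarith
      · rcases lt_or_ge N z.re with h' | h'
        · have : S z = N := by simp only [S]; rw [min_eq_left h'.le, max_eq_right]; linarith
          rw [this] at hre
          linarith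
        · simp only [S]; rw [min_eq_right h', max_eq_right h]
    have r2 : -z.im = T z := by
      rcases lt_or_ge (-z.im) 0 with h | h
      · have : T z = 0 := by simp only [T]; rw [max_eq_left]; exact (min_le_right _ _).trans h.le
        rw [this] at him
        linarith
      · rcases lt_or_ge 1 (-z.im) with h' | h'
        · have : T z = 1 := by simp only [T]; rw [min_eq_left h'.le, max_eq_right]; linarith
          rw [this] at him
          linarith
        · simp only [T]; rw [min_eq_right h', max_eq_right h]
    exact hcon (S z) (hSm z) (T z) (hTm z) (by linarith) (by linarith)
  · intro z
    simpa using hC (S z, T z) ⟨hSm z, hTm z⟩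

/-- a Jordan curve in `ℂ` -/
def JC (J : Set ℂ) : Prop := ∃ f : Circle → ℂ, Continuous f ∧ Function.Injective f ∧ range f = J

lemma JC.param_aux {f : Circle → ℂ} (hf : Continuous f) (hinj : Function.Injective f) (c : Circle) :
    ∃ F : ℝ → ℂ, Continuous F ∧ F 0 = f c ∧ F (-1) = f (c * Circle.exp Real.pi) ∧
      F 1 = f (c * Circle.exp Real.pi) ∧ InjOn F (Ioc (-1) 1) ∧ F '' Icc (-1) 1 = range f := by
  refine ⟨fun t => f (c * Circle.exp (Real.pi * t)), by fun_prop, by simp, ?_, by simp, ?_, ?_⟩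
  · have : Circle.exp (Real.pi * (-1)) = Circle.exp Real.pi := by
      rw [Circle.exp_eq_exp]
      exact ⟨-1, by push_cast; ring⟩
    simp only [this]
  · intro s hs t ht hst
    have h1 := mul_left_cancel (hinj hst)
    have hpi := Real.pi_pos
    have h2 := congrArg (fun z : Circle => Complex.arg z) h1
    rw [Circle.arg_exp (by nlinarith [hs.1]) (by nlinarith [hs.2]),
      Circle.arg_exp (by nlinarith [ht.1]) (by nlinarith [ht.2])] at h2
    exact mul_left_cancel₀ hpi.ne' h2
  · apply Subset.antisymm
    · rintro _ ⟨t, -, rfl⟩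
      exact mem_range_self _
    · rintro _ ⟨d, rfl⟩
      have hpi := Real.pi_pos
      refine ⟨Complex.arg (c⁻¹ * d : Circle) / Real.pi, ⟨?_, ?_⟩, ?_⟩
      · rw [le_div_iff₀ hpi]
        linarith [Complex.neg_pi_lt_arg (c⁻¹ * d : Circle)]
      · rw [div_le_one hpi]
        exact Complex.arg_le_pi _
      · have h1 : Real.pi * (Complex.arg (c⁻¹ * d : Circle) / Real.pi)
            = Complex.arg (c⁻¹ * d : Circle) := by field_simp
        change f (c * Circle.exp (Real.pi * (Complex.arg (c⁻¹ * d : Circle) / Real.pi))) = f d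
        rw [h1, Circle.exp_arg]
        simp

lemma JC.param {J : Set ℂ} (hJ : JC J) {p : ℂ} (hp : p ∈ J) :
    ∃ F : ℝ → ℂ, Continuous F ∧ F 0 = p ∧ F (-1) = F 1 ∧ InjOn F (Ioc (-1) 1) ∧
      F '' Icc (-1) 1 = J := by
  obtain ⟨f, hf, hinj, rfl⟩ := hJ
  obtain ⟨c, rfl⟩ := hp
  obtain ⟨F, h1, h2, h3, h4, h5, h6⟩ := JC.param_aux hf hinj c
  exact ⟨F, h1, h2, h3.trans h4.symm, h5, h6⟩

lemma JC.param' {J : Set ℂ} (hJ : JC J) {p : ℂ} (hp : p ∈ J) :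
    ∃ F : ℝ → ℂ, Continuous F ∧ F (-1) = p ∧ F 1 = p ∧ InjOn F (Ioc (-1) 1) ∧
      F '' Icc (-1) 1 = J := by
  obtain ⟨f, hf, hinj, rfl⟩ := hJ
  obtain ⟨c, rfl⟩ := hp
  obtain ⟨F, h1, h2, h3, h4, h5, h6⟩ := JC.param_aux hf hinj (c * (Circle.exp Real.pi)⁻¹)
  exact ⟨F, h1, by simpa using h3, by simpa using h4, h5, h6⟩

lemma JC.isCompact {J : Set ℂ} (hJ : JC J) : IsCompact J := by
  obtain ⟨f, hf, hinj, rfl⟩ := hJ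
  exact isCompact_range hf

/-- An open bounded set whose frontier misses a point of a Jordan curve containing the frontier is
contained in that curve. -/
lemma JC.no_proper {J V : Set ℂ} (hJ : JC J) (hb : Bornology.IsBounded V)
    {x : ℂ} (hxJ : x ∈ J) (hVJ : frontier V ⊆ J) (hxV : x ∉ frontier V) {q : ℂ} (hq : q ∈ V)
    (hqJ : q ∉ J) : False := by
  classical
  obtain ⟨F, hF, hF1, hF2, hinj, himg⟩ := hJ.param' hxJ
  let T : Set ℝ := Icc (-1) 1 ∩ F ⁻¹' (frontier V)
  have hTc : IsCompact T := isCompact_Icc.inter_right (isClosed_frontier.preimage hF)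
  have hTI : T ⊆ Ioc (-1) 1 := by
    rintro t ⟨ht, htV⟩
    refine ⟨lt_of_le_of_ne ht.1 ?_, ht.2⟩
    rintro rfl
    exact hxV (hF1 ▸ htV)
  have : CompactSpace T := isCompact_iff_compactSpace.1 hTc
  have hemb : Topology.IsClosedEmbedding (T.domRestrict F) :=
    Continuous.isClosedEmbedding (hF.comp continuous_subtype_val)
      (injOn_iff_injective.1 (hinj.mono hTI))
  obtain ⟨G, hG⟩ := ContinuousMap.exists_extension (Y := ℝ) hemb
    ⟨Subtype.val, continuous_subtype_val⟩
  have hG' : ∀ t ∈ T, G (F t) = t := fun t ht => by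
    have := DFunLike.congr_fun hG ⟨t, ht⟩
    simpa using this
  let r : ℂ → ℂ := fun z => F (max (-1) (min 1 (G z)))
  have hr : Continuous r := by fun_prop
  have hrJ : ∀ z, r z ∈ J := fun z => by
    rw [← himg]
    exact mem_image_of_mem _ ⟨le_max_left _ _, max_le (by norm_num) (min_le_left _ _)⟩
  have hrf : ∀ z ∈ frontier V, r z = z := by
    intro z hz
    have := hVJ hz
    rw [← himg] at this
    obtain ⟨t, ht, rfl⟩ := this
    simp only [r, hG' t ⟨ht, hz⟩, min_eq_right ht.2, max_eq_right ht.1]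
  let h : ℂ → ℂ := fun z => if z ∈ V then r z - q else z - q
  have hc : Continuous h := by
    apply Continuous.if _ (by fun_prop) (by fun_prop)
    intro z hz
    rw [hrf z hz]
  have hcomp : IsCompact (closure V) := hb.isCompact_closure
  obtain ⟨C, hC⟩ := hcomp.exists_bound_of_continuousOn (f := fun z => r z - q - z) (by fun_prop)
  refine no_nonvanishing hc (C := max C ‖q‖) ?_ ?_
  · intro z
    by_cases hz : z ∈ V
    · simp only [h, hz, if_true]
      exact sub_ne_zero.2 fun h => hqJ (h ▸ hrJ z)
    · simp only [h, hz, if_false]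
      exact sub_ne_zero.2 fun h => hz (h ▸ hq)
  · intro z
    by_cases hz : z ∈ V
    · simp only [h, hz, if_true]
      exact (hC z (subset_closure hz)).trans (le_max_left _ _)
    · simp only [h, hz, if_false]
      simp

lemma circle_locallyConnected : LocallyConnectedSpace Circle := by
  have : LocallyConnectedSpace (EuclideanSpace ℝ (Fin 1)) := inferInstance
  exact ChartedSpace.locallyConnectedSpace (EuclideanSpace ℝ (Fin 1)) Circle

lemma JC.isPreconnected {J : Set ℂ} (hJ : JC J) : IsPreconnected J := by
  obtain ⟨f, hf, hinj, rfl⟩ := hJ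
  rw [← image_univ, ← Circle.surjOn_exp_neg_pi_pi.image_eq_of_mapsTo (mapsTo_univ _ _)]
  exact (isPreconnected_Ioc.image _ Circle.exp.continuous.continuousOn).image _ hf.continuousOn

/-- Uniform local connectedness of Jordan curves -/
lemma JC.ulc {J : Set ℂ} (hJ : JC J) {ε : ℝ} (hε : 0 < ε) :
    ∃ δ > 0, ∀ a ∈ J, ∀ b ∈ J, dist a b < δ →
      ∃ C ⊆ J, IsPreconnected C ∧ a ∈ C ∧ b ∈ C ∧ C ⊆ ball a ε := by
  obtain ⟨f, hf, hinj, rfl⟩ := hJ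
  have := circle_locallyConnected
  have hemb : Topology.IsEmbedding f := (hf.isClosedEmbedding hinj).isEmbedding
  have h1 : ∀ c : Circle, ∃ O : Set ℂ, IsOpen O ∧ f c ∈ O ∧ ∃ W : Set Circle, IsPreconnected W ∧
      (f ⁻¹' O ⊆ W) ∧ f '' W ⊆ ball (f c) (ε / 2) := by
    intro c
    have hn : f ⁻¹' ball (f c) (ε / 2) ∈ 𝓝 c :=
      hf.continuousAt.preimage_mem_nhds (ball_mem_nhds _ (half_pos hε))
    obtain ⟨W, hW, hWo, hcW, hWc⟩ := (locallyConnectedSpace_iff_subsets_isOpen_isConnected.1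
      (inferInstance : LocallyConnectedSpace Circle)) c _ hn
    obtain ⟨O, hO, rfl⟩ := hemb.isOpen_iff.1 hWo
    exact ⟨O, hO, hcW, _, hWc.isPreconnected, Subset.rfl, image_subset_iff.2 hW⟩
  choose O hO hcO W hW hOW hWb using h1
  obtain ⟨δ, hδ, hleb⟩ := lebesgue_number_lemma_of_metric (isCompact_range hf) hO (by
    rintro _ ⟨c, rfl⟩
    exact mem_iUnion.2 ⟨c, hcO c⟩)
  refine ⟨δ, hδ, fun a ha b hb hab => ?_⟩
  obtain ⟨c, hc⟩ := hleb a ha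
  obtain ⟨a', rfl⟩ := ha
  obtain ⟨b', rfl⟩ := hb
  have haW : a' ∈ W c := hOW c (hc (mem_ball_self hδ))
  have hbW : b' ∈ W c := hOW c (hc (by rwa [mem_ball, dist_comm]))
  refine ⟨f '' W c, image_subset_range _ _, (hW c).image _ hf.continuousOn,
    mem_image_of_mem _ haW, mem_image_of_mem _ hbW, fun z hz => ?_⟩
  have k1 := hWb c hz
  have k2 := hWb c (mem_image_of_mem f haW)
  rw [mem_ball] at *
  have := dist_triangle_right z (f a') (f c)
  linarith

/-- In a compact set, different components are separated by closed sets. -/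
lemma exists_separation {K' : Set ℂ} (hK : IsCompact K') {x y : ℂ} (hx : x ∈ K') (hy : y ∈ K')
    (hxy : y ∉ connectedComponentIn K' x) :
    ∃ A B : Set ℂ, IsClosed A ∧ IsClosed B ∧ A ∪ B = K' ∧ Disjoint A B ∧ x ∈ A ∧ y ∈ B := by
  have : CompactSpace K' := isCompact_iff_compactSpace.1 hK
  rw [connectedComponentIn_eq_image hx] at hxy
  have h1 : (⟨y, hy⟩ : K') ∉ connectedComponent (⟨x, hx⟩ : K') := fun h => hxy ⟨_, h, rfl⟩
  rw [connectedComponent_eq_iInter_isClopen] at h1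
  simp only [mem_iInter, not_forall] at h1
  obtain ⟨⟨Z, hZ, hxZ⟩, hyZ⟩ := h1
  refine ⟨Subtype.val '' Z, Subtype.val '' Zᶜ, ?_, ?_, ?_, ?_, ⟨_, hxZ, rfl⟩, ⟨_, hyZ, rfl⟩⟩
  · exact (hZ.1.isCompact.image continuous_subtype_val).isClosed
  · exact (hZ.compl.1.isCompact.image continuous_subtype_val).isClosed
  · rw [← image_union, union_compl_self, image_univ, Subtype.range_coe]
  · exact (disjoint_image_iff Subtype.val_injective).2 disjoint_compl_right

lemma gap_lemma {K' : Set ℂ} (hK : IsCompact K') {c : ℝ → ℂ} (hc : Continuous c)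
    (h0 : c 0 ∈ K') (h1 : c 1 ∈ K')
    (hgap : ∀ s ∈ Icc (0 : ℝ) 1, ∀ t ∈ Icc (0 : ℝ) 1, s < t → c s ∈ K' → c t ∈ K' →
      (∀ u ∈ Ioo s t, c u ∉ K') → ∃ C ⊆ K', IsPreconnected C ∧ c s ∈ C ∧ c t ∈ C) :
    c 1 ∈ connectedComponentIn K' (c 0) := by
  by_contra hcon
  obtain ⟨A, B, hA, hB, hAB, hdis, hxA, hyB⟩ := exists_separation hK h0 h1 hcon
  have hAK : A ⊆ K' := hAB ▸ subset_union_left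
  have hBK : B ⊆ K' := hAB ▸ subset_union_right
  have hTA : IsCompact (Icc (0 : ℝ) 1 ∩ c ⁻¹' A) := isCompact_Icc.inter_right (hA.preimage hc)
  obtain ⟨τ, ⟨hτI, hτA⟩, hτmax⟩ := hTA.exists_isGreatest ⟨0, ⟨le_rfl, zero_le_one⟩, hxA⟩
  have hτ1 : τ < 1 := by
    refine lt_of_le_of_ne hτI.2 ?_
    rintro rfl
    exact disjoint_left.1 hdis hτA hyB
  -- points of `B` after `τ`
  have hTB : IsCompact (Icc τ 1 ∩ c ⁻¹' B) := isCompact_Icc.inter_right (hB.preimage hc)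
  obtain ⟨σ, ⟨hσI, hσB⟩, hσmin⟩ := hTB.exists_isLeast ⟨1, ⟨hτ1.le, le_rfl⟩, hyB⟩
  have hτσ : τ < σ := by
    refine lt_of_le_of_ne hσI.1 ?_
    rintro rfl
    exact disjoint_left.1 hdis hτA hσB
  obtain ⟨C, hCK, hC, hsC, htC⟩ := hgap τ hτI σ ⟨hτI.1.trans hσI.1, hσI.2⟩ hτσ (hAK hτA) (hBK hσB) (by
    intro u hu huK
    rw [← hAB] at huK
    rcases huK with h | h
    · exact absurd (hτmax ⟨⟨hτI.1.trans hu.1.le, hu.2.le.trans hσI.2⟩, h⟩) (not_le.2 hu.1)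
    · exact absurd (hσmin ⟨⟨hu.1.le, hu.2.le.trans hσI.2⟩, h⟩) (not_le.2 hu.2))
  obtain ⟨z, -, hzA, hzB⟩ := isPreconnected_closed_iff.1 hC A B hA hB (hAB.symm ▸ hCK)
    ⟨_, hsC, hτA⟩ ⟨_, htC, hσB⟩
  exact disjoint_left.1 hdis hzA hzB

/-- the topological setup -/
structure Setup (K : Set ℂ) (Ω : ℕ → Set ℂ) : Prop where
  hKc : IsCompact K
  hopen : ∀ k, IsOpen (Ω k)
  hconn : ∀ k, IsPreconnected (Ω k)
  hne : ∀ k, (Ω k).Nonempty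
  hdisj : ∀ k l z, z ∈ Ω k → z ∈ Ω l → k = l
  hcover : ∀ z, z ∉ K ↔ ∃ k, z ∈ Ω k
  hbdd : ∀ k, k ≠ 0 → Bornology.IsBounded (Ω k)
  hJ : ∀ k, JC (frontier (Ω k))

namespace Setup

variable {K : Set ℂ} {Ω : ℕ → Set ℂ}

lemma not_mem_K (S : Setup K Ω) {k : ℕ} {z : ℂ} (hz : z ∈ Ω k) : z ∉ K := (S.hcover z).2 ⟨k, hz⟩

lemma eq_of_mem_closure (S : Setup K Ω) {k l : ℕ} {z : ℂ} (hz : z ∈ Ω k)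
    (hl : z ∈ closure (Ω l)) : k = l := by
  obtain ⟨w, hw1, hw2⟩ := mem_closure_iff.1 hl _ (S.hopen k) hz
  exact S.hdisj _ _ _ hw1 hw2

lemma frontier_subset (S : Setup K Ω) (k : ℕ) : frontier (Ω k) ⊆ K := by
  intro z hz
  by_contra h
  obtain ⟨l, hl⟩ := (S.hcover z).1 h
  have := S.eq_of_mem_closure hl (frontier_subset_closure hz)
  subst this
  rw [(S.hopen l).frontier_eq] at hz
  exact hz.2 hl

lemma mem_frontier (S : Setup K Ω) {k : ℕ} {z : ℂ} (hz : z ∈ closure (Ω k)) (hzK : z ∈ K) :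
    z ∈ frontier (Ω k) := by
  rw [(S.hopen k).frontier_eq]
  exact ⟨hz, fun h => S.not_mem_K h hzK⟩

lemma subset_of_preconnected (S : Setup K Ω) {C : Set ℂ} (hC : IsPreconnected C) (hCK : C ⊆ Kᶜ)
    {k : ℕ} {z : ℂ} (hzC : z ∈ C) (hz : z ∈ Ω k) : C ⊆ Ω k := by
  refine hC.subset_left_of_subset_union (S.hopen k)
    (isOpen_iUnion fun l : {l // l ≠ k} => S.hopen l) ?_ ?_ ⟨z, hzC, hz⟩
  · rw [disjoint_left]
    intro w hw hw'
    obtain ⟨⟨l, hl⟩, hwl⟩ := mem_iUnion.1 hw'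
    exact hl (S.hdisj _ _ _ hwl hw)
  · intro w hw
    obtain ⟨l, hl⟩ := (S.hcover w).1 (hCK hw)
    by_cases h : l = k
    · left; exact h ▸ hl
    · right; exact mem_iUnion.2 ⟨⟨l, h⟩, hl⟩

lemma subset_closedBall (S : Setup K Ω) {x0 : ℂ} {R : ℝ} (hR : 0 ≤ R) (hKR : K ⊆ closedBall x0 R)
    {k : ℕ} (hk : k ≠ 0) : Ω k ⊆ closedBall x0 R := by
  intro z hz
  by_contra hzR
  rw [mem_closedBall, not_le, dist_eq_norm] at hzR
  let c : ℝ → ℂ := fun t => x0 + (t : ℂ) * (z - x0)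
  have hc : Continuous c := by fun_prop
  have hsub : c '' Ici 1 ⊆ Ω k := by
    refine S.subset_of_preconnected (isPreconnected_Ici.image _ hc.continuousOn) ?_
      (z := z) ⟨1, self_mem_Ici, by simp [c]⟩ hz
    rintro _ ⟨t, ht, rfl⟩ hK
    have h1 := hKR hK
    have ht1 : (1 : ℝ) ≤ t := ht
    rw [mem_closedBall, dist_eq_norm] at h1
    simp only [c, add_sub_cancel_left, norm_mul, Complex.norm_real, Real.norm_eq_abs,
      abs_of_nonneg (zero_le_one.trans ht1)] at h1
    nlinarith [norm_nonneg (z - x0)]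
  obtain ⟨M, hM⟩ := (S.hbdd k hk).subset_closedBall x0
  have hpos : 0 < ‖z - x0‖ := hR.trans_lt hzR
  have hmem : c (max 1 ((|M| + 1) / ‖z - x0‖)) ∈ closedBall x0 M := hM (hsub ⟨_, mem_Ici.2 (le_max_left _ _), rfl⟩)
  rw [mem_closedBall, dist_eq_norm] at hmem
  have h0 : (0 : ℝ) ≤ max 1 ((|M| + 1) / ‖z - x0‖) := zero_le_one.trans (le_max_left _ _)
  simp only [c, add_sub_cancel_left, norm_mul, Complex.norm_real, Real.norm_eq_abs,
      abs_of_nonneg h0] at hmem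
  have h2 : (|M| + 1) / ‖z - x0‖ * ‖z - x0‖ ≤ max 1 ((|M| + 1) / ‖z - x0‖) * ‖z - x0‖ :=
    mul_le_mul_of_nonneg_right (le_max_right _ _) hpos.le
  rw [div_mul_cancel₀ _ hpos.ne'] at h2
  linarith [le_abs_self M]

lemma not_mem_interior (S : Setup K Ω) {x : ℂ} (hx : x ∈ K) (k : ℕ) :
    x ∉ interior (closure (Ω k)) := by
  intro hxi
  have hxJ : x ∈ frontier (Ω k) := S.mem_frontier (interior_subset hxi) hx
  have hxf : x ∉ frontier (closure (Ω k)) := fun h => h.2 hxi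
  by_cases hk : k = 0
  · subst hk
    obtain ⟨q, hq⟩ := S.hne 1
    have hqc : q ∉ closure (Ω 0) := fun h => by
      have := S.eq_of_mem_closure hq h
      omega
    obtain ⟨R, hR⟩ := S.hKc.isBounded.subset_closedBall (0 : ℂ)
    have hR' : K ⊆ closedBall 0 |R| := hR.trans (closedBall_subset_closedBall (le_abs_self R))
    refine (S.hJ 0).no_proper (V := (closure (Ω 0))ᶜ) ?_ hxJ ?_ ?_ hqc
      (fun h => hqc (frontier_subset_closure h))
    · refine (isBounded_closedBall (x := (0 : ℂ)) (r := |R|)).subset ?_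
      intro z hz
      by_cases hzK : z ∈ K
      · exact hR' hzK
      · obtain ⟨l, hl⟩ := (S.hcover z).1 hzK
        refine S.subset_closedBall (abs_nonneg R) hR' ?_ hl
        rintro rfl
        exact hz (subset_closure hl)
    · rw [frontier_compl]
      exact frontier_closure_subset
    · rwa [frontier_compl]
  · obtain ⟨q, hq⟩ := S.hne k
    refine (S.hJ k).no_proper (V := interior (closure (Ω k))) ?_ hxJ ?_ ?_
      ((S.hopen k).subset_interior_closure hq) (fun h => S.not_mem_K hq (S.frontier_subset k h))
    · exact (S.hbdd k hk).closure.subset interior_subset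
    · exact frontier_interior_subset.trans frontier_closure_subset
    · exact fun h => hxf (frontier_interior_subset h)

/-- the regions form a null sequence -/
def Null (Ω : ℕ → Set ℂ) : Prop :=
  ∀ ε > (0 : ℝ), {k | ∃ a ∈ closure (Ω k), ∃ b ∈ closure (Ω k), ε ≤ dist a b}.Finite

lemma ulc (S : Setup K Ω) (hN : Null Ω) {ε : ℝ} (hε : 0 < ε) :
    ∃ δ > 0, ∀ k, ∀ a ∈ frontier (Ω k), ∀ b ∈ frontier (Ω k), dist a b < δ →
      ∃ C ⊆ frontier (Ω k), IsPreconnected C ∧ a ∈ C ∧ b ∈ C ∧ C ⊆ ball a ε := by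
  have h1 := fun k => (S.hJ k).ulc hε
  choose δ hδ hδ' using h1
  obtain ⟨δ0, hδ0, hle⟩ : ∃ δ0 > 0, ∀ k ∈ {k | ∃ a ∈ closure (Ω k), ∃ b ∈ closure (Ω k),
      ε ≤ dist a b}, δ0 ≤ δ k := by
    have hfin := hN ε hε
    rcases eq_empty_or_nonempty {k | ∃ a ∈ closure (Ω k), ∃ b ∈ closure (Ω k),
      ε ≤ dist a b} with he | hne
    · exact ⟨1, one_pos, by simp [he]⟩
    · obtain ⟨k0, -, hk0⟩ := exists_min_image _ δ hfin hne
      exact ⟨δ k0, hδ k0, hk0⟩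
  refine ⟨δ0, hδ0, fun k a ha b hb hab => ?_⟩
  by_cases hk : ∃ a ∈ closure (Ω k), ∃ b ∈ closure (Ω k), ε ≤ dist a b
  · exact hδ' k a ha b hb (hab.trans_le (hle k hk))
  · push Not at hk
    refine ⟨_, Subset.rfl, (S.hJ k).isPreconnected, ha, hb, fun z hz => ?_⟩
    exact hk z (frontier_subset_closure hz) a (frontier_subset_closure ha)

lemma imk (S : Setup K Ω) (hN : Null Ω) {x : ℂ} (hx : x ∈ K) {ε : ℝ} (hε : 0 < ε) :
    ∃ δ > 0, ∀ y ∈ K, dist y x < δ →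
      ∃ C ⊆ K ∩ closedBall x ε, IsCompact C ∧ IsPreconnected C ∧ x ∈ C ∧ y ∈ C := by
  obtain ⟨δ, hδ, hulc⟩ := S.ulc hN (half_pos hε)
  refine ⟨min δ (ε / 2), lt_min hδ (half_pos hε), fun y hy hyx => ?_⟩
  have hd1 : dist y x < δ := hyx.trans_le (min_le_left _ _)
  have hd2 : dist y x < ε / 2 := hyx.trans_le (min_le_right _ _)
  have hK' : IsCompact (K ∩ closedBall x ε) := S.hKc.inter_right isClosed_closedBall
  let c : ℝ → ℂ := fun t => x + (t : ℂ) * (y - x)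
  have hc : Continuous c := by fun_prop
  have hcx : ∀ t ∈ Icc (0 : ℝ) 1, dist (c t) x ≤ ε / 2 := by
    intro t ht
    rw [dist_eq_norm]
    simp only [c, add_sub_cancel_left, norm_mul, Complex.norm_real, Real.norm_eq_abs,
      abs_of_nonneg ht.1]
    rw [← dist_eq_norm]
    nlinarith [ht.1, ht.2, dist_nonneg (x := y) (y := x)]
  have hcc : ∀ s ∈ Icc (0 : ℝ) 1, ∀ t ∈ Icc (0 : ℝ) 1, dist (c s) (c t) < δ := by
    intro s hs t ht
    have : c s - c t = ((s - t : ℝ) : ℂ) * (y - x) := by simp only [c]; push_cast; ring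
    rw [dist_eq_norm, this, norm_mul, Complex.norm_real, Real.norm_eq_abs, ← dist_eq_norm]
    have : |s - t| ≤ 1 := by rw [abs_le]; constructor <;> linarith [hs.1, hs.2, ht.1, ht.2]
    nlinarith [dist_nonneg (x := y) (y := x), abs_nonneg (s - t)]
  have hc0 : c 0 = x := by simp [c]
  have hc1 : c 1 = y := by simp [c]
  have hxK' : x ∈ K ∩ closedBall x ε := ⟨hx, mem_closedBall_self hε.le⟩
  have key : c 1 ∈ connectedComponentIn (K ∩ closedBall x ε) (c 0) := by
    apply gap_lemma hK' hc
    · rwa [hc0]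
    · rw [hc1]; exact ⟨hy, mem_closedBall.2 (by linarith)⟩
    · intro s hs t ht hst hsK htK hu
      have hu' : ∀ u ∈ Ioo s t, c u ∉ K := fun u huI huK => hu u huI
        ⟨huK, mem_closedBall.2 (by
          linarith [hcx u ⟨hs.1.trans huI.1.le, huI.2.le.trans ht.2⟩])⟩
      have hm : (s + t) / 2 ∈ Ioo s t := ⟨by linarith, by linarith⟩
      obtain ⟨k, hk⟩ := (S.hcover _).1 (hu' _ hm)
      have hsub : c '' Ioo s t ⊆ Ω k :=
        S.subset_of_preconnected (isPreconnected_Ioo.image _ hc.continuousOn)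
          (by rintro _ ⟨u, hu1, rfl⟩; exact hu' u hu1) ⟨_, hm, rfl⟩ hk
      have hcl : c '' Icc s t ⊆ closure (Ω k) := by
        rw [← closure_Ioo hst.ne]
        exact (image_closure_subset_closure_image hc).trans (closure_mono hsub)
      have hsF := S.mem_frontier (hcl ⟨s, ⟨le_rfl, hst.le⟩, rfl⟩) hsK.1
      have htF := S.mem_frontier (hcl ⟨t, ⟨hst.le, le_rfl⟩, rfl⟩) htK.1
      obtain ⟨C, hCJ, hC, hsC, htC, hCb⟩ := hulc k _ hsF _ htF (hcc s hs t ht)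
      refine ⟨C, fun z hz => ⟨S.frontier_subset k (hCJ hz), ?_⟩, hC, hsC, htC⟩
      have h1 := mem_ball.1 (hCb hz)
      have h2 := hcx s hs
      have h3 := dist_triangle z (c s) x
      rw [mem_closedBall]
      linarith
  rw [hc0, hc1] at key
  have hcl : closure (connectedComponentIn (K ∩ closedBall x ε) x) ⊆ K ∩ closedBall x ε :=
    closure_minimal (connectedComponentIn_subset _ _) hK'.isClosed
  exact ⟨_, hcl, hK'.of_isClosed_subset isClosed_closure hcl,
    isPreconnected_connectedComponentIn.closure, subset_closure (mem_connectedComponentIn hxK'),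
    subset_closure key⟩

end Setup

namespace Setup

variable {K : Set ℂ} {Ω : ℕ → Set ℂ}

lemma local_cut (S : Setup K Ω) (hN : Null Ω) {k l : ℕ} (hkl : k ≠ l) (hk : k ≠ 0) {p : ℂ}
    (hpk : p ∈ frontier (Ω k)) (hpl : p ∈ frontier (Ω l)) :
    ∃ U ⊆ K, p ∈ U ∧ (∃ O, IsOpen O ∧ U = K ∩ O) ∧ IsConnected U ∧ ¬ IsPreconnected (U \ {p}) := by
  have hpK : p ∈ K := S.frontier_subset k hpk
  obtain ⟨zk, hzk⟩ := S.hne k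
  obtain ⟨zl, hzl⟩ := S.hne l
  have hzkp : 0 < dist zk p := dist_pos.2 (fun h => S.not_mem_K hzk (h ▸ hpK))
  have hzlp : 0 < dist zl p := dist_pos.2 (fun h => S.not_mem_K hzl (h ▸ hpK))
  obtain ⟨ρ, hρ, hρk, hρl⟩ : ∃ ρ > 0, ρ ≤ dist zk p ∧ ρ ≤ dist zl p :=
    ⟨min (dist zk p) (dist zl p), lt_min hzkp hzlp, min_le_left _ _, min_le_right _ _⟩
  have hzk' : zk ∉ ball p ρ := fun h => absurd (mem_ball.1 h) (not_lt.2 hρk)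
  have hzl' : zl ∉ ball p ρ := fun h => absurd (mem_ball.1 h) (not_lt.2 hρl)
  set U := connectedComponentIn (K ∩ ball p ρ) p with hU
  have hpU : p ∈ U := mem_connectedComponentIn ⟨hpK, mem_ball_self hρ⟩
  have hUsub : U ⊆ K ∩ ball p ρ := connectedComponentIn_subset _ _
  -- absorbing property
  have habs : ∀ C ⊆ K ∩ ball p ρ, IsPreconnected C → ∀ y ∈ C, y ∈ U → C ⊆ U := by
    intro C hC hCc y hyC hyU
    rw [hU, connectedComponentIn_eq hyU]
    exact hCc.subset_connectedComponentIn hyC hC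
  -- small connected sets
  have hsmall : ∀ y ∈ U, ∀ r > 0, ∃ δ > 0, ∀ z ∈ K, dist z y < δ →
      ∃ C ⊆ U ∩ closedBall y r, IsCompact C ∧ IsPreconnected C ∧ y ∈ C ∧ z ∈ C := by
    intro y hy r hr
    obtain ⟨r', hr', hball⟩ := Metric.isOpen_iff.1 isOpen_ball y (hUsub hy).2
    obtain ⟨δ, hδ, h⟩ := S.imk hN (hUsub hy).1 (lt_min hr (half_pos hr'))
    refine ⟨δ, hδ, fun z hz hzy => ?_⟩
    obtain ⟨C, hCs, hCc, hCp, hyC, hzC⟩ := h z hz hzy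
    refine ⟨C, fun w hw => ⟨?_, ?_⟩, hCc, hCp, hyC, hzC⟩
    · refine habs C (fun w hw => ⟨(hCs hw).1, hball ?_⟩) hCp y hyC hy hw
      have := mem_closedBall.1 (hCs hw).2
      have h2 := min_le_right r (r' / 2)
      rw [mem_ball]
      linarith
    · exact closedBall_subset_closedBall (min_le_left _ _) (hCs hw).2
  refine ⟨U, fun z hz => (hUsub hz).1, hpU, ?_, ⟨⟨p, hpU⟩, isPreconnected_connectedComponentIn⟩, ?_⟩
  · have h1 : ∀ y : U, ∃ δ > 0, ∀ z ∈ K, dist z y < δ → z ∈ U := by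
      intro y
      obtain ⟨δ, hδ, h⟩ := hsmall y y.2 1 one_pos
      refine ⟨δ, hδ, fun z hz hzy => ?_⟩
      obtain ⟨C, hC, -, -, -, hzC⟩ := h z hz hzy
      exact (hC hzC).1
    choose δ hδ hδ' using h1
    refine ⟨⋃ y : U, ball (y : ℂ) (δ y), isOpen_iUnion fun _ => isOpen_ball, ?_⟩
    apply Subset.antisymm
    · exact fun z hz => ⟨(hUsub hz).1, mem_iUnion.2 ⟨⟨z, hz⟩, mem_ball_self (hδ _)⟩⟩
    · rintro z ⟨hzK, hz⟩
      obtain ⟨y, hy⟩ := mem_iUnion.1 hz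
      exact hδ' y z hzK hy
  · intro hconn
    obtain ⟨F, hF, hF0, hF1, hinj, himg⟩ := (S.hJ k).param hpk
    -- a small arc
    obtain ⟨η, hη, hη1, hηb⟩ : ∃ η > 0, η < 1 ∧ F '' Icc (-η) η ⊆ ball p ρ := by
      have hn : F ⁻¹' ball p ρ ∈ 𝓝 (0 : ℝ) :=
        hF.continuousAt.preimage_mem_nhds (hF0 ▸ ball_mem_nhds p hρ)
      obtain ⟨e, he, hball⟩ := Metric.mem_nhds_iff.1 hn
      refine ⟨min (e / 2) (1 / 2), lt_min (by linarith) (by norm_num),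
        (min_le_right _ _).trans_lt (by norm_num), ?_⟩
      rintro _ ⟨t, ht, rfl⟩
      apply hball
      rw [mem_ball, Real.dist_eq, sub_zero, abs_lt]
      have := min_le_left (e / 2) (1 / 2)
      constructor <;> linarith [ht.1, ht.2]
    set A := F '' Icc (-η) η with hA
    set B := F '' (Icc (-1) (-η) ∪ Icc η 1) with hB
    have hAJ : A ⊆ frontier (Ω k) := by
      rw [← himg]
      exact image_mono (Icc_subset_Icc (by linarith) (by linarith))
    have hABJ : A ∪ B = frontier (Ω k) := by
      rw [← himg, hA, hB, ← image_union]
      congr 1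
      ext t
      simp only [mem_union, mem_Icc]
      constructor
      · rintro (h | h | h) <;> constructor <;> linarith [h.1, h.2]
      · intro h
        rcases le_total t (-η) with h1 | h1
        · exact Or.inr (Or.inl ⟨h.1, h1⟩)
        · rcases le_total t η with h2 | h2
          · exact Or.inl ⟨h1, h2⟩
          · exact Or.inr (Or.inr ⟨h2, h.2⟩)
    have hAc : IsCompact A := isCompact_Icc.image hF
    have hBc : IsCompact B := (isCompact_Icc.union isCompact_Icc).image hF
    have hAU : A ⊆ U := habs A (fun z hz => ⟨S.frontier_subset k (hAJ hz), hηb hz⟩)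
      (isPreconnected_Icc.image _ hF.continuousOn) p ⟨0, ⟨by linarith, hη.le⟩, hF0⟩ hpU
    have hFne : ∀ t, t ∈ Ioc (-1 : ℝ) 1 → t ≠ 0 → F t ≠ p := by
      intro t ht ht0 h
      exact ht0 (hinj ht ⟨by norm_num, by norm_num⟩ (h.trans hF0.symm))
    have hpB : p ∉ B := by
      rintro ⟨t, ht, htp⟩
      rcases ht with ht | ht
      · rcases eq_or_lt_of_le ht.1 with h1 | h1
        · rw [← h1, hF1] at htp
          exact hFne 1 ⟨by norm_num, le_rfl⟩ one_ne_zero htp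
        · exact hFne t ⟨h1, by linarith [ht.2]⟩ (by linarith [ht.2]) htp
      · exact hFne t ⟨by linarith [ht.1], ht.2⟩ (by linarith [ht.1]) htp
    have hAB : A ∩ B ⊆ {F η, F (-η)} := by
      rintro _ ⟨⟨s, hs, rfl⟩, ⟨t, ht, hts⟩⟩
      have hsI : s ∈ Ioc (-1 : ℝ) 1 := ⟨by linarith [hs.1], by linarith [hs.2]⟩
      have hgen : t ∈ Ioc (-1 : ℝ) 1 → F s ∈ ({F η, F (-η)} : Set ℂ) := by
        intro htI
        have hst := hinj htI hsI hts
        subst hst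
        rcases ht with ht | ht
        · have : t = -η := le_antisymm ht.2 hs.1
          subst this; simp
        · have : t = η := le_antisymm hs.2 ht.1
          subst this; simp
      by_cases h1 : t = -1
      · exfalso
        rw [h1, hF1] at hts
        have := hinj ⟨by norm_num, le_rfl⟩ hsI hts
        linarith [hs.2]
      · apply hgen
        rcases ht with ht | ht
        · exact ⟨lt_of_le_of_ne ht.1 (Ne.symm h1), by linarith [ht.2]⟩
        · exact ⟨by linarith [ht.1], ht.2⟩
    have ha1 : F η ∈ U \ {p} := ⟨hAU ⟨η, ⟨by linarith, le_rfl⟩, rfl⟩,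
      hFne η ⟨by linarith, hη1.le⟩ hη.ne'⟩
    have ha2 : F (-η) ∈ U \ {p} := ⟨hAU ⟨-η, ⟨le_rfl, by linarith⟩, rfl⟩,
      hFne (-η) ⟨by linarith, by linarith⟩ (by linarith)⟩
    -- a continuum joining the two points
    obtain ⟨C, hCU, hCc, hCp, h1C, h2C⟩ : ∃ C ⊆ U \ {p}, IsCompact C ∧ IsPreconnected C ∧
        F η ∈ C ∧ F (-η) ∈ C := by
      refine hconn.induction₂ (fun a b => ∃ C ⊆ U \ {p}, IsCompact C ∧ IsPreconnected C ∧
        a ∈ C ∧ b ∈ C) ?_ ?_ ?_ ha1 ha2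
      · intro y hy
        have hyp : 0 < dist y p := dist_pos.2 hy.2
        obtain ⟨δ, hδ, h⟩ := hsmall y hy.1 (dist y p / 2) (half_pos hyp)
        filter_upwards [self_mem_nhdsWithin,
          mem_nhdsWithin_of_mem_nhds (ball_mem_nhds y hδ)] with z hz hzb
        obtain ⟨C, hC, hCc, hCp, h1, h2⟩ := h z (hUsub hz.1).1 hzb
        refine ⟨C, fun w hw => ⟨(hC hw).1, ?_⟩, hCc, hCp, h1, h2⟩
        rintro rfl
        have := mem_closedBall.1 (hC hw).2
        rw [dist_comm] at this
        linarith
      · rintro a b c - - - ⟨C, h1, h2, h3, h4, h5⟩ ⟨C', h1', h2', h3', h4', h5'⟩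
        exact ⟨C ∪ C', union_subset h1 h1', h2.union h2', h3.union b h5 h4' h3', Or.inl h4,
          Or.inr h5'⟩
      · rintro a b - - ⟨C, h1, h2, h3, h4, h5⟩
        exact ⟨C, h1, h2, h3, h5, h4⟩
    have hCK : C ⊆ K ∩ ball p ρ := fun z hz => hUsub (hCU hz).1
    -- a small ball
    obtain ⟨r, hr, hrb⟩ : ∃ r > 0, ∀ z ∈ B ∪ C, r ≤ dist z p := by
      have hcl : IsClosed (B ∪ C) := (hBc.union hCc).isClosed
      have hnot : p ∈ (B ∪ C)ᶜ := by
        rintro (h | h)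
        · exact hpB h
        · exact (hCU h).2 rfl
      obtain ⟨r, hr, hb⟩ := Metric.isOpen_iff.1 hcl.isOpen_compl p hnot
      exact ⟨r, hr, fun z hz => not_lt.1 fun hlt => hb (mem_ball.2 hlt) hz⟩
    obtain ⟨qk, hqk, hqkp⟩ := Metric.mem_closure_iff.1 (frontier_subset_closure hpk) (r / 3)
      (by linarith)
    obtain ⟨ql, hql, hqlp⟩ := Metric.mem_closure_iff.1 (frontier_subset_closure hpl) (r / 3)
      (by linarith)
    have hqlk : ql ∉ closure (Ω k) := fun h => hkl (S.eq_of_mem_closure hql h).symm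
    apply not_hasLog_frontier (S.hbdd k hk) hqk hqlk
    have hL1 : HasLog (B ∪ C) (fun z => (z - qk) / (z - ql)) := by
      apply hasLog_quot
      intro z hz
      rw [← dist_eq_norm, ← dist_eq_norm]
      have := hrb z hz
      have t1 := dist_triangle_left ql qk p
      have t2 := dist_triangle z ql p
      rw [dist_comm ql p] at t2
      linarith
    have hsub2 : A ∪ C ⊆ K ∩ ball p ρ :=
      union_subset (fun z hz => hUsub (hAU hz)) hCK
    have hL2 : HasLog (A ∪ C) (fun z => (z - qk) / (z - ql)) := by
      have e1 : HasLog (A ∪ C) (fun z => (z - qk) / (z - zk)) :=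
        (hasLog_component S.hKc.isClosed (S.hconn k) (fun z hz => S.not_mem_K hz) hqk hzk).mono
          (fun z hz => (hsub2 hz).1)
      have e2 : HasLog (A ∪ C) (fun z => (z - ql) / (z - zl)) :=
        (hasLog_component S.hKc.isClosed (S.hconn l) (fun z hz => S.not_mem_K hz) hql hzl).mono
          (fun z hz => (hsub2 hz).1)
      have e3 := (hasLog_ball hρ hzk').mono (fun z hz => (hsub2 hz).2)
      have e4 := (hasLog_ball hρ hzl').mono (fun z hz => (hsub2 hz).2)
      refine ((e1.mul e3).div (e2.mul e4)).congr fun z hz => ?_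
      have n1 : z - zk ≠ 0 := sub_ne_zero.2 fun h => S.not_mem_K hzk (h ▸ (hsub2 hz).1)
      have n2 : z - zl ≠ 0 := sub_ne_zero.2 fun h => S.not_mem_K hzl (h ▸ (hsub2 hz).1)
      rw [div_mul_cancel₀ _ n1, div_mul_cancel₀ _ n2]
    have hinter : (A ∪ C) ∩ (B ∪ C) = C := by
      rw [← inter_union_distrib_right]
      apply union_eq_right.2
      intro z hz
      rcases hAB hz with h | h
      · exact h ▸ h1C
      · exact h ▸ h2C
    refine (hasLog_glue (hAc.union hCc).isClosed (hBc.union hCc).isClosed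
      (by rw [hinter]; exact hCp) hL2 hL1).mono ?_
    rw [← hABJ]
    exact union_subset_union subset_union_left subset_union_left

end Setup

/-- Linear coordinates on the plane. -/
structure Co (φ ψ : ℂ →L[ℝ] ℝ) (v w : ℂ) : Prop where
  hφv : φ v = 1
  hφw : φ w = 0
  hψv : ψ v = 0
  hψw : ψ w = 1
  hz : ∀ z, z = φ z • v + ψ z • w

lemma Co.symm {φ ψ : ℂ →L[ℝ] ℝ} {v w : ℂ} (C : Co φ ψ v w) : Co ψ φ w v :=
  ⟨C.hψw, C.hψv, C.hφw, C.hφv, fun z => by rw [add_comm]; exact C.hz z⟩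

lemma Co.dist_le {φ ψ : ℂ →L[ℝ] ℝ} {v w : ℂ} (C : Co φ ψ v w) (a b : ℂ) :
    dist a b ≤ |φ a - φ b| * ‖v‖ + |ψ a - ψ b| * ‖w‖ := by
  rw [dist_eq_norm, C.hz (a - b)]
  refine (norm_add_le _ _).trans ?_
  rw [norm_smul, norm_smul, map_sub, map_sub, Real.norm_eq_abs, Real.norm_eq_abs]

lemma Co.ext {φ ψ : ℂ →L[ℝ] ℝ} {v w : ℂ} (C : Co φ ψ v w) {a b : ℂ} (h1 : φ a = φ b)
    (h2 : ψ a = ψ b) : a = b := by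
  rw [C.hz a, C.hz b, h1, h2]

/-- The part of the detour property that is used, for the line `ψ = c`. -/
def Det (Ω : ℕ → Set ℂ) (x0 : ℂ) (r : ℝ) (ψ : ℂ →L[ℝ] ℝ) (c : ℝ) : Prop :=
  ∀ ε > (0 : ℝ), (∃ z ∈ closedBall x0 r, ψ z = c) → ∃ γ : ℝ → ℂ, Continuous γ ∧
    (∀ t ∈ Icc (0 : ℝ) 1, |ψ (γ t) - c| ≤ ε) ∧
    (∀ z ∈ closedBall x0 r, ψ z = c → ∃ t ∈ Icc (0 : ℝ) 1, dist (γ t) z ≤ ε) ∧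
    γ '' Icc 0 1 ⊆ ⋃ k, closure (Ω k) ∧
    {k | (γ '' Icc 0 1 ∩ closure (Ω k)).Nonempty}.Finite

namespace Setup

variable {K : Set ℂ} {Ω : ℕ → Set ℂ}

lemma finite_cross (S : Setup K Ω) {φ ψ : ℂ →L[ℝ] ℝ} {v w : ℂ} (C : Co φ ψ v w) {x0 : ℂ} {r : ℝ}
    (hr : 0 < r) (hKr : K ⊆ ball x0 r) {c δ : ℝ} (hδ : 0 < δ) (hdet : Det Ω x0 r ψ c) :
    {k | k ≠ 0 ∧ ∃ a ∈ Ω k, ∃ b ∈ Ω k, ψ a ≤ c - δ ∧ c + δ ≤ ψ b}.Finite := by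
  obtain ⟨r', ⟨hr'0, hr'r⟩, hKr'⟩ := exists_pos_lt_subset_ball hr S.hKc.isClosed hKr
  have hsub : ∀ k ≠ 0, Ω k ⊆ closedBall x0 r' := fun k hk =>
    S.subset_closedBall hr'0.le (hKr'.trans ball_subset_closedBall) hk
  by_cases hne : ∃ z ∈ closedBall x0 r, ψ z = c
  swap
  · convert Set.finite_empty
    rw [eq_empty_iff_forall_notMem]
    rintro k ⟨hk, a, ha, b, hb, h1, h2⟩
    obtain ⟨z, hz, hzc⟩ := (S.hconn k).intermediate_value ha hb ψ.continuous.continuousOn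
      (show c ∈ Icc (ψ a) (ψ b) from ⟨by linarith, by linarith⟩)
    exact hne ⟨z, closedBall_subset_closedBall hr'r.le (hsub k hk hz), hzc⟩
  obtain ⟨γ, hγ, hγψ, hγd, -, hfin⟩ := hdet (min (δ / 2) ((r - r') / 2))
    (lt_min (by linarith) (by linarith)) hne
  set e := min (δ / 2) ((r - r') / 2) with he
  have heδ : e < δ := (min_le_left _ _).trans_lt (by linarith)
  have her : e < r - r' := (min_le_right _ _).trans_lt (by linarith)
  have hT : IsCompact (φ '' (closedBall x0 r ∩ {z | ψ z = c})) :=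
    ((isCompact_closedBall x0 r).inter_right
      (isClosed_eq ψ.continuous continuous_const)).image φ.continuous
  have hTne : (φ '' (closedBall x0 r ∩ {z | ψ z = c})).Nonempty := by
    obtain ⟨z, hz, hzc⟩ := hne
    exact ⟨_, z, ⟨hz, hzc⟩, rfl⟩
  obtain ⟨p, ⟨P, ⟨hP, hPc⟩, rfl⟩, hpmax⟩ := hT.exists_isGreatest hTne
  obtain ⟨q, ⟨Q, ⟨hQ, hQc⟩, rfl⟩, hqmin⟩ := hT.exists_isLeast hTne
  obtain ⟨sp, hsp, hspd⟩ := hγd P hP hPc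
  obtain ⟨sq, hsq, hsqd⟩ := hγd Q hQ hQc
  simp only [mem_ofPred_eq] at hPc hQc
  have hout1 : ∀ t : ℝ, 0 < t → γ sp + t • v ∉ closedBall x0 r' := by
    intro t ht hmem
    have h1 : P + t • v ∈ closedBall x0 r := by
      rw [mem_closedBall] at hmem ⊢
      have : dist (P + t • v) (γ sp + t • v) ≤ e := by
        rw [dist_add_right, dist_comm]; exact hspd
      linarith [dist_triangle (P + t • v) (γ sp + t • v) x0]
    have := hpmax ⟨_, ⟨h1, by
      rw [mem_ofPred_eq, map_add, map_smul, C.hψv, hPc, smul_zero, add_zero]⟩, rfl⟩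
    rw [map_add, map_smul, C.hφv, smul_eq_mul, mul_one] at this
    linarith
  have hout2 : ∀ t : ℝ, t < 0 → γ sq + t • v ∉ closedBall x0 r' := by
    intro t ht hmem
    have h1 : Q + t • v ∈ closedBall x0 r := by
      rw [mem_closedBall] at hmem ⊢
      have : dist (Q + t • v) (γ sq + t • v) ≤ e := by
        rw [dist_add_right, dist_comm]; exact hsqd
      linarith [dist_triangle (Q + t • v) (γ sq + t • v) x0]
    have := hqmin ⟨_, ⟨h1, by
      rw [mem_ofPred_eq, map_add, map_smul, C.hψv, hQc, smul_zero, add_zero]⟩, rfl⟩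
    rw [map_add, map_smul, C.hφv, smul_eq_mul, mul_one] at this
    linarith
  set cl : ℝ → ℝ := fun t => max 0 (min 1 t) with hcl
  have hclc : Continuous cl := by fun_prop
  have hclI : ∀ t, cl t ∈ Icc (0 : ℝ) 1 := fun t =>
    ⟨le_max_left _ _, max_le zero_le_one (min_le_left _ _)⟩
  have hseg : ∀ t, sq + cl t * (sp - sq) ∈ Icc (0 : ℝ) 1 := by
    intro t
    have := (convex_Icc (0 : ℝ) 1).add_smul_sub_mem hsq hsp (hclI t)
    simpa using this
  set Γ : ℝ → ℂ := fun t => γ (sq + cl t * (sp - sq)) + (t - cl t) • v with hΓ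
  have hΓc : Continuous Γ := by
    have h1 : Continuous fun t => γ (sq + cl t * (sp - sq)) := hγ.comp (by fun_prop)
    exact h1.add (by fun_prop)
  have hΓψ : ∀ t, |ψ (Γ t) - c| ≤ e := by
    intro t
    have : ψ (Γ t) = ψ (γ (sq + cl t * (sp - sq))) := by
      simp only [hΓ, map_add, map_smul, C.hψv, smul_zero, add_zero]
    rw [this]
    exact hγψ _ (hseg t)
  -- bound for φ on the ball
  obtain ⟨M, hM⟩ := ((isCompact_closedBall x0 r').image φ.continuous).isBounded.subset_closedBall 0
  have hM' : ∀ z ∈ closedBall x0 r', |φ z| ≤ M := fun z hz => by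
    have := hM ⟨z, hz, rfl⟩
    simpa using this
  have hM0 : 0 ≤ M := (abs_nonneg _).trans (hM' x0 (mem_closedBall_self hr'0.le))
  set N : ℝ := 2 + M + |φ (γ sp)| + |φ (γ sq)| with hN
  have hN1 : 1 ≤ N := by
    have := abs_nonneg (φ (γ sp)); have := abs_nonneg (φ (γ sq)); linarith
  refine hfin.subset ?_
  rintro k ⟨hk, a, ha, b, hb, h1, h2⟩
  have hpc : IsPathConnected (Ω k) := (S.hopen k).isConnected_iff_isPathConnected.1 ⟨S.hne k, S.hconn k⟩
  obtain ⟨β, hβ⟩ := hpc.joinedIn a ha b hb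
  have hβ' : ∀ t ∈ Icc (0 : ℝ) 1, β.extend t ∈ Ω k := fun t ht => by
    rw [Path.extend_apply _ ht]; exact hβ _
  have hclN : cl N = 1 := by simp [hcl, hN1]
  have hclN' : cl (-N) = 0 := by
    have : min 1 (-N) ≤ 0 := (min_le_right _ _).trans (by linarith)
    simp [hcl, this]
  obtain ⟨s, hs, t, ht, hx, hy⟩ := crossing_s4 (x1 := fun s => φ (Γ s)) (y1 := fun s => ψ (Γ s))
    (x2 := fun t => φ (β.extend t)) (y2 := fun t => ψ (β.extend t))
    (φ.continuous.comp hΓc) (ψ.continuous.comp hΓc)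
    (φ.continuous.comp β.continuous_extend) (ψ.continuous.comp β.continuous_extend)
    (N := N) (by linarith) (by
      intro t ht
      have := abs_le.1 (hM' _ (hsub k hk (hβ' t ht)))
      have e1 := neg_abs_le (φ (γ sp))
      have e2 := le_abs_self (φ (γ sq))
      have := abs_nonneg (φ (γ sp)); have := abs_nonneg (φ (γ sq))
      constructor
      · simp only [hΓ, hclN', map_add, map_smul, C.hφv]
        simp
        linarith
      · simp only [hΓ, hclN, map_add, map_smul, C.hφv]
        simp
        linarith) (by
      intro s hs
      have := abs_le.1 (hΓψ s)
      simp only [Path.extend_zero, Path.extend_one]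
      constructor <;> linarith)
  have hpt : Γ s = β.extend t := C.ext hx hy
  have hmem : Γ s ∈ Ω k := hpt ▸ hβ' t ht
  rcases lt_or_ge s 0 with h | h
  · exfalso
    have hc0 : cl s = 0 := by
      have : min 1 s ≤ 0 := (min_le_right _ _).trans h.le
      simp [hcl, this]
    refine hout2 s h ?_
    have := hsub k hk hmem
    simpa [hΓ, hc0] using this
  rcases lt_or_ge 1 s with h' | h'
  · exfalso
    have hc1 : cl s = 1 := by simp [hcl, h'.le]
    refine hout1 (s - 1) (by linarith) ?_
    have := hsub k hk hmem
    simpa [hΓ, hc1] using this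
  have hcs : cl s = s := by simp [hcl, h, h']
  refine ⟨Γ s, ?_, subset_closure hmem⟩
  refine ⟨_, hseg s, ?_⟩
  simp [hΓ, hcs]

lemma finite_half (S : Setup K Ω) {φ ψ : ℂ →L[ℝ] ℝ} {v w : ℂ} (C : Co φ ψ v w) {x0 : ℂ} {r : ℝ}
    (hr : 0 < r) (hKr : K ⊆ ball x0 r) (hdet : Dense {c | Det Ω x0 r ψ c}) {η : ℝ} (hη : 0 < η) :
    {k | ∃ a ∈ closure (Ω k), ∃ b ∈ closure (Ω k), ψ a + η ≤ ψ b}.Finite := by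
  have hsub : ∀ k ≠ 0, Ω k ⊆ closedBall x0 r := fun k hk =>
    S.subset_closedBall hr.le (hKr.trans ball_subset_closedBall) hk
  obtain ⟨M, hM⟩ := ((isCompact_closedBall x0 r).image ψ.continuous).isBounded.subset_closedBall 0
  have hM' : ∀ z ∈ closedBall x0 r, |ψ z| ≤ M := fun z hz => by
    have := hM ⟨z, hz, rfl⟩
    simpa using this
  have hgood : ∀ j : ℤ, ∃ c, Det Ω x0 r ψ c ∧ dist (j * (η / 4)) c < η / 16 := fun j => by
    obtain ⟨c, hc, h⟩ := hdet.exists_dist_lt (j * (η / 4)) (by positivity : 0 < η / 16)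
    exact ⟨c, hc, h⟩
  choose c hc hcd using hgood
  set J : ℤ := ⌈(M + η) / (η / 4)⌉ with hJ
  have hfin : (({0} : Set ℕ) ∪ ⋃ j ∈ Icc (-J) J,
      {k | k ≠ 0 ∧ ∃ a ∈ Ω k, ∃ b ∈ Ω k, ψ a ≤ c j - η / 8 ∧ c j + η / 8 ≤ ψ b}).Finite := by
    refine (finite_singleton 0).union ((finite_Icc _ _).biUnion fun j _ => ?_)
    exact S.finite_cross C hr hKr (by positivity) (hc j)
  refine hfin.subset ?_
  rintro k ⟨a, ha, b, hb, hab⟩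
  by_cases hk : k = 0
  · left; exact hk
  right
  have happ : ∀ z ∈ closure (Ω k), ∃ z' ∈ Ω k, |ψ z' - ψ z| < η / 8 := by
    intro z hz
    obtain ⟨z', h1, h2⟩ := mem_closure_iff_nhds.1 hz (ψ ⁻¹' ball (ψ z) (η / 8))
      (ψ.continuous.continuousAt.preimage_mem_nhds (ball_mem_nhds _ (by positivity)))
    exact ⟨z', h2, h1⟩
  obtain ⟨a', ha', haa⟩ := happ a ha
  obtain ⟨b', hb', hbb⟩ := happ b hb
  have haa := abs_lt.1 haa
  have hbb := abs_lt.1 hbb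
  have hMa := abs_le.1 (hM' _ (hsub k hk ha'))
  have hMb := abs_le.1 (hM' _ (hsub k hk hb'))
  set j : ℤ := ⌊ψ a' / (η / 4)⌋ + 2 with hj
  have hj1 : (j : ℝ) * (η / 4) ≤ ψ a' + η / 2 := by
    have := Int.floor_le (ψ a' / (η / 4))
    rw [le_div_iff₀ (by positivity)] at this
    push_cast [hj]
    linarith
  have hj2 : ψ a' + η / 4 < (j : ℝ) * (η / 4) := by
    have := Int.lt_floor_add_one (ψ a' / (η / 4))
    rw [div_lt_iff₀ (by positivity)] at this
    push_cast [hj]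
    linarith
  have hcj := hcd j
  rw [Real.dist_eq, abs_lt] at hcj
  simp only [mem_iUnion]
  refine ⟨j, ?_, hk, a', ha', b', hb', by linarith, by linarith⟩
  have hJ1 : M + η ≤ J * (η / 4) := by
    have := Int.le_ceil ((M + η) / (η / 4))
    rwa [div_le_iff₀ (by positivity)] at this
  have h4 : 0 < η / 4 := by positivity
  constructor
  · have : ((-J : ℤ) : ℝ) ≤ j := by
      push_cast
      by_contra hcon
      push Not at hcon
      have := mul_lt_mul_of_pos_right hcon h4
      linarith
    exact_mod_cast this
  · have : (j : ℝ) ≤ J := by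
      by_contra hcon
      push Not at hcon
      have := mul_lt_mul_of_pos_right hcon h4
      linarith
    exact_mod_cast this

lemma null (S : Setup K Ω) {φ ψ : ℂ →L[ℝ] ℝ} {v w : ℂ} (C : Co φ ψ v w) {x0 : ℂ} {r : ℝ}
    (hr : 0 < r) (hKr : K ⊆ ball x0 r) (hdet : Dense {c | Det Ω x0 r ψ c})
    (hdet' : Dense {c | Det Ω x0 r φ c}) : Null Ω := by
  intro ε hε
  set n := ‖v‖ + ‖w‖ + 1 with hn
  have hn0 : 0 < n := by positivity
  have hη : 0 < ε / n := by positivity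
  refine ((S.finite_half C hr hKr hdet hη).union (S.finite_half C.symm hr hKr hdet' hη)).subset ?_
  rintro k ⟨a, ha, b, hb, hab⟩
  have h := C.dist_le a b
  have key : ε / n ≤ |φ a - φ b| ∨ ε / n ≤ |ψ a - ψ b| := by
    by_contra hcon
    push Not at hcon
    have h1 := mul_le_mul_of_nonneg_right hcon.1.le (norm_nonneg v)
    have h2 := mul_le_mul_of_nonneg_right hcon.2.le (norm_nonneg w)
    have h3 : ε / n * n = ε := by field_simp
    have h4 : ε / n * n = ε / n * ‖v‖ + ε / n * ‖w‖ + ε / n := by rw [hn]; ring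
    linarith
  rcases key with h | h
  · right
    rcases le_abs.1 h with h | h
    · exact ⟨b, hb, a, ha, by linarith⟩
    · exact ⟨a, ha, b, hb, by linarith⟩
  · left
    rcases le_abs.1 h with h | h
    · exact ⟨b, hb, a, ha, by linarith⟩
    · exact ⟨a, ha, b, hb, by linarith⟩

end Setup

lemma subpath_aux {g : ℝ → ℝ} (hg : Continuous g) {s t α β : ℝ} (hst : s ≤ t) (hs : g s ≤ α)
    (hαβ : α ≤ β) (ht : β ≤ g t) :
    ∃ I ⊆ Icc s t, IsPreconnected I ∧ (∀ u ∈ I, α ≤ g u ∧ g u ≤ β) ∧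
      ∀ y ∈ Icc α β, ∃ u ∈ I, g u = y := by
  obtain ⟨s', ⟨hs'I, hs'α⟩, hs'max⟩ := (isCompact_Icc.inter_right
    (isClosed_le hg continuous_const) : IsCompact (Icc s t ∩ {u | g u ≤ α})).exists_isGreatest
    ⟨s, ⟨le_rfl, hst⟩, hs⟩
  obtain ⟨t', ⟨ht'I, ht'β⟩, ht'min⟩ := (isCompact_Icc.inter_right
    (isClosed_le continuous_const hg) : IsCompact (Icc s' t ∩ {u | β ≤ g u})).exists_isLeast
    ⟨t, ⟨hs'I.2, le_rfl⟩, ht⟩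
  simp only [mem_ofPred_eq] at hs'α ht'β
  have hs'eq : g s' = α := by
    obtain ⟨u, hu, hua⟩ := intermediate_value_Icc hs'I.2 hg.continuousOn
      (show α ∈ Icc (g s') (g t) from ⟨hs'α, hαβ.trans ht⟩)
    have := hs'max ⟨⟨hs'I.1.trans hu.1, hu.2⟩, hua.le⟩
    rwa [le_antisymm this hu.1] at hua
  have ht'eq : g t' = β := by
    obtain ⟨u, hu, hua⟩ := intermediate_value_Icc ht'I.1 hg.continuousOn
      (show β ∈ Icc (g s') (g t') from ⟨hs'eq ▸ hαβ, ht'β⟩)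
    have := ht'min ⟨⟨hu.1, hu.2.trans ht'I.2⟩, hua.ge⟩
    rwa [le_antisymm hu.2 this] at hua
  refine ⟨Icc s' t', Icc_subset_Icc hs'I.1 ht'I.2, isPreconnected_Icc, ?_, ?_⟩
  · intro u hu
    constructor
    · by_contra hcon
      push Not at hcon
      have := hs'max ⟨⟨hs'I.1.trans hu.1, hu.2.trans ht'I.2⟩, hcon.le⟩
      rw [le_antisymm this hu.1] at hcon
      exact absurd hs'eq hcon.ne
    · by_contra hcon
      push Not at hcon
      have := ht'min ⟨⟨hu.1, hu.2.trans ht'I.2⟩, hcon.le⟩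
      rw [le_antisymm hu.2 this] at hcon
      exact absurd ht'eq hcon.ne'
  · intro y hy
    have := intermediate_value_Icc ht'I.1 hg.continuousOn
      (show y ∈ Icc (g s') (g t') by rw [hs'eq, ht'eq]; exact hy)
    exact this

lemma subpath {g : ℝ → ℝ} (hg : Continuous g) {s t α β : ℝ} (hs1 : s ∈ Icc (0 : ℝ) 1)
    (ht1 : t ∈ Icc (0 : ℝ) 1) (hs : g s ≤ α) (hαβ : α ≤ β) (ht : β ≤ g t) :
    ∃ I ⊆ Icc (0 : ℝ) 1, IsPreconnected I ∧ (∀ u ∈ I, α ≤ g u ∧ g u ≤ β) ∧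
      ∀ y ∈ Icc α β, ∃ u ∈ I, g u = y := by
  rcases le_total s t with h | h
  · obtain ⟨I, hI, h1⟩ := subpath_aux hg h hs hαβ ht
    exact ⟨I, hI.trans (Icc_subset_Icc hs1.1 ht1.2), h1⟩
  · obtain ⟨I, hI, h1, h2, h3⟩ := subpath_aux (g := fun u => g (-u)) (hg.comp continuous_neg)
      (neg_le_neg h) (by simpa using hs) hαβ (by simpa using ht)
    refine ⟨(fun u => -u) '' I, ?_, h1.image _ continuous_neg.continuousOn, ?_, ?_⟩
    · rintro _ ⟨u, hu, rfl⟩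
      have := hI hu
      have h4 := hs1.2; have h5 := ht1.1
      constructor
      · show 0 ≤ -u
        linarith [this.2]
      · show -u ≤ 1
        linarith [this.1]
    · rintro _ ⟨u, hu, rfl⟩
      exact h2 u hu
    · intro y hy
      obtain ⟨u, hu, hy⟩ := h3 y hy
      exact ⟨_, ⟨u, hu, rfl⟩, hy⟩

lemma single_closure {Ω : ℕ → Set ℂ} {T : Set ℂ} (hT : IsPreconnected T) (hne : T.Nonempty)
    (hsub : T ⊆ ⋃ k, closure (Ω k)) (hfin : {k | (T ∩ closure (Ω k)).Nonempty}.Finite)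
    (hdis : ∀ k l, ∀ z ∈ T, z ∈ closure (Ω k) → z ∈ closure (Ω l) → k = l) :
    ∃ k, T ⊆ closure (Ω k) := by
  obtain ⟨z0, hz0⟩ := hne
  obtain ⟨k, hk⟩ := mem_iUnion.1 (hsub hz0)
  refine ⟨k, ?_⟩
  have hB : IsClosed (⋃ l ∈ {k | (T ∩ closure (Ω k)).Nonempty} \ {k}, closure (Ω l)) :=
    (hfin.subset sdiff_subset).isClosed_biUnion fun _ _ => isClosed_closure
  have hcov : T ⊆ closure (Ω k) ∪
      ⋃ l ∈ {k | (T ∩ closure (Ω k)).Nonempty} \ {k}, closure (Ω l) := by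
    intro z hz
    obtain ⟨l, hl⟩ := mem_iUnion.1 (hsub hz)
    by_cases h : l = k
    · left; exact h ▸ hl
    · right
      simp only [mem_iUnion]
      exact ⟨l, ⟨⟨z, hz, hl⟩, h⟩, hl⟩
  have hdj : T ∩ (closure (Ω k) ∩
      ⋃ l ∈ {k | (T ∩ closure (Ω k)).Nonempty} \ {k}, closure (Ω l)) = ∅ := by
    rw [eq_empty_iff_forall_notMem]
    rintro z ⟨hz, hzk, hz2⟩
    simp only [mem_iUnion] at hz2
    obtain ⟨l, hl, hz2⟩ := hz2
    exact hl.2 (hdis l k z hz hz2 hzk)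
  rcases isPreconnected_iff_subset_of_disjoint_closed.1 hT _ _ (isClosed_closure (s := Ω k)) hB
    hcov hdj with h | h
  · exact h
  · exfalso
    have := h hz0
    simp only [mem_iUnion] at this
    obtain ⟨l, hl, hz⟩ := this
    exact hl.2 (hdis l k z0 hz0 hz hk)

namespace Setup

variable {K : Set ℂ} {Ω : ℕ → Set ℂ}

lemma line_in (S : Setup K Ω) {φ ψ : ℂ →L[ℝ] ℝ} {v w : ℂ} (C : Co φ ψ v w) {x0 : ℂ} {r : ℝ}
    (hr : 0 < r) (hKr : K ⊆ ball x0 r) (hdet' : Dense {c | Det Ω x0 r φ c})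
    {D : Set ℂ}
    (hdis : ∀ k l, ∀ z ∈ D, z ∈ closure (Ω k) → z ∈ closure (Ω l) → k = l)
    {c a b η : ℝ} (hη : 0 < η) (hab : a < b)
    (hD : ∀ z, φ z ∈ Icc a b → |ψ z - c| ≤ η → z ∈ D)
    (hball : ∀ z, φ z ∈ Icc (a - η) (b + η) → ψ z = c → z ∈ closedBall x0 r)
    (hc : Det Ω x0 r ψ c) :
    ∃ k, ∀ y ∈ Icc a b, y • v + c • w ∈ closure (Ω k) := by
  have hF := S.finite_half C.symm hr hKr hdet' (sub_pos.2 hab)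
  have hφ : ∀ y d : ℝ, φ (y • v + d • w) = y := fun y d => by
    simp only [map_add, map_smul, C.hφv, C.hφw, smul_eq_mul, mul_one, mul_zero, add_zero]
  have hψ : ∀ y d : ℝ, ψ (y • v + d • w) = d := fun y d => by
    simp only [map_add, map_smul, C.hψv, C.hψw, smul_eq_mul, mul_one, mul_zero, zero_add]
  have key : ∀ e > 0, ∃ k ∈ {k | ∃ p ∈ closure (Ω k), ∃ q ∈ closure (Ω k), φ p + (b - a) ≤ φ q},
      ∀ y ∈ Icc a b, ∃ z ∈ closure (Ω k), dist z (y • v + c • w) < e := by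
    intro e he
    set d := min η (min (η / (‖φ‖ + 1)) (e / (‖w‖ + 1) / 2)) with hd
    have hd0 : 0 < d := by positivity
    have hd1 : d ≤ η := min_le_left _ _
    have hd2 : ‖φ‖ * d ≤ η := by
      have : d ≤ η / (‖φ‖ + 1) := (min_le_right _ _).trans (min_le_left _ _)
      rw [le_div_iff₀ (by positivity)] at this
      linarith
    have hd3 : d * ‖w‖ < e := by
      have : d ≤ e / (‖w‖ + 1) / 2 := (min_le_right _ _).trans (min_le_right _ _)
      rw [le_div_iff₀ (by positivity), le_div_iff₀ (by positivity)] at this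
      nlinarith [norm_nonneg w]
    have hP := hball ((a - η) • v + c • w) (by rw [hφ]; constructor <;> linarith) (hψ _ _)
    have hQ := hball ((b + η) • v + c • w) (by rw [hφ]; constructor <;> linarith) (hψ _ _)
    obtain ⟨γ, hγ, hγψ, hγd, hγsub, hγfin⟩ := hc d hd0 ⟨_, hP, hψ _ _⟩
    obtain ⟨s, hs, hsd⟩ := hγd _ hP (hψ _ _)
    obtain ⟨t, ht, htd⟩ := hγd _ hQ (hψ _ _)
    have hlip : ∀ p q : ℂ, dist p q ≤ d → |φ p - φ q| ≤ η := fun p q hpq => by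
      rw [← map_sub]
      refine (φ.le_opNorm (p - q)).trans (le_trans ?_ hd2)
      rw [← dist_eq_norm]
      gcongr
    have hs' := abs_le.1 (hlip _ _ hsd)
    have ht' := abs_le.1 (hlip _ _ htd)
    rw [hφ] at hs' ht'
    obtain ⟨I, hI, hIc, hIb, hIs⟩ := subpath (g := fun u => φ (γ u)) (φ.continuous.comp hγ) hs ht
      (α := a) (β := b) (by linarith) hab.le (by linarith)
    have hsubI : γ '' I ⊆ γ '' Icc 0 1 := image_mono hI
    obtain ⟨k, hk⟩ := single_closure (Ω := Ω) (T := γ '' I) (hIc.image _ hγ.continuousOn)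
      (by obtain ⟨u, hu, -⟩ := hIs a ⟨le_rfl, hab.le⟩; exact ⟨_, u, hu, rfl⟩)
      (hsubI.trans hγsub)
      (hγfin.subset fun k hk => hk.mono (inter_subset_inter_left _ hsubI))
      (by
        rintro k l _ ⟨u, hu, rfl⟩
        exact hdis k l _ (hD _ (hIb u hu) ((hγψ u (hI hu)).trans hd1)))
    refine ⟨k, ?_, ?_⟩
    · obtain ⟨u, hu, hua⟩ := hIs a ⟨le_rfl, hab.le⟩
      obtain ⟨u', hu', hub⟩ := hIs b ⟨hab.le, le_rfl⟩
      exact ⟨γ u, hk ⟨u, hu, rfl⟩, γ u', hk ⟨u', hu', rfl⟩, by rw [hua, hub]; linarith⟩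
    · intro y hy
      obtain ⟨u, hu, huy⟩ := hIs y hy
      refine ⟨γ u, hk ⟨u, hu, rfl⟩, ?_⟩
      refine (C.dist_le _ _).trans_lt ?_
      rw [hφ, hψ, huy]
      simp only [sub_self, abs_zero, zero_mul, zero_add]
      refine lt_of_le_of_lt ?_ hd3
      exact mul_le_mul_of_nonneg_right (hγψ u (hI hu)) (norm_nonneg _)
  by_contra hcon
  push Not at hcon
  have hev : ∀ᶠ e in 𝓝[>] (0 : ℝ),
      ∀ k ∈ {k | ∃ p ∈ closure (Ω k), ∃ q ∈ closure (Ω k), φ p + (b - a) ≤ φ q},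
      ¬ ∀ y ∈ Icc a b, ∃ z ∈ closure (Ω k), dist z (y • v + c • w) < e := by
    rw [Filter.eventually_all_finite hF]
    intro k _
    obtain ⟨y, hy, hyk⟩ := hcon k
    rw [Metric.mem_closure_iff] at hyk
    have : ∃ e > 0, ∀ z ∈ closure (Ω k), e ≤ dist z (y • v + c • w) := by
      push Not at hyk
      obtain ⟨e, he, h⟩ := hyk
      refine ⟨e, he, fun z hz => ?_⟩
      have hcl : IsClosed {z | e ≤ dist z (y • v + c • w)} :=
        isClosed_le continuous_const (continuous_id.dist continuous_const)
      exact closure_minimal (fun z hz => by rw [mem_ofPred_eq, dist_comm]; exact h z hz) hcl hz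
    obtain ⟨e, he, h⟩ := this
    filter_upwards [Ioo_mem_nhdsGT he] with e' he' hall
    obtain ⟨z, hz, hzd⟩ := hall y hy
    linarith [h z hz, he'.2]
  obtain ⟨e, he, he0⟩ := (hev.and self_mem_nhdsWithin).exists
  obtain ⟨k, hk, h⟩ := key e he0
  exact he k hk h

lemma touching (S : Setup K Ω) {φ ψ : ℂ →L[ℝ] ℝ} {v w : ℂ} (C : Co φ ψ v w) {x0 : ℂ} {r : ℝ}
    (hr : 0 < r) (hKr : K ⊆ ball x0 r) (hdet : Dense {c | Det Ω x0 r ψ c})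
    (hdet' : Dense {c | Det Ω x0 r φ c}) {x : ℂ} (hx : x ∈ K) {ε : ℝ} (hε : 0 < ε) :
    ∃ k l, k ≠ l ∧ ∃ p, dist p x < ε ∧ p ∈ closure (Ω k) ∧ p ∈ closure (Ω l) := by
  by_contra hcon
  push Not at hcon
  obtain ⟨ρ0, hρ0, hρ0r⟩ := Metric.isOpen_ball.mem_nhds (hKr hx) |> Metric.mem_nhds_iff.1
  set ρ := min ρ0 ε with hρ
  have hρp : 0 < ρ := lt_min hρ0 hε
  have hρr : ball x ρ ⊆ closedBall x0 r :=
    (ball_subset_ball (min_le_left _ _)).trans (hρ0r.trans ball_subset_closedBall)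
  have hdis : ∀ k l, ∀ z ∈ ball x ρ, z ∈ closure (Ω k) → z ∈ closure (Ω l) → k = l := by
    intro k l z hz hzk hzl
    by_contra hkl
    exact hcon k l hkl z (lt_of_lt_of_le hz (min_le_right _ _)) hzk hzl
  set n := ‖v‖ + ‖w‖ + 1 with hn
  have hn0 : 0 < n := by positivity
  set η := ρ / n / 2 with hη
  have hη0 : 0 < η := by positivity
  have hηn : 2 * η * n = ρ := by rw [hη]; field_simp
  have hbox : ∀ z, |φ z - φ x| ≤ 2 * η → |ψ z - ψ x| ≤ 2 * η → z ∈ ball x ρ := by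
    intro z h1 h2
    rw [mem_ball]
    refine (C.dist_le z x).trans_lt ?_
    have := mul_le_mul_of_nonneg_right h1 (norm_nonneg v)
    have := mul_le_mul_of_nonneg_right h2 (norm_nonneg w)
    have h4 : 2 * η * n = 2 * η * ‖v‖ + 2 * η * ‖w‖ + 2 * η := by rw [hn]; ring
    linarith
  have hφ : ∀ y d : ℝ, φ (y • v + d • w) = y := fun y d => by
    simp only [map_add, map_smul, C.hφv, C.hφw, smul_eq_mul, mul_one, mul_zero, add_zero]
  have hψ : ∀ y d : ℝ, ψ (y • v + d • w) = d := fun y d => by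
    simp only [map_add, map_smul, C.hψv, C.hψw, smul_eq_mul, mul_one, mul_zero, zero_add]
  have hH : ∀ c, Det Ω x0 r ψ c → |c - ψ x| < η →
      ∃ k, ∀ y ∈ Icc (φ x - η) (φ x + η), y • v + c • w ∈ closure (Ω k) := by
    intro c hc hcx
    have hcx := abs_lt.1 hcx
    refine S.line_in C hr hKr hdet' hdis hη0 (by linarith) ?_ ?_ hc
    · intro z h1 h2
      have h2 := abs_le.1 h2
      exact hbox z (abs_le.2 ⟨by linarith [h1.1], by linarith [h1.2]⟩)
        (abs_le.2 ⟨by linarith, by linarith⟩)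
    · intro z h1 h2
      exact hρr (hbox z (abs_le.2 ⟨by linarith [h1.1], by linarith [h1.2]⟩)
        (abs_le.2 ⟨by linarith, by linarith⟩))
  have hV : ∀ c, Det Ω x0 r φ c → |c - φ x| < η →
      ∃ k, ∀ y ∈ Icc (ψ x - η) (ψ x + η), y • w + c • v ∈ closure (Ω k) := by
    intro c hc hcx
    have hcx := abs_lt.1 hcx
    refine S.line_in C.symm hr hKr hdet hdis hη0 (by linarith) ?_ ?_ hc
    · intro z h1 h2
      have h2 := abs_le.1 h2
      exact hbox z (abs_le.2 ⟨by linarith, by linarith⟩)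
        (abs_le.2 ⟨by linarith [h1.1], by linarith [h1.2]⟩)
    · intro z h1 h2
      exact hρr (hbox z (abs_le.2 ⟨by linarith, by linarith⟩)
        (abs_le.2 ⟨by linarith [h1.1], by linarith [h1.2]⟩))
  obtain ⟨d, hd, hdx⟩ := hdet'.exists_dist_lt (φ x) hη0
  rw [dist_comm, Real.dist_eq] at hdx
  obtain ⟨k, hk⟩ := hV d hd hdx
  have hdx := abs_lt.1 hdx
  have hH' : ∀ c, Det Ω x0 r ψ c → |c - ψ x| < η →
      ∀ y ∈ Icc (φ x - η) (φ x + η), y • v + c • w ∈ closure (Ω k) := by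
    intro c hc hcx
    obtain ⟨l, hl⟩ := hH c hc hcx
    have hcx := abs_lt.1 hcx
    have h1 := hl d ⟨by linarith, by linarith⟩
    have h2 := hk c ⟨by linarith, by linarith⟩
    rw [add_comm] at h2
    have := hdis k l (d • v + c • w) (hbox _
      (by rw [hφ]; exact abs_le.2 ⟨by linarith, by linarith⟩)
      (by rw [hψ]; exact abs_le.2 ⟨by linarith, by linarith⟩)) h2 h1
    rw [this]; exact hl
  refine S.not_mem_interior hx k ?_
  rw [mem_interior]
  refine ⟨{z | |φ z - φ x| < η} ∩ {z | |ψ z - ψ x| < η}, ?_, ?_, by simp [hη0]⟩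
  · rintro z ⟨h1, h2⟩
    simp only [mem_ofPred_eq] at h1 h2
    have ho : IsOpen {c : ℝ | |c - ψ x| < η} :=
      isOpen_lt (by fun_prop) continuous_const
    have hmem := hdet.open_subset_closure_inter ho (show ψ z ∈ _ from h2)
    have hcl : IsClosed {c : ℝ | φ z • v + c • w ∈ closure (Ω k)} :=
      isClosed_closure.preimage (by fun_prop)
    have h3 := closure_minimal (t := {c : ℝ | φ z • v + c • w ∈ closure (Ω k)}) (fun c hc => ?_) hcl hmem
    · rw [C.hz z]; exact h3
    · have h1 := abs_lt.1 h1
      exact hH' c hc.2 hc.1 _ ⟨by linarith, by linarith⟩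
  · exact (isOpen_lt (by fun_prop) continuous_const).inter (isOpen_lt (by fun_prop) continuous_const)

lemma conclude (S : Setup K Ω) {φ ψ : ℂ →L[ℝ] ℝ} {v w : ℂ} (C : Co φ ψ v w) {x0 : ℂ} {r : ℝ}
    (hr : 0 < r) (hKr : K ⊆ ball x0 r) (hdet : Dense {c | Det Ω x0 r ψ c})
    (hdet' : Dense {c | Det Ω x0 r φ c}) {x : ℂ} (hx : x ∈ K) {ε : ℝ} (hε : 0 < ε) :
    ∃ p, dist p x < ε ∧ ∃ U ⊆ K, p ∈ U ∧ (∃ O, IsOpen O ∧ U = K ∩ O) ∧ IsConnected U ∧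
      ¬ IsPreconnected (U \ {p}) := by
  have hN := S.null C hr hKr hdet hdet'
  obtain ⟨k, l, hkl, p, hpx, hpk, hpl⟩ := S.touching C hr hKr hdet hdet' hx hε
  have hpK : p ∈ K := by
    by_contra hp
    obtain ⟨j, hj⟩ := (S.hcover p).1 hp
    exact hkl ((S.eq_of_mem_closure hj hpk).symm.trans (S.eq_of_mem_closure hj hpl))
  refine ⟨p, hpx, ?_⟩
  by_cases hk : k = 0
  · exact S.local_cut hN hkl.symm (by rintro rfl; exact hkl hk) (S.mem_frontier hpl hpK)
      (S.mem_frontier hpk hpK)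
  · exact S.local_cut hN hkl hk (S.mem_frontier hpk hpK) (S.mem_frontier hpl hpK)

end Setup

lemma dense_det {Ω : ℕ → Set (EuclideanSpace ℝ (Fin 2))} (e : EuclideanSpace ℝ (Fin 2) ≃ₗᵢ[ℝ] ℂ)
    {x u u' : EuclideanSpace ℝ (Fin 2)} {r : ℝ} {f g : EuclideanSpace ℝ (Fin 2) →L[ℝ] ℝ}
    (hgu : g u = 0) (hgu' : g u' = 1) (hz : ∀ z, z = f z • u + g z • u')
    (h : ∀ᵐ w : ↥(Submodule.span ℝ {u})ᗮ,
        HasDetourProperty Ω (closedBall x r) (lineThrough (w : EuclideanSpace ℝ (Fin 2)) u)) :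
    Dense {c | Det (fun k => e '' Ω k) (e x) r
      (g.comp (e.symm.toContinuousLinearEquiv : ℂ →L[ℝ] EuclideanSpace ℝ (Fin 2))) c} := by
  have hD := Measure.dense_of_ae h
  have hsurj : Function.Surjective
      (fun w : ↥(Submodule.span ℝ {u})ᗮ => g (w : EuclideanSpace ℝ (Fin 2))) := by
    intro c
    obtain ⟨y, hy, z, hz1, hyz⟩ := (Submodule.span ℝ {u}).exists_add_mem_mem_orthogonal (c • u')
    obtain ⟨t, rfl⟩ := Submodule.mem_span_singleton.1 hy
    refine ⟨⟨z, hz1⟩, ?_⟩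
    have h1 := congrArg g hyz
    simp only [map_add, map_smul, hgu, hgu', smul_eq_mul, mul_one, mul_zero, zero_add] at h1
    exact h1.symm
  refine (hsurj.denseRange.dense_image (g.continuous.comp continuous_subtype_val) hD).mono ?_
  rintro _ ⟨w, hw, rfl⟩
  have hw' : HasDetourProperty Ω (closedBall x r)
    (lineThrough (w : EuclideanSpace ℝ (Fin 2)) u) := hw
  have hline : ∀ z, z ∈ lineThrough (w : EuclideanSpace ℝ (Fin 2)) u ↔
      g z = g (w : EuclideanSpace ℝ (Fin 2)) := by
    intro z
    constructor
    · rintro ⟨t, rfl⟩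
      simp only [map_add, map_smul, hgu, smul_zero, add_zero]
    · intro h1
      refine ⟨f z - f (w : EuclideanSpace ℝ (Fin 2)), ?_⟩
      have h2 := hz z
      have h3 := hz (w : EuclideanSpace ℝ (Fin 2))
      rw [h1] at h2
      generalize f z = a at *
      generalize f (w : EuclideanSpace ℝ (Fin 2)) = b at *
      generalize g (w : EuclideanSpace ℝ (Fin 2)) = c at *
      rw [h2, h3]
      module
  intro ε hε hne
  obtain ⟨z0, hz0, hz0c⟩ := hne
  set d := ε / (‖g‖ + 1) with hd
  have hd0 : 0 < d := by positivity
  have hgd : ‖g‖ * d ≤ ε := by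
    have : (‖g‖ + 1) * d = ε := by rw [hd]; field_simp
    linarith
  have hdε : d ≤ ε := div_le_self hε.le (by linarith [norm_nonneg g])
  obtain ⟨γ, hγ, hγd, hγs, hγf, -⟩ := hw' (d / 2) (by positivity)
  have hcpt : IsCompact (γ '' Icc 0 1) := isCompact_Icc.image_of_continuousOn hγ
  have hfin : hausdorffEDist (γ '' Icc 0 1)
      (lineThrough (w : EuclideanSpace ℝ (Fin 2)) u ∩ closedBall x r) ≠ ⊤ := by
    refine hausdorffEDist_ne_top_of_nonempty_of_bounded ⟨_, 0, ⟨le_rfl, zero_le_one⟩, rfl⟩ ?_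
      hcpt.isBounded (isBounded_closedBall.subset inter_subset_right)
    refine ⟨e.symm z0, (hline _).2 hz0c, ?_⟩
    rw [mem_closedBall] at hz0 ⊢
    rw [← e.dist_map, e.apply_symm_apply]
    exact hz0
  have hlt := hγd.trans_lt (half_lt_self hd0)
  set cl : ℝ → ℝ := fun t => max 0 (min 1 t) with hcl
  have hclc : Continuous cl := by fun_prop
  have hclI : ∀ t, cl t ∈ Icc (0 : ℝ) 1 := fun t =>
    ⟨le_max_left _ _, max_le zero_le_one (min_le_left _ _)⟩
  have hcls : ∀ t ∈ Icc (0 : ℝ) 1, cl t = t := fun t ht => by simp [hcl, ht.1, ht.2]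
  have himg : (fun t => e (γ (cl t))) '' Icc 0 1 = e '' (γ '' Icc 0 1) := by
    rw [image_image]
    exact image_congr fun t ht => by rw [hcls t ht]
  have hcle : ∀ k, closure (e '' Ω k) = e '' closure (Ω k) := fun k =>
    (e.toHomeomorph.image_closure (Ω k)).symm
  refine ⟨fun t => e (γ (cl t)), e.continuous.comp (hγ.comp_continuous hclc hclI), ?_, ?_, ?_, ?_⟩
  · intro t ht
    obtain ⟨y, hy, hyd⟩ := exists_dist_lt_of_hausdorffDist_lt
      (mem_image_of_mem γ (hclI t)) hlt hfin
    have h1 : g y = g (w : EuclideanSpace ℝ (Fin 2)) := (hline y).1 hy.1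
    have h2 : (g.comp (e.symm.toContinuousLinearEquiv : ℂ →L[ℝ] EuclideanSpace ℝ (Fin 2)))
        (e (γ (cl t))) = g (γ (cl t)) := by simp
    rw [h2]
    show |g (γ (cl t)) - g (w : EuclideanSpace ℝ (Fin 2))| ≤ ε
    rw [← h1, ← map_sub]
    refine (g.le_opNorm _).trans (le_trans ?_ hgd)
    rw [← dist_eq_norm]
    gcongr
  · intro z hzb hzc
    have hzm : e.symm z ∈ lineThrough (w : EuclideanSpace ℝ (Fin 2)) u ∩ closedBall x r := by
      refine ⟨(hline _).2 hzc, ?_⟩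
      rw [mem_closedBall] at hzb ⊢
      rw [← e.dist_map, e.apply_symm_apply]
      exact hzb
    obtain ⟨_, ⟨t, ht, rfl⟩, hyd⟩ := exists_dist_lt_of_hausdorffDist_lt' hzm hlt hfin
    refine ⟨t, ht, ?_⟩
    simp only [hcls t ht]
    rw [← e.apply_symm_apply z, e.dist_map]
    exact hyd.le.trans hdε
  · rw [himg]
    rintro _ ⟨y, hy, rfl⟩
    obtain ⟨k, hk⟩ := mem_iUnion.1 (hγs hy)
    exact mem_iUnion.2 ⟨k, by rw [hcle]; exact ⟨y, hk, rfl⟩⟩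
  · rw [himg]
    refine hγf.subset ?_
    rintro k ⟨_, ⟨y, hy, rfl⟩, hyk⟩
    rw [hcle] at hyk
    obtain ⟨y', hy', hyy⟩ := hyk
    rw [e.injective hyy] at hy'
    exact ⟨y, hy, hy'⟩

lemma jc_image (e : EuclideanSpace ℝ (Fin 2) ≃ₗᵢ[ℝ] ℂ) {J : Set (EuclideanSpace ℝ (Fin 2))}
    (hJ : IsJordanCurve J) : JC (e '' J) := by
  obtain ⟨f, hf, hinj, rfl⟩ := hJ
  have hmem : ∀ c : Circle, e.symm (c : ℂ) ∈ sphere (0 : EuclideanSpace ℝ (Fin 2)) 1 := by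
    intro c
    rw [mem_sphere_zero_iff_norm, e.symm.norm_map]
    exact Circle.norm_coe c
  refine ⟨fun c => e (f ⟨e.symm c, hmem c⟩), ?_, ?_, ?_⟩
  · refine e.continuous.comp (hf.comp ?_)
    exact (e.symm.continuous.comp continuous_subtype_val).subtype_mk hmem
  · intro c c' h
    have h1 := hinj (e.injective h)
    simp only [Subtype.mk.injEq] at h1
    exact Circle.ext (e.symm.injective h1)
  · ext z
    constructor
    · rintro ⟨c, rfl⟩
      exact ⟨_, ⟨_, rfl⟩, rfl⟩
    · rintro ⟨_, ⟨y, rfl⟩, rfl⟩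
      have hy : ‖e (y : EuclideanSpace ℝ (Fin 2))‖ = 1 := by
        rw [e.norm_map]; exact mem_sphere_zero_iff_norm.1 y.2
      refine ⟨⟨e y, mem_sphere_zero_iff_norm.2 hy⟩, ?_⟩
      simp

lemma setup_image (e : EuclideanSpace ℝ (Fin 2) ≃ₗᵢ[ℝ] ℂ) {K : Set (EuclideanSpace ℝ (Fin 2))}
    {Ω : ℕ → Set (EuclideanSpace ℝ (Fin 2))} (hK : IsDetourSet 2 K Ω)
    (h0 : IsUnboundedJordanRegion (Ω 0))
    (hk : ∀ k : ℕ, k ≠ 0 → IsJordanRegion (Ω k)) :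
    Setup (e '' K) (fun k => e '' Ω k) := by
  have hKo : IsOpen Kᶜ := hK.compact.isClosed.isOpen_compl
  have hcomp : ∀ k z, z ∈ Ω k → z ∈ Kᶜ ∧ Ω k = connectedComponentIn Kᶜ z := by
    intro k z hz
    obtain ⟨x, hx, hxk⟩ := hK.component k
    rw [hxk] at hz ⊢
    exact ⟨connectedComponentIn_subset _ _ hz, connectedComponentIn_eq hz⟩
  refine ⟨hK.compact.image e.continuous, ?_, ?_, ?_, ?_, ?_, ?_, ?_⟩
  · intro k
    obtain ⟨x, hx, hxk⟩ := hK.component k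
    exact e.toHomeomorph.isOpenMap _ (hxk ▸ hKo.connectedComponentIn)
  · intro k
    obtain ⟨x, hx, hxk⟩ := hK.component k
    have : IsPreconnected (Ω k) := hxk ▸ isPreconnected_connectedComponentIn
    exact this.image _ e.continuous.continuousOn
  · intro k
    obtain ⟨x, hx, hxk⟩ := hK.component k
    exact ⟨e x, x, hxk ▸ mem_connectedComponentIn hx, rfl⟩
  · rintro k l _ ⟨z, hz, rfl⟩ ⟨z', hz', hzz⟩
    rw [e.injective hzz] at hz'
    exact hK.inj ((hcomp k z hz).2.trans (hcomp l z hz').2.symm)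
  · intro z
    constructor
    · intro hz
      have hz' : e.symm z ∈ Kᶜ := fun h => hz ⟨_, h, e.apply_symm_apply z⟩
      obtain ⟨k, hk⟩ := hK.surj _ hz'
      exact ⟨k, e.symm z, hk ▸ mem_connectedComponentIn hz', e.apply_symm_apply z⟩
    · rintro ⟨k, y, hy, rfl⟩ ⟨y', hy', hyy⟩
      rw [e.injective hyy] at hy'
      exact (hcomp k y hy).1 hy'
  · intro k hk0
    exact e.lipschitz.isBounded_image (hK.bounded k hk0)
  · intro k
    have : frontier (e '' Ω k) = e '' frontier (Ω k) := (e.toHomeomorph.image_frontier (Ω k)).symm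
    rw [this]
    apply jc_image
    by_cases hk0 : k = 0
    · rw [hk0]; exact h0.1
    · exact (hk k hk0).2

theorem statement4 (K : Set (EuclideanSpace ℝ (Fin 2)))
    (Ω : ℕ → Set (EuclideanSpace ℝ (Fin 2))) (hK : IsDetourSet 2 K Ω)
    (h0 : IsUnboundedJordanRegion (Ω 0))
    (hk : ∀ k : ℕ, k ≠ 0 → IsJordanRegion (Ω k)) :
    Dense {x : K | IsLocalCutPoint K x} := by
  let e : EuclideanSpace ℝ (Fin 2) ≃ₗᵢ[ℝ] ℂ := Complex.orthonormalBasisOneI.repr.symm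
  have S := setup_image e hK h0 hk
  obtain ⟨x0, r, hr, hKr, v, hv, hdet⟩ := hK.detour
  let b := basisOfLinearIndependentOfCardEqFinrank hv (by simp)
  have hb : ∀ i, b i = v i := fun i => by simp [b]
  let f : EuclideanSpace ℝ (Fin 2) →L[ℝ] ℝ := LinearMap.toContinuousLinearMap (b.coord 0)
  let g : EuclideanSpace ℝ (Fin 2) →L[ℝ] ℝ := LinearMap.toContinuousLinearMap (b.coord 1)
  have hf0 : f (v 0) = 1 := by rw [← hb]; simp [f]
  have hf1 : f (v 1) = 0 := by rw [← hb]; simp [f]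
  have hg0 : g (v 0) = 0 := by rw [← hb]; simp [g]
  have hg1 : g (v 1) = 1 := by rw [← hb]; simp [g]
  have hfg : ∀ z, z = f z • v 0 + g z • v 1 := by
    intro z
    have := b.sum_repr z
    rw [Fin.sum_univ_two, hb, hb] at this
    exact this.symm
  let es : ℂ →L[ℝ] EuclideanSpace ℝ (Fin 2) := e.symm.toContinuousLinearEquiv
  have hes : ∀ z, es (e z) = z := fun z => e.symm_apply_apply z
  have C : Co (f.comp es) (g.comp es) (e (v 0)) (e (v 1)) := by
    refine ⟨?_, ?_, ?_, ?_, ?_⟩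
    · rw [ContinuousLinearMap.comp_apply, hes, hf0]
    · rw [ContinuousLinearMap.comp_apply, hes, hf1]
    · rw [ContinuousLinearMap.comp_apply, hes, hg0]
    · rw [ContinuousLinearMap.comp_apply, hes, hg1]
    · intro z
      obtain ⟨y, rfl⟩ := e.surjective z
      rw [ContinuousLinearMap.comp_apply, ContinuousLinearMap.comp_apply, hes, ← map_smul,
        ← map_smul, ← map_add, ← hfg]
  have hd1 := dense_det e (f := f) (g := g) hg0 hg1 hfg (hdet 0)
  have hd2 := dense_det e (f := g) (g := f) hf1 hf0
    (fun z => by rw [add_comm]; exact hfg z) (hdet 1)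
  have hKr' : e '' K ⊆ ball (e x0) r := by
    rintro _ ⟨y, hy, rfl⟩
    rw [mem_ball, e.dist_map]
    exact hKr hy
  rw [Metric.dense_iff]
  intro x ε hε
  obtain ⟨p, hpx, U, hUK, hpU, ⟨O, hO, hUO⟩, hUc, hUn⟩ :=
    S.conclude C hr hKr' hd1 hd2 (x := e x) ⟨x, x.2, rfl⟩ hε
  obtain ⟨q, hq, rfl⟩ := hUK hpU
  let i : K → ℂ := fun y => e y
  have hi : Topology.IsEmbedding i := e.toHomeomorph.isEmbedding.comp Topology.IsEmbedding.subtypeVal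
  have hiU : i '' (i ⁻¹' U) = U := by
    rw [image_preimage_eq_iff]
    intro z hz
    obtain ⟨y, hy, rfl⟩ := hUK hz
    exact ⟨⟨y, hy⟩, rfl⟩
  refine ⟨⟨q, hq⟩, ?_, i ⁻¹' U, ?_, hpU, ?_, ?_⟩
  · rw [e.dist_map] at hpx
    exact hpx
  · have : i ⁻¹' U = i ⁻¹' O := by
      ext y
      rw [hUO]
      exact ⟨fun h => h.2, fun h => ⟨⟨y, y.2, rfl⟩, h⟩⟩
    rw [this]
    exact hO.preimage hi.continuous
  · refine ⟨⟨⟨q, hq⟩, hpU⟩, ?_⟩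
    rw [← hi.isInducing.isPreconnected_image, hiU]
    exact hUc.2
  · rw [← hi.isInducing.isPreconnected_image, image_sdiff hi.injective, hiU, image_singleton]
    exact hUn
end

section
/- Let K ⊆ ℝ² be a detour set whose complementary components are Jordan regions when regarded as subsets of the Riemann sphere (i.e., each bounded component Ω_k, k ≥ 1, is a Jordan region, and the unbounded component Ω₀ is an unbounded Jordan region). Then for every complementary component Ω_k there exists an index l ≠ k such that cl(Ω_k) ∩ cl(Ω_l) ≠ ∅. -/
open MeasureTheory Metric Set Filter
open scoped ENNReal NNReal Topology

section Helpers

variable {K : Set (EuclideanSpace ℝ (Fin 2))} {Ω : ℕ → Set (EuclideanSpace ℝ (Fin 2))}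

lemma comp_open (hK : IsDetourSet 2 K Ω) (k : ℕ) : IsOpen (Ω k) := by
  obtain ⟨x, -, h⟩ := hK.component k
  rw [h]
  exact hK.compact.isClosed.isOpen_compl.connectedComponentIn

lemma comp_eq (hK : IsDetourSet 2 K Ω) {k l : ℕ} {x : EuclideanSpace ℝ (Fin 2)}
    (h1 : x ∈ Ω k) (h2 : x ∈ Ω l) : k = l := by
  obtain ⟨y, -, hy⟩ := hK.component k
  obtain ⟨z, -, hz⟩ := hK.component l
  apply hK.inj
  rw [hy] at h1
  rw [hz] at h2
  rw [hy, hz, connectedComponentIn_eq h1, connectedComponentIn_eq h2]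

/-- Points outside the ball lie in the unbounded component. -/
lemma outside_mem (hK : IsDetourSet 2 K Ω) {x : EuclideanSpace ℝ (Fin 2)} {r : ℝ}
    (hr : 0 < r) (hKB : K ⊆ ball x r) {q : EuclideanSpace ℝ (Fin 2)} (hq : r ≤ dist q x) :
    q ∈ Ω 0 := by
  have hqK : q ∈ Kᶜ := fun h => absurd (hKB h) (by simpa using hq)
  obtain ⟨m, hm⟩ := hK.surj q hqK
  let g : ℝ → EuclideanSpace ℝ (Fin 2) := fun s => x + s • (q - x)
  have hg : Continuous g := by fun_prop
  have hpre : IsPreconnected (g '' Ici 1) := isPreconnected_Ici.image g hg.continuousOn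
  have hdist : ∀ s : ℝ, 1 ≤ s → dist (g s) x = s * dist q x := by
    intro s hs
    simp [g, dist_eq_norm, norm_smul, abs_of_nonneg (by linarith : (0:ℝ) ≤ s)]
  have hsub : g '' Ici 1 ⊆ Kᶜ := by
    rintro _ ⟨s, hs, rfl⟩ h
    have h1 := hKB h
    rw [mem_ball, hdist s hs] at h1
    have hs' : (1:ℝ) ≤ s := hs
    nlinarith
  have hqg : q ∈ g '' Ici 1 := ⟨1, by simp, by simp [g]⟩
  have hin : g '' Ici 1 ⊆ Ω m := by
    rw [hm]
    exact hpre.subset_connectedComponentIn hqg hsub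
  have hm0 : m = 0 := by
    by_contra hne
    obtain ⟨R, hR⟩ := ((hK.bounded m hne).subset hin).subset_closedBall x
    have hs : (1:ℝ) ≤ 1 + |R| / r := by
      have : 0 ≤ |R| / r := by positivity
      linarith
    have h2 := hR ⟨1 + |R| / r, hs, rfl⟩
    rw [mem_closedBall, hdist _ hs] at h2
    have h3 : |R| / r * r = |R| := by field_simp
    have h4 : (1 + |R| / r) * r ≤ (1 + |R| / r) * dist q x := by gcongr
    have := le_abs_self R
    nlinarith
  rw [← hm0]
  exact hin hqg

/-- A line through a point of a ball in a nonzero direction meets the sphere. -/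
lemma exists_sphere {x p v : EuclideanSpace ℝ (Fin 2)} {r : ℝ} (hv : v ≠ 0)
    (hp : dist p x ≤ r) : ∃ t : ℝ, dist (p + t • v) x = r := by
  have hc : Continuous (fun t : ℝ => dist (p + t • v) x) := by fun_prop
  have hv' : 0 < ‖v‖ := norm_pos_iff.mpr hv
  have hr : 0 ≤ r := dist_nonneg.trans hp
  let T := 2 * r / ‖v‖
  have hT : 0 ≤ T := by positivity
  have hbig : r ≤ dist (p + T • v) x := by
    have h1 : ‖T • v‖ = 2 * r := by
      rw [norm_smul, Real.norm_of_nonneg hT]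
      simp only [T]
      field_simp
    have h2 : dist (p + T • v) p ≤ dist (p + T • v) x + dist x p := dist_triangle _ _ _
    rw [dist_eq_norm, add_sub_cancel_left, h1, dist_comm x p] at h2
    linarith
  obtain ⟨t, -, ht⟩ := intermediate_value_Icc hT hc.continuousOn
    (show r ∈ Icc _ _ from ⟨by simpa using hp, hbig⟩)
  exact ⟨t, ht⟩

/-- There is a good line through any component. -/
lemma exists_line (hK : IsDetourSet 2 K Ω) (j : ℕ) {v : EuclideanSpace ℝ (Fin 2)}
    {B : Set (EuclideanSpace ℝ (Fin 2))}
    (h : ∀ᵐ w : ↥(Submodule.span ℝ {v})ᗮ,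
        HasDetourProperty Ω B (lineThrough (w : EuclideanSpace ℝ (Fin 2)) v)) :
    ∃ w : EuclideanSpace ℝ (Fin 2), HasDetourProperty Ω B (lineThrough w v) ∧
      ∃ t : ℝ, w + t • v ∈ Ω j := by
  obtain ⟨p, hpK, hp⟩ := hK.component j
  have hpj : p ∈ Ω j := by rw [hp]; exact mem_connectedComponentIn hpK
  obtain ⟨a, ha, b, hb, hab⟩ := (Submodule.span ℝ {v}).exists_add_mem_mem_orthogonal p
  obtain ⟨t, rfl⟩ := Submodule.mem_span_singleton.mp ha
  have hd := Measure.dense_of_ae h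
  have ho : IsOpen {w : ↥(Submodule.span ℝ {v})ᗮ |
      (w : EuclideanSpace ℝ (Fin 2)) + t • v ∈ Ω j} :=
    (comp_open hK j).preimage (by fun_prop)
  obtain ⟨w, hw1, hw2⟩ := hd.inter_open_nonempty _ ho
    ⟨⟨b, hb⟩, by
      show b + t • v ∈ Ω j
      rw [add_comm, ← hab]
      exact hpj⟩
  exact ⟨w, hw2, t, hw1⟩

end Helpers

theorem statement5 (K : Set (EuclideanSpace ℝ (Fin 2)))
    (Ω : ℕ → Set (EuclideanSpace ℝ (Fin 2))) (hK : IsDetourSet 2 K Ω)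
    (h0 : IsUnboundedJordanRegion (Ω 0))
    (hk : ∀ k : ℕ, k ≠ 0 → IsJordanRegion (Ω k)) :
    ∀ k : ℕ, ∃ l : ℕ, l ≠ k ∧ (closure (Ω k) ∩ closure (Ω l)).Nonempty := by
  intro k
  obtain ⟨x, r, hr, hKB, v, hv, hae⟩ := hK.detour
  obtain ⟨j, hj0, hkj⟩ : ∃ j, j ≠ 0 ∧ (k = j ∨ k = 0) := by
    by_cases h : k = 0
    · exact ⟨1, one_ne_zero, Or.inr h⟩
    · exact ⟨k, h, Or.inl rfl⟩
  obtain ⟨w, hw, t, ht⟩ := exists_line hK j (hae 0)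
  set p := w + t • v 0 with hpdef
  have hpB : dist p x ≤ r := by
    by_contra hcon
    exact hj0 (comp_eq hK ht (outside_mem hK hr hKB (not_le.mp hcon).le))
  obtain ⟨s, hs⟩ := exists_sphere (hv.ne_zero 0) hpB
  set q := p + s • v 0 with hqdef
  have hq0 : q ∈ Ω 0 := outside_mem hK hr hKB hs.ge
  have hpL : p ∈ lineThrough w (v 0) ∩ closedBall x r := ⟨⟨t, rfl⟩, hpB⟩
  have hqL : q ∈ lineThrough w (v 0) ∩ closedBall x r :=
    ⟨⟨t + s, by rw [hqdef, hpdef, add_smul, add_assoc]⟩, hs.le⟩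
  obtain ⟨e1, he1, hb1⟩ := Metric.isOpen_iff.mp (comp_open hK j) p ht
  obtain ⟨e2, he2, hb2⟩ := Metric.isOpen_iff.mp (comp_open hK 0) q hq0
  have hmin : 0 < min e1 e2 := lt_min he1 he2
  obtain ⟨γ, hγ, hH, hcov, hfin, -⟩ := hw (min e1 e2 / 2) (by linarith)
  have hH' : hausdorffDist (γ '' Icc 0 1) (lineThrough w (v 0) ∩ closedBall x r) < min e1 e2 := by
    linarith
  have hne : (γ '' Icc (0:ℝ) 1).Nonempty := ⟨γ 0, 0, by simp, rfl⟩
  have hbd : Bornology.IsBounded (γ '' Icc (0:ℝ) 1) := (isCompact_Icc.image_of_continuousOn hγ).isBounded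
  have hfine := Metric.hausdorffEDist_ne_top_of_nonempty_of_bounded hne ⟨p, hpL⟩ hbd
    (isBounded_closedBall.subset inter_subset_right)
  obtain ⟨p', hp', hpp⟩ := exists_dist_lt_of_hausdorffDist_lt' hpL hH' hfine
  obtain ⟨q', hq', hqq⟩ := exists_dist_lt_of_hausdorffDist_lt' hqL hH' hfine
  have hpj : p' ∈ Ω j := hb1 (lt_of_lt_of_le hpp (min_le_left _ _))
  have hq0' : q' ∈ Ω 0 := hb2 (lt_of_lt_of_le hqq (min_le_right _ _))
  set S := {k | (γ '' Icc 0 1 ∩ closure (Ω k)).Nonempty} with hS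
  have hcl : IsClosed (⋃ l ∈ S \ {k}, closure (Ω l)) :=
    (hfin.subset diff_subset).isClosed_biUnion (fun _ _ => isClosed_closure)
  have hpre : IsPreconnected (γ '' Icc (0:ℝ) 1) := isPreconnected_Icc.image γ hγ
  have key : ∀ y ∈ γ '' Icc (0:ℝ) 1, ∀ l, l ≠ k → y ∈ closure (Ω l) →
      y ∈ ⋃ l ∈ S \ {k}, closure (Ω l) := by
    intro y hy l hl hyl
    exact mem_biUnion (show l ∈ S \ {k} from ⟨⟨y, hy, hyl⟩, hl⟩) hyl
  have hsub : γ '' Icc (0:ℝ) 1 ⊆ closure (Ω k) ∪ ⋃ l ∈ S \ {k}, closure (Ω l) := by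
    intro y hy
    obtain ⟨l, hl⟩ := mem_iUnion.mp (hcov hy)
    by_cases h : l = k
    · exact Or.inl (h ▸ hl)
    · exact Or.inr (key y hy l h hl)
  have hboth : (γ '' Icc (0:ℝ) 1 ∩ closure (Ω k)).Nonempty ∧
      (γ '' Icc (0:ℝ) 1 ∩ ⋃ l ∈ S \ {k}, closure (Ω l)).Nonempty := by
    rcases hkj with h | h
    · exact ⟨⟨p', hp', h ▸ subset_closure hpj⟩,
        ⟨q', hq', key q' hq' 0 (h ▸ hj0.symm) (subset_closure hq0')⟩⟩
    · exact ⟨⟨q', hq', h ▸ subset_closure hq0'⟩,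
        ⟨p', hp', key p' hp' j (h ▸ hj0) (subset_closure hpj)⟩⟩
  obtain ⟨y, -, hy1, hy2⟩ := isPreconnected_closed_iff.mp hpre _ _ isClosed_closure hcl hsub
    hboth.1 hboth.2
  obtain ⟨l, hl, hyl⟩ := mem_iUnion₂.mp hy2
  exact ⟨l, hl.2, y, hy1, hyl⟩
end
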